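/- The limit superior of the sequence (f_n : ℝ)/p_n (as n → ∞, along the atTop filter) is at most 4. -/

import Mathlib

open Filter Pointwise

/-- `nthPrime n` is the `n`-th prime number (1-indexed): `nthPrime 1 = 2`, etc. -/
noncomputable def nthPrime (n : ℕ) : ℕ := Nat.nth Nat.Prime (n - 1)

/-- `S n` is the additive submonoid of `ℕ` generated by the primes `q ≥ nthPrime n`. -/
def S (n : ℕ) : AddSubmonoid ℕ :=
  AddSubmonoid.closure {q : ℕ | q.Prime ∧ nthPrime n ≤ q}

/-- `frob n` is the Frobenius number of `S n`: the largest natural number not in `S n`. -/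
noncomputable def frob (n : ℕ) : ℕ := sSup {m : ℕ | m ∉ S n}

/-- `genus n` is the number of natural numbers not in `S n`. -/
noncomputable def genus (n : ℕ) : ℕ := {m : ℕ | m ∉ S n}.ncard

/-- `atoms n` is the minimal generating set `S n \ {0} \ ((S n \ {0}) + (S n \ {0}))`. -/
def atoms (n : ℕ) : Set ℕ :=
  ((S n : Set ℕ) \ {0}) \ (((S n : Set ℕ) \ {0}) + ((S n : Set ℕ) \ {0}))

/-- `u n` is the largest atom of `S n`. -/
noncomputable def u (n : ℕ) : ℕ := sSup (atoms n)

/-- `e n` is the embedding dimension of `S n`: the number of atoms. -/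
noncomputable def e (n : ℕ) : ℕ := (atoms n).ncard

namespace Vino

open Finset

/-- The additive character `x ↦ exp(2πix)`. -/
noncomputable def ee (x : ℝ) : ℂ := Complex.exp ((2 * Real.pi * x : ℝ) * Complex.I)

@[simp] lemma norm_ee (x : ℝ) : ‖ee x‖ = 1 := by
  unfold ee; exact Complex.norm_exp_ofReal_mul_I _

lemma ee_add (x y : ℝ) : ee (x + y) = ee x * ee y := by
  unfold ee; rw [← Complex.exp_add]; congr 1; push_cast; ring

@[simp] lemma ee_zero : ee 0 = 1 := by simp [ee]

lemma ee_neg (x : ℝ) : ee (-x) = (starRingEnd ℂ) (ee x) := by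
  unfold ee
  rw [← Complex.exp_conj]
  congr 1
  rw [map_mul, Complex.conj_ofReal, Complex.conj_I]
  push_cast; ring

lemma ee_sub (x y : ℝ) : ee (x - y) = ee x * (starRingEnd ℂ) (ee y) := by
  rw [sub_eq_add_neg, ee_add, ee_neg]

@[simp] lemma ee_int (n : ℤ) : ee n = 1 := by
  unfold ee
  rw [Complex.exp_eq_one_iff]
  exact ⟨n, by push_cast; ring⟩

lemma ee_add_int (x : ℝ) (n : ℤ) : ee (x + n) = ee x := by
  rw [ee_add, ee_int, mul_one]

lemma ee_nat_mul (n : ℕ) (x : ℝ) : ee (n * x) = ee x ^ n := by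
  unfold ee; rw [← Complex.exp_nat_mul]; congr 1; push_cast; ring

lemma ee_eq_one_iff (x : ℝ) : ee x = 1 ↔ ∃ n : ℤ, x = n := by
  unfold ee
  rw [Complex.exp_eq_one_iff]
  constructor
  · rintro ⟨n, hn⟩
    refine ⟨n, ?_⟩
    have h2 : ((2 * Real.pi * x : ℝ) : ℂ) = ((n * (2 * Real.pi) : ℝ) : ℂ) := by
      apply mul_right_cancel₀ Complex.I_ne_zero
      rw [hn]; push_cast; ring
    have h3 := Complex.ofReal_injective h2
    have hp := Real.pi_pos
    field_simp at h3
    linarith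
  · rintro ⟨n, rfl⟩
    exact ⟨n, by push_cast; ring⟩

/-- The distance to the nearest integer. -/
noncomputable def nn (x : ℝ) : ℝ := ‖(x : UnitAddCircle)‖

lemma nn_eq (x : ℝ) : nn x = |x - round x| := UnitAddCircle.norm_eq

lemma coe_int_circle (n : ℤ) : ((n : ℝ) : UnitAddCircle) = 0 := by
  rw [AddCircle.coe_eq_zero_iff]
  exact ⟨n, by simp⟩

lemma nn_add_int (x : ℝ) (n : ℤ) : nn (x + n) = nn x := by
  unfold nn; rw [AddCircle.coe_add, coe_int_circle, add_zero]

lemma nn_sub_le (x y : ℝ) : nn (x - y) ≤ nn x + nn y := by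
  unfold nn; rw [AddCircle.coe_sub]; exact norm_sub_le _ _

lemma nn_le_abs_sub (x : ℝ) (n : ℤ) : nn x ≤ |x - n| := by
  rw [nn_eq]; exact round_le x n

lemma nn_le_half (x : ℝ) : nn x ≤ 1 / 2 := by
  rw [nn_eq]; exact abs_sub_round x

lemma norm_ee_sub_one (x : ℝ) : ‖ee x - 1‖ = 2 * |Real.sin (Real.pi * x)| := by
  have h : ee x = Complex.exp (Complex.I * ((2 * Real.pi * x : ℝ) : ℂ)) := by
    unfold ee; rw [mul_comm]
  rw [h, Complex.norm_exp_I_mul_ofReal_sub_one]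
  rw [Real.norm_eq_abs, abs_mul]
  norm_num
  congr 1; ring_nf

lemma norm_ee_sub_one_le (x : ℝ) : ‖ee x - 1‖ ≤ 2 * Real.pi * |x| := by
  rw [norm_ee_sub_one]
  have h := Real.abs_sin_le_abs (x := Real.pi * x)
  rw [abs_mul, abs_of_pos Real.pi_pos] at h
  linarith

lemma four_nn_le (x : ℝ) : 4 * nn x ≤ ‖ee x - 1‖ := by
  set y := x - round x with hy
  have h1 : ee x = ee y := by
    rw [show x = y + (round x : ℤ) by rw [hy]; ring, ee_add_int]
  have h2 : nn x = |y| := nn_eq x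
  have h3 : |y| ≤ 1 / 2 := abs_sub_round x
  rw [h1, h2, norm_ee_sub_one]
  have h4 : |Real.sin (Real.pi * y)| = Real.sin (Real.pi * |y|) := by
    rcases le_total 0 y with h | h
    · rw [abs_of_nonneg h] at *
      exact abs_of_nonneg (Real.sin_nonneg_of_nonneg_of_le_pi (by have := Real.pi_pos; positivity)
        (by have := Real.pi_pos; nlinarith))
    · rw [abs_of_nonpos h] at *
      rw [mul_neg, Real.sin_neg]
      have : 0 ≤ Real.sin (Real.pi * -y) := Real.sin_nonneg_of_nonneg_of_le_pi
        (mul_nonneg Real.pi_pos.le (by linarith)) (by have := Real.pi_pos; nlinarith)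
      rw [mul_neg, Real.sin_neg] at this
      exact abs_of_nonpos (by linarith)
  rw [h4]
  have h5 := Real.mul_le_sin (x := Real.pi * |y|) (by have := Real.pi_pos; positivity)
    (by have := Real.pi_pos; nlinarith)
  have h6 : 2 / Real.pi * (Real.pi * |y|) = 2 * |y| := by
    have := Real.pi_pos; field_simp
  linarith

/-- The geometric exponential sum. -/
noncomputable def geo (H : ℕ) (t : ℝ) : ℂ := ∑ n ∈ range H, ee (n * t)

lemma norm_geo_le (H : ℕ) (t : ℝ) : ‖geo H t‖ ≤ H := by
  unfold geo
  refine (norm_sum_le _ _).trans ?_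
  simp

lemma geo_zero (H : ℕ) : geo H 0 = H := by simp [geo]

lemma geo_add_int (H : ℕ) (t : ℝ) (k : ℤ) : geo H (t + k) = geo H t := by
  unfold geo
  refine sum_congr rfl fun n _ => ?_
  rw [show (n : ℝ) * (t + k) = n * t + ((n * k : ℤ) : ℝ) by push_cast; ring, ee_add_int]

lemma norm_geo_mul_nn_le (H : ℕ) (t : ℝ) : ‖geo H t‖ * (2 * nn t) ≤ 1 := by
  have h1 : geo H t * (ee t - 1) = ee (H * t) - 1 := by
    unfold geo
    simp_rw [ee_nat_mul]
    exact geom_sum_mul _ _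
  have h2 : ‖geo H t‖ * ‖ee t - 1‖ ≤ 2 := by
    rw [← norm_mul, h1]
    refine (norm_sub_le _ _).trans ?_
    rw [norm_ee]; norm_num
  have h3 := four_nn_le t
  have := mul_le_mul_of_nonneg_left h3 (norm_nonneg (geo H t))
  linarith

lemma norm_geo_le_inv (H : ℕ) {t d : ℝ} (hd : 0 < d) (h : d ≤ nn t) :
    ‖geo H t‖ ≤ 1 / (2 * d) := by
  rw [le_div_iff₀ (by positivity)]
  have := norm_geo_mul_nn_le H t
  have h2 := mul_le_mul_of_nonneg_left h (norm_nonneg (geo H t))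
  linarith

lemma sum_ee_div {P : ℕ} (hP : 0 < P) (k : ℤ) :
    ∑ j ∈ range P, ee (j * (k / P)) = if (P : ℤ) ∣ k then (P : ℂ) else 0 := by
  have hP' : (P : ℝ) ≠ 0 := by positivity
  split_ifs with h
  · obtain ⟨m, rfl⟩ := h
    have : ∀ j ∈ range P, ee (j * (((P * m : ℤ) : ℝ) / P)) = 1 := by
      intro j _
      rw [show (j : ℝ) * (((P * m : ℤ) : ℝ) / P) = ((j * m : ℤ) : ℝ) by
        push_cast; field_simp, ee_int]
    rw [sum_congr rfl this]; simp
  · have h1 : (∑ j ∈ range P, ee (j * (k / P))) * (ee (k / P) - 1) = 0 := by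
      simp_rw [ee_nat_mul]
      rw [geom_sum_mul, ← ee_nat_mul, show (P : ℝ) * (k / P) = (k : ℤ) by field_simp, ee_int,
        sub_self]
    rcases mul_eq_zero.1 h1 with h2 | h2
    · exact h2
    · exfalso
      rw [sub_eq_zero, ee_eq_one_iff] at h2
      obtain ⟨n, hn⟩ := h2
      apply h
      refine ⟨n, ?_⟩
      field_simp at hn
      exact_mod_cast hn

end Vino

namespace Vino

open Finset

/-- The exponential sum of a real sequence over `[0, H)`. -/
noncomputable def expS (H : ℕ) (a : ℕ → ℝ) (t : ℝ) : ℂ := ∑ n ∈ range H, (a n : ℂ) * ee (n * t)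

lemma expS_neg (H : ℕ) (a : ℕ → ℝ) (t : ℝ) : expS H a (-t) = (starRingEnd ℂ) (expS H a t) := by
  unfold expS
  rw [map_sum]
  refine sum_congr rfl fun n _ => ?_
  rw [map_mul, Complex.conj_ofReal, ← ee_neg]
  congr 2; ring

lemma expS_add_int (H : ℕ) (a : ℕ → ℝ) (t : ℝ) (k : ℤ) : expS H a (t + k) = expS H a t := by
  unfold expS
  refine sum_congr rfl fun n _ => ?_
  rw [show (n : ℝ) * (t + k) = n * t + ((n * k : ℤ) : ℝ) by push_cast; ring, ee_add_int]

lemma normSq_sum {ι : Type*} (s : Finset ι) (z : ι → ℂ) :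
    ((‖∑ i ∈ s, z i‖ ^ 2 : ℝ) : ℂ) = ∑ i ∈ s, ∑ j ∈ s, z i * (starRingEnd ℂ) (z j) := by
  rw [← sum_mul_sum, ← map_sum, Complex.mul_conj, Complex.normSq_eq_norm_sq]

lemma parseval_aux {P : ℕ} (hP : 0 < P) (c : ℕ → ℂ) :
    ∑ n ∈ range P, ‖∑ j ∈ range P, c j * ee (n * (j / P))‖ ^ 2
      = P * ∑ j ∈ range P, ‖c j‖ ^ 2 := by
  have key : ((∑ n ∈ range P, ‖∑ j ∈ range P, c j * ee (n * (j / P))‖ ^ 2 : ℝ) : ℂ)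
      = ((P * ∑ j ∈ range P, ‖c j‖ ^ 2 : ℝ) : ℂ) := by
    rw [Complex.ofReal_sum]
    simp_rw [normSq_sum]
    rw [sum_comm]
    have h1 : ∀ i ∈ range P, (∑ y ∈ range P, ∑ x ∈ range P,
        c i * ee (y * (i / P)) * (starRingEnd ℂ) (c x * ee (y * (x / P)))) = P * ‖c i‖ ^ 2 := by
      intro i hi
      rw [sum_comm]
      have h2 : ∀ x ∈ range P, (∑ y ∈ range P,
          c i * ee (y * (i / P)) * (starRingEnd ℂ) (c x * ee (y * (x / P))))
          = if x = i then (P : ℂ) * (c i * (starRingEnd ℂ) (c i)) else 0 := by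
        intro x hx
        have h3 : ∀ y ∈ range P, c i * ee (y * (i / P)) * (starRingEnd ℂ) (c x * ee (y * (x / P)))
            = c i * (starRingEnd ℂ) (c x) * ee (y * (((i - x : ℤ) : ℝ) / P)) := by
          intro y _
          rw [show (y : ℝ) * (((i - x : ℤ) : ℝ) / P) = y * (i / P) - y * (x / P) by
            push_cast; ring, ee_sub, map_mul]
          ring
        rw [sum_congr rfl h3, ← mul_sum, sum_ee_div hP]
        by_cases hxi : x = i
        · subst hxi; simp; ring
        · rw [if_neg hxi, if_neg, mul_zero]
          intro hd
          have h4 := Int.eq_zero_of_abs_lt_dvd hd (by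
            have := mem_range.1 hi; have := mem_range.1 hx
            rw [abs_lt]; constructor <;> omega)
          omega
      rw [sum_congr rfl h2, sum_ite_eq' (range P) i, if_pos hi, Complex.mul_conj,
        Complex.normSq_eq_norm_sq]
      push_cast; ring
    rw [sum_congr rfl h1]
    push_cast
    rw [mul_sum]
  exact_mod_cast key

lemma parseval_dual {P H : ℕ} (hP : 0 < P) (hH : H ≤ P) {J : Finset ℕ} (hJ : J ⊆ range P)
    (c : ℕ → ℂ) :
    ∑ n ∈ range H, ‖∑ j ∈ J, c j * ee (n * (j / P))‖ ^ 2 ≤ P * ∑ j ∈ J, ‖c j‖ ^ 2 := by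
  classical
  have h := parseval_aux hP (fun j => if j ∈ J then c j else 0)
  have h1 : ∀ n : ℕ, ∑ j ∈ range P, (if j ∈ J then c j else 0) * ee (n * (j / P))
      = ∑ j ∈ J, c j * ee (n * (j / P)) := by
    intro n
    rw [← sum_subset hJ]
    · exact sum_congr rfl fun j hj => by rw [if_pos hj]
    · intro j _ hj; rw [if_neg hj, zero_mul]
  have h2 : ∑ j ∈ range P, ‖if j ∈ J then c j else 0‖ ^ 2 = ∑ j ∈ J, ‖c j‖ ^ 2 := by
    rw [← sum_subset hJ]
    · exact sum_congr rfl fun j hj => by rw [if_pos hj]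
    · intro j _ hj; rw [if_neg hj]; simp
  simp_rw [h1] at h
  rw [h2] at h
  rw [← h]
  exact sum_le_sum_of_subset_of_nonneg (range_subset_range.2 hH) fun _ _ _ => by positivity

lemma parseval_expS {P H : ℕ} (hP : 0 < P) (hH : H ≤ P) (a : ℕ → ℝ) :
    ∑ j ∈ range P, ‖expS H a (j / P)‖ ^ 2 = P * ∑ n ∈ range H, a n ^ 2 := by
  have h := parseval_aux hP (fun n => if n ∈ range H then (a n : ℂ) else 0)
  have hJ := range_subset_range.2 hH
  have h1 : ∀ n : ℕ, ∑ j ∈ range P, (if j ∈ range H then (a j : ℂ) else 0) * ee (n * (j / P))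
      = expS H a (n / P) := by
    intro n
    unfold expS
    rw [← sum_subset hJ]
    · refine sum_congr rfl fun j hj => ?_
      rw [if_pos hj]; congr 2; ring
    · intro j _ hj; rw [if_neg hj, zero_mul]
  have h2 : ∑ j ∈ range P, ‖if j ∈ range H then (a j : ℂ) else 0‖ ^ 2
      = ∑ n ∈ range H, a n ^ 2 := by
    rw [← sum_subset hJ]
    · exact sum_congr rfl fun j hj => by rw [if_pos hj]; simp
    · intro j _ hj; rw [if_neg hj]; simp
  simp_rw [h1] at h
  rw [h2] at h
  exact h

/-- Expansion of a weighted mean square of a product of two trigonometric polynomials. -/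
lemma sum_normSq_prod {ι κ : Type*} (I : Finset ι) (X : Finset κ) (θ : ι → ℝ) (v : κ → ℝ)
    (γ : ι → ℂ) (ω : κ → ℂ) (H : ℕ) :
    ((∑ n ∈ range H, ‖(∑ x ∈ X, ω x * ee (n * v x)) * ∑ i ∈ I, γ i * ee (n * θ i)‖ ^ 2 : ℝ) : ℂ)
      = ∑ x ∈ X, ∑ y ∈ X, ∑ i ∈ I, ∑ j ∈ I, ω x * (starRingEnd ℂ) (ω y) * (γ i *
        (starRingEnd ℂ) (γ j)) * geo H (θ i - θ j + v x - v y) := by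
  have h : ∀ n ∈ range H,
      ((‖(∑ x ∈ X, ω x * ee (n * v x)) * ∑ i ∈ I, γ i * ee (n * θ i)‖ ^ 2 : ℝ) : ℂ)
      = ∑ x ∈ X, ∑ y ∈ X, ∑ i ∈ I, ∑ j ∈ I, ω x * (starRingEnd ℂ) (ω y) * (γ i *
        (starRingEnd ℂ) (γ j)) * ee (n * (θ i - θ j + v x - v y)) := by
    intro n _
    rw [norm_mul, mul_pow, Complex.ofReal_mul, normSq_sum, normSq_sum, sum_mul]
    refine sum_congr rfl fun x _ => ?_
    rw [sum_mul]
    refine sum_congr rfl fun y _ => ?_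
    rw [mul_sum]
    refine sum_congr rfl fun i _ => ?_
    rw [mul_sum]
    refine sum_congr rfl fun j _ => ?_
    rw [show (n : ℝ) * (θ i - θ j + v x - v y) = (n * v x - n * v y) + (n * θ i - n * θ j) by ring,
      ee_add, ee_sub, ee_sub, map_mul, map_mul]
    ring
  rw [Complex.ofReal_sum, sum_congr rfl h, sum_comm]
  refine sum_congr rfl fun x _ => ?_
  rw [sum_comm]
  refine sum_congr rfl fun y _ => ?_
  rw [sum_comm]
  refine sum_congr rfl fun i _ => ?_
  rw [sum_comm]
  refine sum_congr rfl fun j _ => ?_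
  rw [geo, mul_sum]

lemma sum_normSq_one {ι : Type*} (I : Finset ι) (θ : ι → ℝ) (γ : ι → ℂ) (H : ℕ) :
    ((∑ n ∈ range H, ‖∑ i ∈ I, γ i * ee (n * θ i)‖ ^ 2 : ℝ) : ℂ)
      = ∑ i ∈ I, ∑ j ∈ I, (γ i * (starRingEnd ℂ) (γ j)) * geo H (θ i - θ j) := by
  have h := sum_normSq_prod I ({()} : Finset Unit) θ (fun _ => 0) γ (fun _ => 1) H
  simpa using h

lemma sum_norm_sq_le_card {ι : Type*} (I : Finset ι) (γ : ι → ℂ) :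
    ∑ i ∈ I, ∑ j ∈ I, ‖γ i‖ * ‖γ j‖ ≤ #I * ∑ i ∈ I, ‖γ i‖ ^ 2 := by
  rw [← sum_mul_sum, ← sq]
  exact sq_sum_le_card_mul_sum_sq

/-- The abstract dual sieve inequality. -/
lemma dual_sieve {ι κ : Type*} [DecidableEq κ] (I : Finset ι) (X : Finset κ) (θ : ι → ℝ)
    (v : κ → ℝ) (ω : κ → ℂ) (H : ℕ) (a : ℕ → ℝ) {G B E Q : ℝ} (hQ : ∑ x ∈ X, ‖ω x‖ ^ 2 = Q)
    (hB0 : 0 ≤ B) (hE0 : 0 ≤ E)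
    (hD : ∀ n ∈ range H, a n ≠ 0 → ∑ x ∈ X, ω x * ee (n * v x) = G)
    (hB : ∀ γ : ι → ℂ, ∑ n ∈ range H, ‖∑ i ∈ I, γ i * ee (n * θ i)‖ ^ 2
      ≤ B * ∑ i ∈ I, ‖γ i‖ ^ 2)
    (hE : ∀ i ∈ I, ∀ j ∈ I, ∑ x ∈ X, ∑ y ∈ X.erase x, ‖ω x‖ * ‖ω y‖ *
      ‖geo H (θ i - θ j + v x - v y)‖ ≤ E) :
    G ^ 2 * ∑ i ∈ I, ‖expS H a (θ i)‖ ^ 2 ≤ (∑ n ∈ range H, a n ^ 2) * (Q * B + #I * E) := by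
  have hQ0 : 0 ≤ Q := by rw [← hQ]; positivity
  set γ : ι → ℂ := fun i => (starRingEnd ℂ) (expS H a (θ i)) with hγ
  set D : ℕ → ℂ := fun n => ∑ x ∈ X, ω x * ee (n * v x) with hDdef
  set Γ : ℕ → ℂ := fun n => ∑ i ∈ I, γ i * ee (n * θ i) with hΓ
  set T2 := ∑ i ∈ I, ‖expS H a (θ i)‖ ^ 2 with hT
  have hT' : T2 = ∑ i ∈ I, ‖γ i‖ ^ 2 := by
    refine sum_congr rfl fun i _ => ?_
    rw [hγ]; simp
  have hT0 : 0 ≤ T2 := by positivity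
  have h1 : ((G * T2 : ℝ) : ℂ) = ∑ n ∈ range H, (a n : ℂ) * (D n * Γ n) := by
    have h2 : ∀ n ∈ range H, (a n : ℂ) * (D n * Γ n) = G * ((a n : ℂ) * Γ n) := by
      intro n hn
      by_cases h0 : a n = 0
      · simp [h0]
      · rw [hDdef]; simp only; rw [hD n hn h0]; ring
    rw [sum_congr rfl h2, ← mul_sum]
    push_cast
    congr 1
    rw [hT]
    push_cast
    simp_rw [hΓ, mul_sum]
    rw [sum_comm]
    refine sum_congr rfl fun i _ => ?_
    have : (‖expS H a (θ i)‖ : ℂ) ^ 2 = γ i * expS H a (θ i) := by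
      rw [hγ]; simp only
      rw [mul_comm, Complex.mul_conj, Complex.normSq_eq_norm_sq]; push_cast; rfl
    rw [this, expS, mul_sum]
    exact sum_congr rfl fun n _ => by ring
  have h3 : (G * T2) ^ 2 ≤ (∑ n ∈ range H, a n ^ 2) * ∑ n ∈ range H, ‖D n * Γ n‖ ^ 2 := by
    have h4 : |G * T2| ≤ ∑ n ∈ range H, |a n| * ‖D n * Γ n‖ := by
      rw [← Real.norm_eq_abs, ← Complex.norm_real, h1]
      refine (norm_sum_le _ _).trans (sum_le_sum fun n _ => ?_)
      rw [norm_mul, Complex.norm_real, Real.norm_eq_abs]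
    calc (G * T2) ^ 2 = |G * T2| ^ 2 := (sq_abs _).symm
      _ ≤ (∑ n ∈ range H, |a n| * ‖D n * Γ n‖) ^ 2 := by gcongr
      _ ≤ (∑ n ∈ range H, |a n| ^ 2) * ∑ n ∈ range H, ‖D n * Γ n‖ ^ 2 :=
        sum_mul_sq_le_sq_mul_sq _ _ _
      _ = _ := by simp_rw [sq_abs]
  have h5 : ∑ n ∈ range H, ‖D n * Γ n‖ ^ 2 ≤ (Q * B + #I * E) * T2 := by
    have h6 := sum_normSq_prod I X θ v γ ω H
    have h7 := sum_normSq_one I θ γ H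
    have h8 : ((∑ n ∈ range H, ‖D n * Γ n‖ ^ 2 : ℝ) : ℂ)
        = ((Q * ∑ n ∈ range H, ‖Γ n‖ ^ 2 : ℝ) : ℂ) + ∑ x ∈ X, ∑ y ∈ X.erase x,
          ∑ i ∈ I, ∑ j ∈ I, ω x * (starRingEnd ℂ) (ω y) * (γ i *
          (starRingEnd ℂ) (γ j)) * geo H (θ i - θ j + v x - v y) := by
      rw [h6, Complex.ofReal_mul, h7, ← hQ, Complex.ofReal_sum, sum_mul, ← sum_add_distrib]
      refine sum_congr rfl fun x hx => ?_
      rw [← add_sum_erase X _ hx]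
      congr 1
      rw [mul_sum]
      refine sum_congr rfl fun i _ => ?_
      rw [mul_sum]
      refine sum_congr rfl fun j _ => ?_
      rw [Complex.mul_conj, Complex.normSq_eq_norm_sq, add_sub_cancel_right]
      ring
    have h9 : ‖∑ x ∈ X, ∑ y ∈ X.erase x, ∑ i ∈ I, ∑ j ∈ I, ω x * (starRingEnd ℂ) (ω y) * (γ i *
          (starRingEnd ℂ) (γ j)) * geo H (θ i - θ j + v x - v y)‖ ≤ (#I * E) * T2 := by
      calc _ ≤ ∑ x ∈ X, ∑ y ∈ X.erase x, ∑ i ∈ I, ∑ j ∈ I, (‖γ i‖ * ‖γ j‖) *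
            (‖ω x‖ * ‖ω y‖ * ‖geo H (θ i - θ j + v x - v y)‖) := by
            refine (norm_sum_le _ _).trans (sum_le_sum fun x _ => ?_)
            refine (norm_sum_le _ _).trans (sum_le_sum fun y _ => ?_)
            refine (norm_sum_le _ _).trans (sum_le_sum fun i _ => ?_)
            refine (norm_sum_le _ _).trans (sum_le_sum fun j _ => ?_)
            simp only [norm_mul, RCLike.norm_conj]
            apply le_of_eq; ring
        _ = ∑ i ∈ I, ∑ j ∈ I, (‖γ i‖ * ‖γ j‖) * ∑ x ∈ X, ∑ y ∈ X.erase x,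
            (‖ω x‖ * ‖ω y‖ * ‖geo H (θ i - θ j + v x - v y)‖) := by
            simp_rw [mul_sum]
            have hc : ∀ x, (∑ y ∈ X.erase x, ∑ i ∈ I, ∑ j ∈ I, (‖γ i‖ * ‖γ j‖) *
                (‖ω x‖ * ‖ω y‖ * ‖geo H (θ i - θ j + v x - v y)‖)) = ∑ i ∈ I, ∑ j ∈ I,
                ∑ y ∈ X.erase x, (‖γ i‖ * ‖γ j‖) *
                (‖ω x‖ * ‖ω y‖ * ‖geo H (θ i - θ j + v x - v y)‖) := by
              intro x
              rw [sum_comm]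
              exact sum_congr rfl fun i _ => sum_comm
            rw [sum_congr rfl fun x _ => hc x, sum_comm]
            exact sum_congr rfl fun i _ => sum_comm
        _ ≤ ∑ i ∈ I, ∑ j ∈ I, (‖γ i‖ * ‖γ j‖) * E := by
            refine sum_le_sum fun i hi => sum_le_sum fun j hj => ?_
            exact mul_le_mul_of_nonneg_left (hE i hi j hj) (by positivity)
        _ = E * ∑ i ∈ I, ∑ j ∈ I, (‖γ i‖ * ‖γ j‖) := by
            simp_rw [mul_sum]
            exact sum_congr rfl fun i _ => sum_congr rfl fun j _ => by ring
        _ ≤ E * (#I * ∑ i ∈ I, ‖γ i‖ ^ 2) := by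
            gcongr; exact sum_norm_sq_le_card I γ
        _ = _ := by rw [← hT']; ring
    have h10 : ∑ n ∈ range H, ‖D n * Γ n‖ ^ 2 ≤ Q * ∑ n ∈ range H, ‖Γ n‖ ^ 2 + (#I * E) * T2 := by
      have h11 : ‖((∑ n ∈ range H, ‖D n * Γ n‖ ^ 2 : ℝ) : ℂ)‖
          = ∑ n ∈ range H, ‖D n * Γ n‖ ^ 2 := by
        rw [Complex.norm_real, Real.norm_of_nonneg (by positivity)]
      rw [← h11, h8]
      refine (norm_add_le _ _).trans (add_le_add ?_ h9)
      rw [Complex.norm_real, Real.norm_of_nonneg (by positivity)]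
    have h12 := mul_le_mul_of_nonneg_left (hB γ) hQ0
    rw [← hT'] at h12
    calc _ ≤ _ := h10
      _ ≤ Q * (B * T2) + (#I * E) * T2 := by gcongr
      _ = _ := by ring
  rcases hT0.eq_or_lt with h0 | h0
  · rw [← h0]
    have h13 : 0 ≤ ∑ n ∈ range H, a n ^ 2 := by positivity
    rw [mul_zero]
    positivity
  · have h14 : 0 ≤ ∑ n ∈ range H, a n ^ 2 := by positivity
    have h15 := h3.trans (mul_le_mul_of_nonneg_left h5 h14)
    have : (G ^ 2 * T2) * T2 ≤ ((∑ n ∈ range H, a n ^ 2) * (Q * B + #I * E)) * T2 := by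
      nlinarith
    exact le_of_mul_le_mul_right this h0

end Vino

namespace Vino

open Finset

lemma sum_moebius_gcd (c d : ℕ) (hd : 0 < d) :
    (∑ e ∈ d.divisors with e ∣ c, (ArithmeticFunction.moebius e : ℤ)) =
      if Nat.Coprime c d then 1 else 0 := by
  have h1 : d.divisors.filter (fun e => e ∣ c) = (Nat.gcd c d).divisors := by
    ext e
    have : Nat.gcd c d ≠ 0 := (Nat.gcd_pos_of_pos_right _ hd).ne'
    simp only [mem_filter, Nat.mem_divisors, Nat.dvd_gcd_iff]
    have := hd.ne'
    tauto
  rw [h1, ← ArithmeticFunction.coe_mul_zeta_apply, ArithmeticFunction.moebius_mul_coe_zeta,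
    ArithmeticFunction.one_apply]

/-- Ramanujan sums at arguments coprime to the modulus. -/
lemma ramanujan_sum {d : ℕ} (hd : 0 < d) {m : ℕ} (hm : Nat.Coprime m d) :
    ∑ c ∈ (range d).filter (fun c => Nat.Coprime c d), ee ((c : ℝ) * ((m : ℝ) / d)) =
      (ArithmeticFunction.moebius d : ℂ) := by
  have h1 : ∀ c : ℕ, (if Nat.Coprime c d then ee ((c : ℝ) * ((m : ℝ) / d)) else 0) =
      ∑ e ∈ d.divisors, if e ∣ c then
        (ArithmeticFunction.moebius e : ℂ) * ee ((c : ℝ) * ((m : ℝ) / d)) else 0 := by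
    intro c
    have h := congrArg (fun z : ℤ => (z : ℂ)) (sum_moebius_gcd c d hd)
    rw [← sum_filter, ← sum_mul]
    push_cast at h
    rw [h]
    split_ifs <;> simp
  rw [sum_filter, sum_congr rfl (fun c _ => h1 c), sum_comm]
  rw [sum_eq_single d]
  · rw [← sum_filter]
    have : (range d).filter (fun c => d ∣ c) = {0} := by
      ext c
      simp only [mem_filter, mem_range, mem_singleton]
      constructor
      · rintro ⟨h, h'⟩
        exact Nat.eq_zero_of_dvd_of_lt h' h
      · rintro rfl
        exact ⟨hd, dvd_zero _⟩
    rw [this]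
    simp [ee_zero]
  · intro e he hne
    rw [Nat.mem_divisors] at he
    obtain ⟨⟨k, hk⟩, _⟩ := he
    have he0 : 0 < e := Nat.pos_of_ne_zero (by rintro rfl; simp at hk; omega)
    have hk0 : 0 < k := Nat.pos_of_ne_zero (by rintro rfl; simp at hk; omega)
    rw [← sum_filter]
    have himg : (range d).filter (fun c => e ∣ c) = (range k).image (fun c => e * c) := by
      ext c
      simp only [mem_filter, mem_range, mem_image]
      constructor
      · rintro ⟨h, ⟨c', rfl⟩⟩
        exact ⟨c', by rw [hk] at h; exact Nat.lt_of_mul_lt_mul_left h, rfl⟩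
      · rintro ⟨c', h, rfl⟩
        exact ⟨by rw [hk]; exact Nat.mul_lt_mul_of_pos_left h he0, dvd_mul_right _ _⟩
    rw [himg, sum_image (by intro a _ b _ h; exact Nat.eq_of_mul_eq_mul_left he0 h), ← mul_sum]
    have h2 : ∀ c ∈ range k, ee (((e * c : ℕ) : ℝ) * ((m : ℝ) / d)) =
        ee ((c : ℝ) * (((m : ℤ) : ℝ) / k)) := by
      intro c _
      congr 1
      rw [hk]
      push_cast
      have : (e : ℝ) ≠ 0 := by positivity
      have : (k : ℝ) ≠ 0 := by positivity
      field_simp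
    rw [sum_congr rfl h2, sum_ee_div hk0, if_neg, mul_zero]
    intro hdiv
    have hkm : k ∣ m := by exact_mod_cast hdiv
    have hkd : k ∣ d := ⟨e, by rw [hk, mul_comm]⟩
    have := Nat.eq_one_of_dvd_coprimes hm hkm hkd
    apply hne
    rw [hk, this, mul_one]
  · intro h
    exact absurd (Nat.mem_divisors_self d hd.ne') h

/-- The reduced fractions `c / d` with `d ∈ D`, as pairs. -/
def fareyIdx (D : Finset ℕ) : Finset (Σ _ : ℕ, ℕ) :=
  D.sigma fun d => (range d).filter (fun c => Nat.Coprime c d)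

/-- The sieve sum `∑ 1 / φ(d)`. -/
noncomputable def sieveG (D : Finset ℕ) : ℝ := ∑ d ∈ D, (1 : ℝ) / d.totient

lemma mem_fareyIdx {D : Finset ℕ} {x : Σ _ : ℕ, ℕ} :
    x ∈ fareyIdx D ↔ x.1 ∈ D ∧ x.2 < x.1 ∧ Nat.Coprime x.2 x.1 := by
  simp [fareyIdx]

lemma card_coprime_range (d : ℕ) :
    ((range d).filter (fun c => Nat.Coprime c d)).card = d.totient := by
  rw [Nat.totient]
  congr 1
  ext c
  simp [Nat.coprime_comm]

/-- The dual form of the large sieve, applied to sequences supported on integers `n` for which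
`W * n + b` is coprime to all the moduli in `D`. -/
lemma farey_sieve {ι : Type*} (I : Finset ι) (D : Finset ℕ) (W b : ℕ)
    (hD0 : ∀ d ∈ D, Squarefree d) (θ : ι → ℝ) (H : ℕ) (a : ℕ → ℝ) {B E : ℝ}
    (hB0 : 0 ≤ B) (hE0 : 0 ≤ E)
    (hcop : ∀ n ∈ range H, a n ≠ 0 → ∀ d ∈ D, Nat.Coprime (W * n + b) d)
    (hB : ∀ γ : ι → ℂ, ∑ n ∈ range H, ‖∑ i ∈ I, γ i * ee (n * θ i)‖ ^ 2 ≤ B * ∑ i ∈ I, ‖γ i‖ ^ 2)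
    (hE : ∀ i ∈ I, ∀ j ∈ I, ∑ x ∈ fareyIdx D, ∑ y ∈ (fareyIdx D).erase x,
      (1 / x.1.totient : ℝ) * (1 / y.1.totient : ℝ) *
        ‖geo H (θ i - θ j + W * (x.2 / x.1 : ℝ) - W * (y.2 / y.1 : ℝ))‖ ≤ E) :
    sieveG D ^ 2 * ∑ i ∈ I, ‖expS H a (θ i)‖ ^ 2 ≤
      (∑ n ∈ range H, a n ^ 2) * (sieveG D * B + I.card * E) := by
  have hmu : ∀ d ∈ D, ((ArithmeticFunction.moebius d : ℤ) : ℝ) ^ 2 = 1 := by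
    intro d hd
    have := ArithmeticFunction.moebius_sq_eq_one_of_squarefree (hD0 d hd)
    exact_mod_cast this
  have hnorm : ∀ d ∈ D, ‖((ArithmeticFunction.moebius d : ℤ) : ℂ)‖ = 1 := by
    intro d hd
    have h := hmu d hd
    have : ‖((ArithmeticFunction.moebius d : ℤ) : ℂ)‖ ^ 2 = 1 := by
      rw [Complex.norm_intCast, sq_abs, h]
    exact (pow_eq_one_iff_of_nonneg (norm_nonneg _) two_ne_zero).mp this
  have hphi : ∀ d ∈ D, (0 : ℝ) < d.totient := by
    intro d hd
    exact_mod_cast Nat.totient_pos.mpr (Nat.pos_of_ne_zero (hD0 d hd).ne_zero)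
  have hω : ∀ x ∈ fareyIdx D, ‖((ArithmeticFunction.moebius x.1 : ℤ) : ℂ) / (x.1.totient : ℂ) *
        ee ((x.2 : ℝ) * ((b : ℝ) / x.1))‖ = 1 / x.1.totient := by
    intro x hx
    rw [norm_mul, norm_ee, mul_one, norm_div, hnorm _ (mem_fareyIdx.mp hx).1]
    simp
  refine dual_sieve (G := sieveG D) (Q := sieveG D) (B := B) (E := E) I (fareyIdx D) θ
    (fun x => W * (x.2 / x.1 : ℝ))
    (fun x => ((ArithmeticFunction.moebius x.1 : ℤ) : ℂ) / (x.1.totient : ℂ) *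
        ee ((x.2 : ℝ) * ((b : ℝ) / x.1))) H a ?_ hB0 hE0 ?_ hB ?_
  · rw [sum_congr rfl (fun x hx => by rw [hω x hx])]
    rw [fareyIdx, sum_sigma, sieveG]
    apply sum_congr rfl
    intro d hd
    simp only [sum_const, card_coprime_range, nsmul_eq_mul]
    have := hphi d hd
    field_simp
  · intro n hn han
    rw [fareyIdx, sum_sigma, sieveG]
    push_cast
    apply sum_congr rfl
    intro d hd
    have hd0 : 0 < d := Nat.pos_of_ne_zero (hD0 d hd).ne_zero
    have h1 := ramanujan_sum hd0 (hcop n hn han d hd)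
    have h2 : ∀ c : ℕ, ((ArithmeticFunction.moebius d : ℤ) : ℂ) / (d.totient : ℂ) *
        ee ((c : ℝ) * ((b : ℝ) / d)) * ee (n * (W * (c / d : ℝ))) =
        ((ArithmeticFunction.moebius d : ℤ) : ℂ) / (d.totient : ℂ) *
          ee ((c : ℝ) * (((W * n + b : ℕ) : ℝ) / d)) := by
      intro c
      rw [mul_assoc, ← ee_add]
      congr 2
      push_cast
      ring
    simp only [h2]
    rw [← mul_sum, h1]
    have h3 : ((ArithmeticFunction.moebius d : ℤ) : ℂ) ^ 2 = 1 := by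
      have := hmu d hd
      exact_mod_cast this
    have h4 : (d.totient : ℂ) ≠ 0 := by
      have := (hphi d hd).ne'
      exact_mod_cast this
    field_simp
    exact h3
  · intro i hi j hj
    refine le_trans (le_of_eq ?_) (hE i hi j hj)
    apply sum_congr rfl
    intro x hx
    apply sum_congr rfl
    intro y hy
    rw [hω x hx, hω y (mem_of_mem_erase hy)]

end Vino

namespace Vino

open Finset

lemma geo_half_le {κ : Type*} (A : Finset κ) (y : κ → ℝ) (f : κ → ℝ) (H : ℕ) {Δ : ℝ} (hΔ : 0 < Δ)
    (hΔ1 : Δ ≤ 1) (hy0 : ∀ a ∈ A, 0 ≤ y a) (hy : ∀ a ∈ A, y a ≤ nn (f a))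
    (hsep : ∀ a ∈ A, ∀ b ∈ A, a ≠ b → Δ ≤ |y a - y b|) :
    ∑ a ∈ A, ‖geo H (f a)‖ ≤ H + 1 / (2 * Δ) * (1 + Real.log (1 / Δ)) := by
  classical
  set N := ⌊1 / (2 * Δ)⌋₊ with hN
  let j : κ → ℕ := fun a => ⌊y a / Δ⌋₊
  let h : ℕ → ℝ := fun k => if k = 0 then H else 1 / (2 * (k * Δ))
  have hj : ∀ a ∈ A, j a ∈ range (N + 1) := by
    intro a ha
    rw [mem_range, Nat.lt_succ_iff]
    apply Nat.floor_le_floor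
    have h1 := (hy a ha).trans (nn_le_half _)
    rw [div_le_div_iff₀ hΔ (by positivity)]
    nlinarith
  have hinj : Set.InjOn j A := by
    intro a ha b hb hab
    by_contra hne
    have h1 := hsep a ha b hb hne
    have ha1 := Nat.floor_le (div_nonneg (hy0 a ha) hΔ.le)
    have hb1 := Nat.floor_le (div_nonneg (hy0 b hb) hΔ.le)
    have ha2 := Nat.lt_floor_add_one (y a / Δ)
    have hb2 := Nat.lt_floor_add_one (y b / Δ)
    have hab' : (⌊y a / Δ⌋₊ : ℝ) = ⌊y b / Δ⌋₊ := by exact_mod_cast hab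
    have h2 : |y a / Δ - y b / Δ| < 1 := by rw [abs_lt]; constructor <;> linarith
    rw [← sub_div, abs_div, abs_of_pos hΔ, div_lt_one hΔ] at h2
    linarith
  have hle : ∀ a ∈ A, ‖geo H (f a)‖ ≤ h (j a) := by
    intro a ha
    simp only [h]
    split_ifs with h0
    · exact norm_geo_le _ _
    · have hp : (0 : ℝ) < j a := by exact_mod_cast Nat.pos_of_ne_zero h0
      refine norm_geo_le_inv _ (by positivity) (le_trans ?_ (hy a ha))
      have := Nat.floor_le (div_nonneg (hy0 a ha) hΔ.le)
      rwa [le_div_iff₀ hΔ] at this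
  have hh : ∀ k, 0 ≤ h k := by
    intro k; simp only [h]; split_ifs <;> positivity
  calc ∑ a ∈ A, ‖geo H (f a)‖ ≤ ∑ a ∈ A, h (j a) := sum_le_sum hle
    _ = ∑ k ∈ A.image j, h k := (sum_image hinj).symm
    _ ≤ ∑ k ∈ range (N + 1), h k := by
        apply sum_le_sum_of_subset_of_nonneg
        · intro k hk
          obtain ⟨a, ha, rfl⟩ := mem_image.mp hk
          exact hj a ha
        · intro k _ _; exact hh k
    _ = H + 1 / (2 * Δ) * (harmonic N : ℝ) := by
        rw [sum_range_succ', add_comm, harmonic]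
        push_cast
        rw [mul_sum]
        congr 1
        apply sum_congr rfl
        intro k _
        simp only [h]
        rw [if_neg (by omega)]
        push_cast
        have : (k : ℝ) + 1 ≠ 0 := by positivity
        field_simp
    _ ≤ H + 1 / (2 * Δ) * (1 + Real.log (1 / Δ)) := by
        gcongr
        rcases Nat.eq_zero_or_pos N with h0 | h0
        · rw [h0]
          simp only [harmonic_zero, Rat.cast_zero]
          have : 0 ≤ Real.log (1 / Δ) := Real.log_nonneg (by rw [le_div_iff₀ hΔ]; linarith)
          linarith
        · refine (harmonic_le_one_add_log N).trans ?_
          gcongr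
          refine (Nat.floor_le (by positivity)).trans ?_
          gcongr
          linarith

/-- Sums of geometric sums over `Δ`-separated points of the circle. -/
lemma geo_sep_le {κ : Type*} (A : Finset κ) (f : κ → ℝ) (H : ℕ) {Δ : ℝ} (hΔ : 0 < Δ)
    (hΔ1 : Δ ≤ 1) (hsep : ∀ a ∈ A, ∀ b ∈ A, a ≠ b → Δ ≤ nn (f a - f b)) :
    ∑ a ∈ A, ‖geo H (f a)‖ ≤ 2 * H + 1 / Δ * (1 + Real.log (1 / Δ)) := by
  classical
  let z : κ → ℝ := fun a => f a - round (f a)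
  have hz : ∀ a, nn (f a) = |z a| := fun a => nn_eq _
  have hs : ∀ a ∈ A, ∀ b ∈ A, a ≠ b → Δ ≤ |z a - z b| := by
    intro a ha b hb hab
    refine (hsep a ha b hb hab).trans ?_
    have := nn_le_abs_sub (f a - f b) (round (f a) - round (f b))
    refine this.trans (le_of_eq ?_)
    simp only [z]
    push_cast
    congr 1
    ring
  rw [← sum_filter_add_sum_filter_not A (fun a => 0 ≤ z a)]
  have h1 := geo_half_le (A.filter (fun a => 0 ≤ z a)) z f H hΔ hΔ1
    (fun a ha => (mem_filter.mp ha).2)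
    (fun a ha => by rw [hz, abs_of_nonneg (mem_filter.mp ha).2])
    (fun a ha b hb => hs a (mem_filter.mp ha).1 b (mem_filter.mp hb).1)
  have h2 := geo_half_le (A.filter (fun a => ¬ 0 ≤ z a)) (fun a => - z a) f H hΔ hΔ1
    (fun a ha => by have := (mem_filter.mp ha).2; linarith)
    (fun a ha => by rw [hz, abs_of_neg (not_le.mp (mem_filter.mp ha).2)])
    (fun a ha b hb hab => by
      rw [← abs_neg]
      have := hs a (mem_filter.mp ha).1 b (mem_filter.mp hb).1 hab
      rw [show -(-z a - -z b) = z a - z b by ring]; exact this)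
  have h3 : 1 / Δ = 1 / (2 * Δ) + 1 / (2 * Δ) := by field_simp; norm_num
  have h4 : 1 / Δ * (1 + Real.log (1 / Δ)) = 1 / (2 * Δ) * (1 + Real.log (1 / Δ)) +
      1 / (2 * Δ) * (1 + Real.log (1 / Δ)) := by rw [← add_mul, ← h3]
  rw [h4]
  linarith

lemma nn_ge_inv {x : ℝ} {k : ℕ} (hk : 0 < k) {m : ℤ} (hx : x * k = m) (hm : ¬ (k : ℤ) ∣ m) :
    1 / (k : ℝ) ≤ nn x := by
  rw [nn_eq, div_le_iff₀ (by positivity)]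
  have : |x - round x| * k = |((m - round x * k : ℤ) : ℝ)| := by
    nth_rewrite 1 [← abs_of_pos (show (0 : ℝ) < k by positivity)]
    rw [← abs_mul]
    push_cast
    rw [← hx]; congr 1; ring
  rw [this, ← Int.cast_abs]
  have : m - round x * k ≠ 0 := by
    intro h
    apply hm
    exact ⟨round x, by linarith⟩
  exact_mod_cast Int.one_le_abs this

/-- Multiples by `W` of distinct fractions with denominators coprime to `W` are well spaced. -/
lemma nn_rat_sep {W : ℕ} {β₁ β₂ : ℚ} (h1 : 0 ≤ β₁) (h1' : β₁ < 1) (h2 : 0 ≤ β₂) (h2' : β₂ < 1)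
    (hne : β₁ ≠ β₂) (hW1 : Nat.Coprime W β₁.den) (hW2 : Nat.Coprime W β₂.den) :
    1 / ((β₁.den : ℝ) * β₂.den) ≤ nn (W * (β₁ : ℝ) - W * (β₂ : ℝ)) := by
  have hd1 : (0 : ℝ) < β₁.den := by exact_mod_cast β₁.den_pos
  have hd2 : (0 : ℝ) < β₂.den := by exact_mod_cast β₂.den_pos
  have e1 : (β₁ : ℝ) * β₁.den = β₁.num := by exact_mod_cast Rat.mul_den_eq_num β₁
  have e2 : (β₂ : ℝ) * β₂.den = β₂.num := by exact_mod_cast Rat.mul_den_eq_num β₂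
  have h := @nn_ge_inv (W * (β₁ : ℝ) - W * (β₂ : ℝ)) (β₁.den * β₂.den)
    (Nat.mul_pos β₁.den_pos β₂.den_pos) (W * (β₁.num * β₂.den - β₂.num * β₁.den)) (by
      push_cast
      rw [← e1, ← e2]; ring) (by
      intro hdvd
      have hc : IsCoprime ((β₁.den * β₂.den : ℕ) : ℤ) (W : ℤ) :=
        Nat.isCoprime_iff_coprime.mpr (Nat.Coprime.mul_left hW1.symm hW2.symm)
      have h3 := hc.dvd_of_dvd_mul_left hdvd
      obtain ⟨k, hk⟩ := h3
      have h4 : (β₁ - β₂ : ℚ) = k := by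
        have e1 := Rat.mul_den_eq_num β₁
        have e2 := Rat.mul_den_eq_num β₂
        have hk' : (β₁.num : ℚ) * β₂.den - β₂.num * β₁.den = β₁.den * β₂.den * k := by
          exact_mod_cast hk
        rw [← e1, ← e2] at hk'
        have hd : (β₁.den : ℚ) * β₂.den ≠ 0 := by positivity
        apply mul_left_cancel₀ hd
        rw [← hk']; ring
      have h5 : (-1 : ℚ) < k := by rw [← h4]; linarith
      have h6 : (k : ℚ) < 1 := by rw [← h4]; linarith
      have h5' : -1 < k := by exact_mod_cast h5
      have h6' : k < 1 := by exact_mod_cast h6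
      have : k = 0 := by omega
      rw [this] at h4
      apply hne
      push_cast at h4
      linarith)
  push_cast at h
  exact h

end Vino

namespace Vino

open Finset

/-- The fraction `c / d` attached to an index `(d, c)`. -/
def fr (x : Σ _ : ℕ, ℕ) : ℚ := (x.2 : ℚ) / x.1

/-- The pairs of reduced residues `(c, c')` with `c / d - c' / d' ≡ β` modulo one. -/
def diffPairs (d d' : ℕ) (β : ℚ) : Finset (ℕ × ℕ) :=
  (((range d).filter (fun c => Nat.Coprime c d)) ×ˢ
    ((range d').filter (fun c => Nat.Coprime c d'))).filter
    (fun p => Int.fract ((p.1 : ℚ) / d - (p.2 : ℚ) / d') = β)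

lemma mem_diffPairs {d d' : ℕ} {β : ℚ} {p : ℕ × ℕ} : p ∈ diffPairs d d' β ↔
    ((p.1 < d ∧ Nat.Coprime p.1 d) ∧ (p.2 < d' ∧ Nat.Coprime p.2 d')) ∧
      Int.fract ((p.1 : ℚ) / d - (p.2 : ℚ) / d') = β := by
  simp [diffPairs]

lemma diffPairs_num {s t m : ℕ} (hs : 0 < s) (ht : 0 < t) (hm : 0 < m) {β : ℚ} {p : ℕ × ℕ}
    (hp : p ∈ diffPairs (s * m) (t * m) β) :
    ∃ k : ℤ, β * (s * t * m) = (p.1 : ℚ) * t - p.2 * s - k * (s * t * m) := by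
  have h := (mem_diffPairs.mp hp).2
  refine ⟨⌊(p.1 : ℚ) / (s * m : ℕ) - (p.2 : ℚ) / (t * m : ℕ)⌋, ?_⟩
  rw [← h, Int.fract]
  push_cast
  have : (s : ℚ) ≠ 0 := by positivity
  have : (t : ℚ) ≠ 0 := by positivity
  have : (m : ℚ) ≠ 0 := by positivity
  rw [sub_mul]
  congr 1
  field_simp

lemma diffPairs_den {s t m : ℕ} (hs : 0 < s) (ht : 0 < t) (hm : 0 < m) (hst : Nat.Coprime s t)
    {β : ℚ} {p : ℕ × ℕ} (hp : p ∈ diffPairs (s * m) (t * m) β) :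
    s ∣ β.den ∧ t ∣ β.den ∧ β.den ∣ s * t * m := by
  obtain ⟨k, hk⟩ := diffPairs_num hs ht hm hp
  obtain ⟨⟨⟨_, hc⟩, ⟨_, hc'⟩⟩, _⟩ := mem_diffPairs.mp hp
  have hstm : ((s * t * m : ℕ) : ℚ) ≠ 0 := by positivity
  set n : ℤ := (p.1 : ℤ) * t - p.2 * s - k * (s * t * m) with hn
  have h1 : β = (n : ℚ) / ((s * t * m : ℕ) : ℤ) := by
    rw [eq_div_iff (by exact_mod_cast hstm)]
    push_cast
    rw [hk, hn]
    push_cast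
    ring
  have h2 : β.den ∣ s * t * m := by
    have := Rat.den_dvd n ((s * t * m : ℕ) : ℤ)
    rw [Rat.divInt_eq_div, ← h1] at this
    exact_mod_cast this
  have h3 : β.num * ((s * t * m : ℕ) : ℤ) = n * β.den := by
    have e1 := Rat.mul_den_eq_num β
    have : (β.num : ℚ) * ((s * t * m : ℕ) : ℚ) = n * β.den := by
      rw [← e1, hn]
      push_cast
      rw [mul_right_comm, hk]
    exact_mod_cast this
  refine ⟨?_, ?_, h2⟩
  · have hcop : IsCoprime (s : ℤ) n := by
      have e : n = (p.1 * t : ℕ) + s * (-p.2 - k * (t * m)) := by rw [hn]; push_cast; ring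
      rw [e]
      refine IsCoprime.add_mul_left_right ?_ _
      exact Nat.isCoprime_iff_coprime.mpr
        (Nat.Coprime.mul_right (Nat.Coprime.coprime_mul_right_right hc).symm hst)
    have : (s : ℤ) ∣ n * β.den := by
      rw [← h3]; push_cast; exact ⟨β.num * (t * m), by ring⟩
    exact_mod_cast hcop.dvd_of_dvd_mul_left this
  · have hcop : IsCoprime (t : ℤ) n := by
      have e : n = -((p.2 * s : ℕ) : ℤ) + t * (p.1 - k * (s * m)) := by rw [hn]; push_cast; ring
      rw [e]
      refine IsCoprime.add_mul_left_right ?_ _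
      exact (Nat.isCoprime_iff_coprime.mpr
        (Nat.Coprime.mul_right (Nat.Coprime.coprime_mul_right_right hc').symm hst.symm)).neg_right
    have : (t : ℤ) ∣ n * β.den := by
      rw [← h3]; push_cast; exact ⟨β.num * (s * m), by ring⟩
    exact_mod_cast hcop.dvd_of_dvd_mul_left this

lemma card_diffPairs_le {s t m : ℕ} (hs : 0 < s) (ht : 0 < t) (hm : 0 < m) (hst : Nat.Coprime s t)
    (hsm : Nat.Coprime s m) (β : ℚ) :
    (diffPairs (s * m) (t * m) β).card ≤ m.totient := by
  rw [← card_coprime_range]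
  apply card_le_card_of_injOn (fun p => p.1 % m)
  · intro p hp
    obtain ⟨⟨⟨_, hc⟩, _⟩, _⟩ := mem_diffPairs.mp hp
    rw [mem_coe, mem_filter, mem_range]
    refine ⟨Nat.mod_lt _ hm, ?_⟩
    rw [Nat.Coprime, ← Nat.gcd_rec, Nat.gcd_comm]
    exact Nat.Coprime.coprime_mul_left_right hc
  · intro p hp p' hp' hpp
    obtain ⟨k, hk⟩ := diffPairs_num hs ht hm hp
    obtain ⟨k', hk'⟩ := diffPairs_num hs ht hm hp'
    obtain ⟨⟨⟨h1, _⟩, ⟨h2, _⟩⟩, _⟩ := mem_diffPairs.mp hp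
    obtain ⟨⟨⟨h1', _⟩, ⟨h2', _⟩⟩, _⟩ := mem_diffPairs.mp hp'
    have heq : ((p.1 : ℤ) - p'.1) * t = s * ((p.2 - p'.2) + (k - k') * (t * m)) := by
      have : ((p.1 : ℚ) - p'.1) * t = s * ((p.2 - p'.2) + (k - k') * (t * m)) := by
        rw [hk] at hk'; linear_combination hk'
      exact_mod_cast this
    have hsd : (s : ℤ) ∣ (p.1 : ℤ) - p'.1 :=
      (Nat.isCoprime_iff_coprime.mpr hst).dvd_of_dvd_mul_right ⟨_, heq⟩
    have hmd : (m : ℤ) ∣ (p.1 : ℤ) - p'.1 := by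
      have : p'.1 ≡ p.1 [MOD m] := hpp.symm
      exact (Nat.modEq_iff_dvd.mp this)
    have hd : ((s * m : ℕ) : ℤ) ∣ (p.1 : ℤ) - p'.1 := by
      push_cast
      exact (Nat.isCoprime_iff_coprime.mpr hsm).mul_dvd hsd hmd
    have e1 : p.1 = p'.1 := by
      have hmod : p'.1 ≡ p.1 [MOD (s * m)] := Nat.modEq_iff_dvd.mpr hd
      exact (Nat.ModEq.eq_of_lt_of_lt hmod h1' h1).symm
    have e2 : p.2 = p'.2 := by
      rw [e1, sub_self, zero_mul] at heq
      have h0 : ((p.2 : ℤ) - p'.2) + (k - k') * (t * m) = 0 := by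
        rcases mul_eq_zero.mp heq.symm with h | h
        · exact absurd h (by positivity)
        · exact h
      have hmod : p'.2 ≡ p.2 [MOD (t * m)] := by
        apply Nat.modEq_iff_dvd.mpr
        refine ⟨-(k - k'), ?_⟩
        push_cast
        linear_combination h0
      exact (Nat.ModEq.eq_of_lt_of_lt hmod h2' h2).symm
    exact Prod.ext e1 e2

end Vino

namespace Vino

open Finset

lemma diffPairs_structure {d d' : ℕ} (hd : Squarefree d) (hd' : Squarefree d') {β : ℚ}
    (hne : (diffPairs d d' β).Nonempty) :
    ∃ s t m g : ℕ, m = Nat.gcd d d' ∧ d = s * m ∧ d' = t * m ∧ s ∣ β.den ∧ t ∣ β.den ∧ 0 < m ∧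
      β.den * g = s * t * m ∧ g ∣ m ∧ Squarefree (s * t * m) ∧
      ((diffPairs d d' β).card : ℝ) * (1 / d.totient * (1 / d'.totient)) ≤
        1 / β.den.totient * (1 / g.totient) := by
  have hd0 : 0 < d := Nat.pos_of_ne_zero hd.ne_zero
  have hd0' : 0 < d' := Nat.pos_of_ne_zero hd'.ne_zero
  obtain ⟨s, t, hst, h1, h2⟩ := Nat.exists_coprime d d'
  have hm : 0 < Nat.gcd d d' := Nat.gcd_pos_of_pos_left _ hd0
  set m := Nat.gcd d d' with hmdef
  clear_value m
  subst h1 h2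
  have hs : 0 < s := Nat.pos_of_mul_pos_right hd0
  have ht : 0 < t := Nat.pos_of_mul_pos_right hd0'
  have hsm : Nat.Coprime s m := Nat.coprime_of_squarefree_mul hd
  have htm : Nat.Coprime t m := Nat.coprime_of_squarefree_mul hd'
  obtain ⟨p, hp⟩ := hne
  obtain ⟨hsq, htq, g, hg⟩ := diffPairs_den hs ht hm hst hp
  have hsf : Squarefree (s * t * m) := by
    rw [Nat.squarefree_mul (Nat.Coprime.mul_left hsm htm), Nat.squarefree_mul hst]
    exact ⟨⟨hd.of_mul_left, hd'.of_mul_left⟩, hd.of_mul_right⟩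
  have hqg : Nat.Coprime β.den g := Nat.coprime_of_squarefree_mul (hg ▸ hsf)
  have hg0 : 0 < g := by
    rcases Nat.eq_zero_or_pos g with h | h
    · rw [h, mul_zero] at hg; exact absurd hg (by positivity)
    · exact h
  refine ⟨s, t, m, g, rfl, rfl, rfl, hsq, htq, hm, hg.symm, ?_, hsf, ?_⟩
  · obtain ⟨k, hk⟩ := hst.mul_dvd_of_dvd_of_dvd hsq htq
    refine ⟨k, ?_⟩
    rw [hk, mul_assoc (s * t)] at hg
    rw [mul_comm]
    exact Nat.eq_of_mul_eq_mul_left (Nat.mul_pos hs ht) hg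
  · have e1 : (β.den.totient : ℝ) * g.totient = s.totient * t.totient * m.totient := by
      have : β.den.totient * g.totient = s.totient * t.totient * m.totient := by
        rw [← Nat.totient_mul hqg, ← Nat.totient_mul hst,
          ← Nat.totient_mul (Nat.Coprime.mul_left hsm htm), hg]
      exact_mod_cast this
    have hc : ((diffPairs (s * m) (t * m) β).card : ℝ) ≤ m.totient := by
      exact_mod_cast card_diffPairs_le hs ht hm hst hsm β
    have ps : (0 : ℝ) < s.totient := by exact_mod_cast Nat.totient_pos.mpr hs
    have pt : (0 : ℝ) < t.totient := by exact_mod_cast Nat.totient_pos.mpr ht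
    have pm : (0 : ℝ) < m.totient := by exact_mod_cast Nat.totient_pos.mpr hm
    rw [one_div_mul_one_div (β.den.totient : ℝ), e1, Nat.totient_mul hsm, Nat.totient_mul htm]
    push_cast
    calc _ ≤ (m.totient : ℝ) * (1 / (s.totient * m.totient) * (1 / (t.totient * m.totient))) := by
            gcongr
      _ = _ := by field_simp

/-- The total weight of the pairs of Farey fractions with a given difference modulo one. -/
lemma diff_weight_le (D : Finset ℕ) (hsf : ∀ d ∈ D, Squarefree d)
    (hdiv : ∀ d ∈ D, ∀ g, g ∣ d → g ∈ D) (β : ℚ) :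
    ∑ x ∈ fareyIdx D, ∑ y ∈ (fareyIdx D).filter (fun y => Int.fract (fr x - fr y) = β),
      (1 / x.1.totient : ℝ) * (1 / y.1.totient : ℝ) ≤
      (β.den.divisors.card : ℝ) ^ 2 / β.den.totient * sieveG D := by
  have e1 : ∑ x ∈ fareyIdx D, ∑ y ∈ (fareyIdx D).filter (fun y => Int.fract (fr x - fr y) = β),
      (1 / x.1.totient : ℝ) * (1 / y.1.totient : ℝ) =
      ∑ p ∈ D ×ˢ D, ((diffPairs p.1 p.2 β).card : ℝ) * (1 / p.1.totient * (1 / p.2.totient)) := by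
    rw [sum_product]
    have hc : ∀ d d' : ℕ, ((diffPairs d d' β).card : ℝ) =
        ∑ c ∈ (range d).filter (fun c => Nat.Coprime c d),
          ∑ c' ∈ (range d').filter (fun c => Nat.Coprime c d'),
            if Int.fract ((c : ℚ) / d - (c' : ℚ) / d') = β then (1 : ℝ) else 0 := by
      intro d d'
      rw [diffPairs, card_eq_sum_ones, sum_filter, sum_product]
      push_cast
      rfl
    have hl : ∀ x, ∑ y ∈ (fareyIdx D).filter (fun y => Int.fract (fr x - fr y) = β),
        (1 / x.1.totient : ℝ) * (1 / y.1.totient : ℝ) = ∑ y ∈ fareyIdx D,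
          if Int.fract (fr x - fr y) = β then (1 / x.1.totient : ℝ) * (1 / y.1.totient : ℝ)
            else 0 := fun x => sum_filter _ _
    simp only [hl, hc]
    rw [fareyIdx, sum_sigma]
    apply sum_congr rfl
    intro d _
    simp only [sum_sigma]
    rw [sum_comm]
    apply sum_congr rfl
    intro d' _
    rw [sum_mul]
    apply sum_congr rfl
    intro c _
    rw [sum_mul]
    apply sum_congr rfl
    intro c' _
    simp only [fr, ite_mul, one_mul, zero_mul]
    congr
  rw [e1]
  set P := (D ×ˢ D).filter (fun p => (diffPairs p.1 p.2 β).Nonempty) with hP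
  have e2 : ∑ p ∈ D ×ˢ D, ((diffPairs p.1 p.2 β).card : ℝ) *
      (1 / p.1.totient * (1 / p.2.totient)) = ∑ p ∈ P, ((diffPairs p.1 p.2 β).card : ℝ) *
      (1 / p.1.totient * (1 / p.2.totient)) := by
    rw [hP, sum_filter]
    apply sum_congr rfl
    intro p _
    split_ifs with h
    · rfl
    · rw [not_nonempty_iff_eq_empty.mp h]; simp
  rw [e2]
  let F : ℕ × ℕ → ℕ × ℕ × ℕ := fun p => (p.1 / Nat.gcd p.1 p.2, p.2 / Nat.gcd p.1 p.2,
    (p.1 / Nat.gcd p.1 p.2) * (p.2 / Nat.gcd p.1 p.2) * Nat.gcd p.1 p.2 / β.den)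
  have key : ∀ p ∈ P, ∃ s t m g : ℕ, p = (s * m, t * m) ∧ F p = (s, t, g) ∧ s ∣ β.den ∧
      t ∣ β.den ∧ 0 < s ∧ 0 < t ∧ β.den * g = s * t * m ∧ g ∈ D ∧
      ((diffPairs p.1 p.2 β).card : ℝ) * (1 / p.1.totient * (1 / p.2.totient)) ≤
        1 / β.den.totient * (1 / g.totient) := by
    intro p hp
    obtain ⟨hp1, hp2⟩ := mem_filter.mp hp
    obtain ⟨hd, hd'⟩ := mem_product.mp hp1
    obtain ⟨s, t, m, g, hm, h1, h2, hs, ht, hm0, hg, hgm, hsf', hle⟩ :=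
      diffPairs_structure (hsf _ hd) (hsf _ hd') hp2
    have hs0 : 0 < s := Nat.pos_of_dvd_of_pos hs β.den_pos
    have ht0 : 0 < t := Nat.pos_of_dvd_of_pos ht β.den_pos
    have q1 : p.1 / m = s := by rw [h1]; exact Nat.mul_div_cancel _ hm0
    have q2 : p.2 / m = t := by rw [h2]; exact Nat.mul_div_cancel _ hm0
    refine ⟨s, t, m, g, Prod.ext h1 h2, ?_, hs, ht, hs0, ht0, hg, ?_, hle⟩
    · simp only [F]
      rw [← hm, q1, q2, ← hg, Nat.mul_div_cancel_left _ β.den_pos]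
    · exact hdiv _ hd _ (hgm.trans ⟨s, by rw [h1, mul_comm]⟩)
  have hinj : Set.InjOn F P := by
    intro p hp p' hp' heq
    obtain ⟨s, t, m, g, h1, h2, _, _, hs0, ht0, hg, _⟩ := key p hp
    obtain ⟨s', t', m', g', h1', h2', _, _, _, _, hg', _⟩ := key p' hp'
    rw [h2, h2', Prod.mk.injEq, Prod.mk.injEq] at heq
    obtain ⟨rfl, rfl, rfl⟩ := heq
    have : m = m' := Nat.eq_of_mul_eq_mul_left (Nat.mul_pos hs0 ht0) (hg.symm.trans hg')
    rw [h1, h1', this]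
  calc ∑ p ∈ P, ((diffPairs p.1 p.2 β).card : ℝ) * (1 / p.1.totient * (1 / p.2.totient))
      ≤ ∑ p ∈ P, 1 / (β.den.totient : ℝ) * (1 / ((F p).2.2.totient : ℝ)) := by
        apply sum_le_sum
        intro p hp
        obtain ⟨s, t, m, g, h1, h2, _, _, _, _, _, _, hle⟩ := key p hp
        rw [h2]
        exact hle
    _ = ∑ z ∈ P.image F, 1 / (β.den.totient : ℝ) * (1 / (z.2.2.totient : ℝ)) :=
        (sum_image (f := fun z : ℕ × ℕ × ℕ => 1 / (β.den.totient : ℝ) *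
          (1 / (z.2.2.totient : ℝ))) hinj).symm
    _ ≤ ∑ z ∈ β.den.divisors ×ˢ β.den.divisors ×ˢ D,
          1 / (β.den.totient : ℝ) * (1 / (z.2.2.totient : ℝ)) := by
        apply sum_le_sum_of_subset_of_nonneg
        · intro z hz
          obtain ⟨p, hp, rfl⟩ := mem_image.mp hz
          obtain ⟨s, t, m, g, h1, h2, hs, ht, _, _, _, hgD, _⟩ := key p hp
          rw [h2]
          simp only [mem_product, Nat.mem_divisors]
          exact ⟨⟨hs, β.den_pos.ne'⟩, ⟨ht, β.den_pos.ne'⟩, hgD⟩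
        · intro z _ _; positivity
    _ = (β.den.divisors.card : ℝ) ^ 2 / β.den.totient * sieveG D := by
        simp only [sum_product, sum_const, nsmul_eq_mul, ← mul_sum]
        rw [sieveG]
        ring

end Vino

namespace Vino

open Finset

/-- The differences modulo one of distinct Farey fractions. -/
def farDiff (D : Finset ℕ) : Finset ℚ :=
  (fareyIdx D).biUnion fun x => ((fareyIdx D).erase x).image fun y => Int.fract (fr x - fr y)

lemma fr_nonneg (x : Σ _ : ℕ, ℕ) : 0 ≤ fr x := by unfold fr; positivity

lemma fr_lt_one {D : Finset ℕ} {x : Σ _ : ℕ, ℕ} (hx : x ∈ fareyIdx D) : fr x < 1 := by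
  obtain ⟨_, h, _⟩ := mem_fareyIdx.mp hx
  have h0 : (0 : ℚ) < x.1 := by exact_mod_cast (Nat.zero_le _).trans_lt h
  rw [fr, div_lt_one h0]
  exact_mod_cast h

lemma fr_injOn (D : Finset ℕ) : Set.InjOn fr (fareyIdx D) := by
  intro x hx y hy h
  obtain ⟨_, h1, h2⟩ := mem_fareyIdx.mp hx
  obtain ⟨_, h3, h4⟩ := mem_fareyIdx.mp hy
  have := Rat.div_int_inj (a := x.2) (b := x.1) (c := y.2) (d := y.1) (by omega) (by omega)
    (by simpa using h2) (by simpa using h4) (by simpa [fr] using h)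
  obtain ⟨h5, h6⟩ := this
  exact Sigma.ext (by exact_mod_cast h6) (heq_of_eq (by exact_mod_cast h5))

lemma farDiff_spec {D : Finset ℕ} (hsf : ∀ d ∈ D, Squarefree d) {W F : ℕ}
    (hW : ∀ d ∈ D, Nat.Coprime W d) (hF : ∀ d ∈ D, d ≤ F) {β : ℚ} (hβ : β ∈ farDiff D) :
    0 ≤ β ∧ β < 1 ∧ 1 < β.den ∧ Squarefree β.den ∧ Nat.Coprime W β.den ∧ β.den ≤ F ^ 2 ∧
      ∃ d ∈ D, ∃ d' ∈ D, β.den ∣ d * d' := by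
  obtain ⟨x, hx, hβ⟩ := mem_biUnion.mp hβ
  obtain ⟨y, hy, rfl⟩ := mem_image.mp hβ
  obtain ⟨hxy, hy⟩ := mem_erase.mp hy
  obtain ⟨hx1, hx2, hx3⟩ := mem_fareyIdx.mp hx
  obtain ⟨hy1, hy2, hy3⟩ := mem_fareyIdx.mp hy
  obtain ⟨s, t, m, g, hm, h1, h2, hs, ht, hm0, hg, hgm, hsf', _⟩ :=
    diffPairs_structure (hsf _ hx1) (hsf _ hy1) (β := Int.fract (fr x - fr y))
      ⟨(x.2, y.2), mem_diffPairs.mpr ⟨⟨⟨hx2, hx3⟩, ⟨hy2, hy3⟩⟩, rfl⟩⟩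
  have hdvd : (Int.fract (fr x - fr y)).den ∣ x.1 * y.1 := by
    refine (Dvd.intro _ hg).trans ?_
    rw [h1, h2]
    exact ⟨m, by ring⟩
  refine ⟨Int.fract_nonneg _, Int.fract_lt_one _, ?_, ?_, ?_, ?_, x.1, hx1, y.1, hy1, hdvd⟩
  · by_contra hle
    have hden : (Int.fract (fr x - fr y)).den = 1 := by
      have := (Int.fract (fr x - fr y)).den_pos
      omega
    have h3 : Int.fract (fr x - fr y) = (Int.fract (fr x - fr y)).num := by
      rw [Rat.den_eq_one_iff] at hden
      exact hden.symm
    have h0 := Int.fract_nonneg (fr x - fr y)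
    have h0' := Int.fract_lt_one (fr x - fr y)
    rw [h3] at h0 h0'
    have h4 : (Int.fract (fr x - fr y)).num = 0 := by
      have a1 : (0 : ℤ) ≤ (Int.fract (fr x - fr y)).num := by exact_mod_cast h0
      have a2 : (Int.fract (fr x - fr y)).num < 1 := by exact_mod_cast h0'
      omega
    rw [h4] at h3
    rw [Int.fract] at h3
    have b1 := fr_nonneg x
    have b2 := fr_nonneg y
    have b3 := fr_lt_one hx
    have b4 := fr_lt_one hy
    have c1 : (-1 : ℚ) < ⌊fr x - fr y⌋ := by push_cast at h3; linarith
    have c2 : (⌊fr x - fr y⌋ : ℚ) < 1 := by push_cast at h3; linarith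
    have c1' : -1 < ⌊fr x - fr y⌋ := by exact_mod_cast c1
    have c2' : ⌊fr x - fr y⌋ < 1 := by exact_mod_cast c2
    have c3 : ⌊fr x - fr y⌋ = 0 := by omega
    rw [c3] at h3
    push_cast at h3
    exact hxy (fr_injOn D hy hx (by linarith))
  · exact (hg ▸ hsf').of_mul_left
  · exact Nat.Coprime.coprime_dvd_right hdvd (Nat.Coprime.mul_right (hW _ hx1) (hW _ hy1))
  · have hp : 0 < x.1 * y.1 := Nat.mul_pos (by omega) (by omega)
    refine (Nat.le_of_dvd hp hdvd).trans ?_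
    rw [pow_two]
    exact Nat.mul_le_mul (hF _ hx1) (hF _ hy1)

lemma geo_fract (H : ℕ) (α : ℝ) (W : ℕ) (r : ℚ) :
    geo H (α + W * ((Int.fract r : ℚ) : ℝ)) = geo H (α + W * (r : ℝ)) := by
  have := geo_add_int H (α + W * ((Int.fract r : ℚ) : ℝ)) (W * ⌊r⌋)
  rw [← this]
  congr 1
  have h : (r : ℝ) = (⌊r⌋ : ℝ) + ((Int.fract r : ℚ) : ℝ) := by
    exact_mod_cast congrArg (fun z : ℚ => (z : ℝ)) (Int.floor_add_fract r).symm
  rw [h]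
  push_cast
  ring

/-- The off-diagonal contribution in the dual sieve, in terms of differences. -/
lemma offdiag_le (D : Finset ℕ) (hsf : ∀ d ∈ D, Squarefree d)
    (hdiv : ∀ d ∈ D, ∀ g, g ∣ d → g ∈ D) (W H : ℕ) (α : ℝ) :
    ∑ x ∈ fareyIdx D, ∑ y ∈ (fareyIdx D).erase x,
      (1 / x.1.totient : ℝ) * (1 / y.1.totient : ℝ) *
        ‖geo H (α + W * (x.2 / x.1 : ℝ) - W * (y.2 / y.1 : ℝ))‖ ≤
    ∑ β ∈ farDiff D, (β.den.divisors.card : ℝ) ^ 2 / β.den.totient * sieveG D *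
      ‖geo H (α + W * (β : ℝ))‖ := by
  calc _ = ∑ x ∈ fareyIdx D, ∑ β ∈ farDiff D,
        ∑ y ∈ ((fareyIdx D).erase x).filter (fun y => Int.fract (fr x - fr y) = β),
          (1 / x.1.totient : ℝ) * (1 / y.1.totient : ℝ) * ‖geo H (α + W * (β : ℝ))‖ := by
        apply sum_congr rfl
        intro x hx
        rw [← sum_fiberwise_of_maps_to (t := farDiff D) (g := fun y => Int.fract (fr x - fr y))
          (fun y hy => mem_biUnion.mpr ⟨x, hx, mem_image_of_mem _ hy⟩)]
        apply sum_congr rfl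
        intro β hβ
        apply sum_congr rfl
        intro y hy
        rw [← (mem_filter.mp hy).2, geo_fract]
        congr 3
        simp only [fr]
        push_cast
        ring
    _ ≤ ∑ x ∈ fareyIdx D, ∑ β ∈ farDiff D,
        ∑ y ∈ (fareyIdx D).filter (fun y => Int.fract (fr x - fr y) = β),
          (1 / x.1.totient : ℝ) * (1 / y.1.totient : ℝ) * ‖geo H (α + W * (β : ℝ))‖ := by
        gcongr with x hx β hβ
        exact erase_subset _ _
    _ = ∑ β ∈ farDiff D, (∑ x ∈ fareyIdx D,
        ∑ y ∈ (fareyIdx D).filter (fun y => Int.fract (fr x - fr y) = β),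
          (1 / x.1.totient : ℝ) * (1 / y.1.totient : ℝ)) * ‖geo H (α + W * (β : ℝ))‖ := by
        rw [sum_comm]
        simp only [sum_mul]
    _ ≤ _ := by
        gcongr with β hβ
        exact diff_weight_le D hsf hdiv β

end Vino

namespace Vino

open Finset

lemma geo_block_le (D : Finset ℕ) (hsf : ∀ d ∈ D, Squarefree d) {W F : ℕ}
    (hW : ∀ d ∈ D, Nat.Coprime W d) (hF : ∀ d ∈ D, d ≤ F) (A : Finset ℚ) (hA : A ⊆ farDiff D)
    {Q : ℝ} (hQ : 1 ≤ Q) (hAQ : ∀ β ∈ A, (β.den : ℝ) ≤ Q) (H : ℕ) (α : ℝ) :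
    ∑ β ∈ A, ‖geo H (α + W * (β : ℝ))‖ ≤ 2 * H + Q ^ 2 * (1 + Real.log (Q ^ 2)) := by
  have hQ2 : 1 ≤ Q ^ 2 := one_le_pow₀ hQ
  have := geo_sep_le A (fun β : ℚ => α + W * (β : ℝ)) H (Δ := 1 / Q ^ 2) (by positivity)
    (by rw [div_le_one (by positivity)]; exact hQ2) (by
      intro a ha b hb hab
      obtain ⟨a1, a2, _, _, a3, _⟩ := farDiff_spec hsf hW hF (hA ha)
      obtain ⟨b1, b2, _, _, b3, _⟩ := farDiff_spec hsf hW hF (hA hb)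
      have h := nn_rat_sep a1 a2 b1 b2 hab a3 b3
      rw [show α + W * (a : ℝ) - (α + W * (b : ℝ)) = W * (a : ℝ) - W * (b : ℝ) by ring]
      refine le_trans ?_ h
      have pa : (0 : ℝ) < a.den := by exact_mod_cast a.den_pos
      have pb : (0 : ℝ) < b.den := by exact_mod_cast b.den_pos
      have ha' := hAQ a ha
      have hb' := hAQ b hb
      rw [pow_two]
      gcongr)
  rwa [one_div_one_div] at this

lemma sum_biUnion_le_sum {ι κ : Type*} [DecidableEq κ] (I : Finset ι) (A : ι → Finset κ) (f : κ → ℝ)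
    (hf : ∀ x, 0 ≤ f x) : ∑ x ∈ I.biUnion A, f x ≤ ∑ i ∈ I, ∑ x ∈ A i, f x := by
  classical
  induction I using Finset.induction_on with
  | empty => simp
  | insert a I ha ih =>
    rw [biUnion_insert, sum_insert ha]
    have h := sum_union_inter (s₁ := A a) (s₂ := I.biUnion A) (f := f)
    have h0 : 0 ≤ ∑ x ∈ A a ∩ I.biUnion A, f x := sum_nonneg fun x _ => hf x
    linarith

lemma exists_dyadic {Y z : ℝ} (hz : Y < z) (K : ℕ) (hK : z ≤ 2 ^ K * Y) :
    ∃ k ∈ range K, 2 ^ k * Y < z ∧ z ≤ 2 ^ (k + 1) * Y := by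
  induction K with
  | zero => simp at hK; linarith
  | succ K ih =>
    by_cases h : z ≤ 2 ^ K * Y
    · obtain ⟨k, hk, h'⟩ := ih h
      exact ⟨k, mem_range.mpr ((mem_range.mp hk).trans (Nat.lt_succ_self _)), h'⟩
    · exact ⟨K, self_mem_range_succ K, not_le.mp h, hK⟩

/-- Bound for the off-diagonal contribution in the dual sieve. -/
lemma offdiag_bound (D : Finset ℕ) (hsf : ∀ d ∈ D, Squarefree d)
    (hdiv : ∀ d ∈ D, ∀ g, g ∣ d → g ∈ D) {W F : ℕ}
    (hW : ∀ d ∈ D, Nat.Coprime W d) (hF : ∀ d ∈ D, d ≤ F) (hF0 : 1 ≤ F) {w e : ℝ}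
    (hw : 0 < w) (he0 : 0 < e) (he : e < 2)
    (hr : ∀ q : ℕ, 1 < q → Squarefree q → Nat.Coprime W q →
      w ≤ q ∧ (q.divisors.card : ℝ) ^ 2 / q.totient ≤ (q : ℝ) ^ (-e))
    {Y : ℝ} (hY : 1 ≤ Y) {K : ℕ} (hK : (F : ℝ) ^ 2 ≤ 2 ^ K * Y) (H : ℕ) (α : ℝ) :
    ∑ x ∈ fareyIdx D, ∑ y ∈ (fareyIdx D).erase x,
      (1 / x.1.totient : ℝ) * (1 / y.1.totient : ℝ) *
        ‖geo H (α + W * (x.2 / x.1 : ℝ) - W * (y.2 / y.1 : ℝ))‖ ≤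
    sieveG D * (w ^ (-e) * (2 * H + Y ^ 2 * (1 + Real.log (Y ^ 2))) +
      K * (2 * H * Y ^ (-e) +
        4 * ((F : ℝ) ^ 2) ^ (2 - e) * (1 + Real.log (4 * (F : ℝ) ^ 4)))) := by
  have hF1 : (1 : ℝ) ≤ F := by exact_mod_cast hF0
  refine (offdiag_le D hsf hdiv W H α).trans ?_
  have hG : 0 ≤ sieveG D := sum_nonneg fun d _ => by positivity
  have h1 : ∑ β ∈ farDiff D, (β.den.divisors.card : ℝ) ^ 2 / β.den.totient * sieveG D *
      ‖geo H (α + W * (β : ℝ))‖ ≤ sieveG D * ∑ β ∈ farDiff D, (β.den : ℝ) ^ (-e) *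
      ‖geo H (α + W * (β : ℝ))‖ := by
    rw [mul_sum]
    apply sum_le_sum
    intro β hβ
    obtain ⟨_, _, b3, b4, b5, _⟩ := farDiff_spec hsf hW hF hβ
    have := (hr _ b3 b4 b5).2
    calc _ = sieveG D * ((β.den.divisors.card : ℝ) ^ 2 / β.den.totient *
        ‖geo H (α + W * (β : ℝ))‖) := by ring
      _ ≤ _ := by gcongr
  refine h1.trans (mul_le_mul_of_nonneg_left ?_ hG)
  rw [← sum_filter_add_sum_filter_not (farDiff D) (fun β => (β.den : ℝ) ≤ Y)]
  apply add_le_add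
  · calc _ ≤ ∑ β ∈ (farDiff D).filter (fun β => (β.den : ℝ) ≤ Y), w ^ (-e) *
          ‖geo H (α + W * (β : ℝ))‖ := by
          apply sum_le_sum
          intro β hβ
          obtain ⟨_, _, b3, b4, b5, _⟩ := farDiff_spec hsf hW hF (mem_filter.mp hβ).1
          have := (hr _ b3 b4 b5).1
          exact mul_le_mul_of_nonneg_right
            (Real.rpow_le_rpow_of_nonpos hw this (by linarith)) (norm_nonneg _)
      _ ≤ _ := by
          rw [← mul_sum]
          gcongr
          exact geo_block_le D hsf hW hF _ (filter_subset _ _) hY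
            (fun β hβ => (mem_filter.mp hβ).2) H α
  · let A : ℕ → Finset ℚ := fun k => (farDiff D).filter
      (fun β => 2 ^ k * Y < (β.den : ℝ) ∧ (β.den : ℝ) ≤ 2 ^ (k + 1) * Y)
    have hsub : (farDiff D).filter (fun β => ¬ (β.den : ℝ) ≤ Y) ⊆ (range K).biUnion A := by
      intro β hβ
      obtain ⟨hβ1, hβ2⟩ := mem_filter.mp hβ
      obtain ⟨_, _, _, _, _, b6, _⟩ := farDiff_spec hsf hW hF hβ1
      have b6' : (β.den : ℝ) ≤ (F : ℝ) ^ 2 := by exact_mod_cast b6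
      obtain ⟨k, hk, hk'⟩ := exists_dyadic (not_le.mp hβ2) K (b6'.trans hK)
      exact mem_biUnion.mpr ⟨k, hk, mem_filter.mpr ⟨hβ1, hk'⟩⟩
    have hnn : ∀ β : ℚ, 0 ≤ (β.den : ℝ) ^ (-e) * ‖geo H (α + W * (β : ℝ))‖ :=
      fun β => by positivity
    refine (sum_le_sum_of_subset_of_nonneg hsub fun β _ _ => hnn β).trans ?_
    refine (sum_biUnion_le_sum _ _ _ hnn).trans ?_
    rw [← card_range K, ← nsmul_eq_mul, card_range K]
    conv_rhs => rw [← card_range K]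
    apply sum_le_card_nsmul
    intro k _
    rcases (A k).eq_empty_or_nonempty with h | ⟨β₀, h0⟩
    · rw [h, sum_empty]
      have : 0 ≤ Real.log (4 * (F : ℝ) ^ 4) := by
        apply Real.log_nonneg
        have : (1 : ℝ) ≤ (F : ℝ) ^ 4 := one_le_pow₀ hF1
        linarith
      positivity
    · obtain ⟨hβ1, hβ2, _⟩ := mem_filter.mp h0
      obtain ⟨_, _, _, _, _, b6, _⟩ := farDiff_spec hsf hW hF hβ1
      have b6' : (β₀.den : ℝ) ≤ (F : ℝ) ^ 2 := by exact_mod_cast b6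
      set Q : ℝ := 2 ^ k * Y with hQ
      have hYQ : Y ≤ Q := le_mul_of_one_le_left (by linarith) (one_le_pow₀ (by norm_num))
      have hQ0 : 0 < Q := by linarith
      have hQF : Q ≤ (F : ℝ) ^ 2 := by linarith
      calc ∑ β ∈ A k, (β.den : ℝ) ^ (-e) * ‖geo H (α + W * (β : ℝ))‖
          ≤ ∑ β ∈ A k, Q ^ (-e) * ‖geo H (α + W * (β : ℝ))‖ := by
            apply sum_le_sum
            intro β hβ
            exact mul_le_mul_of_nonneg_right (Real.rpow_le_rpow_of_nonpos hQ0
              (mem_filter.mp hβ).2.1.le (by linarith)) (norm_nonneg _)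
        _ ≤ Q ^ (-e) * (2 * H + (2 * Q) ^ 2 * (1 + Real.log ((2 * Q) ^ 2))) := by
            rw [← mul_sum]
            gcongr
            refine geo_block_le D hsf hW hF _ (filter_subset _ _) (by linarith)
              (fun β hβ => ?_) H α
            refine (mem_filter.mp hβ).2.2.trans (le_of_eq ?_)
            rw [hQ]; ring
        _ = 2 * H * Q ^ (-e) + 4 * Q ^ (2 - e) * (1 + Real.log (4 * Q ^ 2)) := by
            have : Q ^ (2 - e) = Q ^ 2 * Q ^ (-e) := by
              rw [sub_eq_add_neg, Real.rpow_add hQ0]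
              norm_num
            rw [this]
            ring_nf
        _ ≤ _ := by
            have hlog : 0 ≤ Real.log (4 * Q ^ 2) := by
              apply Real.log_nonneg
              nlinarith
            have e1 : Q ^ (-e) ≤ Y ^ (-e) :=
              Real.rpow_le_rpow_of_nonpos (by linarith) hYQ (by linarith)
            have e2 : Q ^ (2 - e) ≤ ((F : ℝ) ^ 2) ^ (2 - e) :=
              Real.rpow_le_rpow hQ0.le hQF (by linarith)
            have e3 : Real.log (4 * Q ^ 2) ≤ Real.log (4 * (F : ℝ) ^ 4) := by
              apply Real.log_le_log (by positivity)
              have : Q ^ 2 ≤ ((F : ℝ) ^ 2) ^ 2 := by gcongr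
              nlinarith
            gcongr

end Vino

namespace Vino

open Finset

lemma exists_prime_bound {e : ℝ} (he : e < 1) :
    ∃ w₀ : ℕ, ∀ p : ℕ, w₀ ≤ p → 4 * (p : ℝ) ^ e ≤ (p : ℝ) - 1 := by
  have h : Tendsto (fun n : ℕ => ((n : ℝ)) ^ (1 - e)) atTop atTop :=
    (tendsto_rpow_atTop (by linarith)).comp tendsto_natCast_atTop_atTop
  obtain ⟨w₀, hw⟩ := eventually_atTop.mp (h.eventually_ge_atTop 8)
  refine ⟨max w₀ 2, fun p hp => ?_⟩
  have h1 := hw p ((le_max_left _ _).trans hp)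
  have h2 : (2 : ℝ) ≤ p := by exact_mod_cast (le_max_right _ _).trans hp
  have h3 : (p : ℝ) = (p : ℝ) ^ (1 - e) * (p : ℝ) ^ e := by
    rw [← Real.rpow_add (by linarith)]; norm_num
  have h4 : 0 < (p : ℝ) ^ e := by positivity
  nlinarith

lemma divisor_sq_le {e : ℝ} (q : ℕ) : (∀ p, p.Prime → p ∣ q → 4 * (p : ℝ) ^ e ≤ (p : ℝ) - 1) →
    Squarefree q → (q.divisors.card : ℝ) ^ 2 / q.totient ≤ (q : ℝ) ^ (-e) := by
  induction q using induction_on_primes with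
  | zero => intro _ h; exact absurd h not_squarefree_zero
  | one => intro _ _; simp
  | prime_mul p a hp ih =>
    intro h hsf
    have hcop : Nat.Coprime p a := Nat.coprime_of_squarefree_mul hsf
    have ih' := ih (fun r hr hra => h r hr (hra.mul_left p)) hsf.of_mul_right
    have ha : 0 < a := Nat.pos_of_ne_zero hsf.of_mul_right.ne_zero
    have hφ : (0 : ℝ) < a.totient := by exact_mod_cast Nat.totient_pos.mpr ha
    have hp' := h p hp (dvd_mul_right _ _)
    have hp2 : (2 : ℝ) ≤ p := by exact_mod_cast hp.two_le
    have hpe : 0 < (p : ℝ) ^ e := by positivity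
    rw [hcop.card_divisors_mul, Nat.totient_mul hcop, Nat.totient_prime hp, hp.divisors,
      card_pair hp.one_lt.ne]
    push_cast [Nat.cast_sub hp.one_lt.le]
    rw [Real.mul_rpow (by positivity) (by positivity), mul_pow, mul_div_mul_comm]
    gcongr
    rw [Real.rpow_neg (by positivity), div_le_iff₀ (by linarith), ← div_eq_inv_mul,
      le_div_iff₀ hpe]
    linarith

lemma prime_gt_of_coprime_primorial {w p : ℕ} (hp : p.Prime)
    (h : Nat.Coprime (primorial w) p) : w < p := by
  by_contra hle
  have : p ∣ primorial w := by
    unfold primorial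
    exact dvd_prod_of_mem _ (mem_filter.mpr ⟨mem_range.mpr (by omega), hp⟩)
  have := Nat.Coprime.eq_one_of_dvd h.symm this
  exact hp.one_lt.ne' this

lemma gt_of_coprime_primorial {w q : ℕ} (hq : 1 < q) (h : Nat.Coprime (primorial w) q) : w < q :=
  (prime_gt_of_coprime_primorial (Nat.minFac_prime hq.ne')
    (Nat.Coprime.coprime_dvd_right (Nat.minFac_dvd q) h)).trans_le (Nat.minFac_le (by omega))

/-- The arithmetic input for the off-diagonal bound. -/
lemma exists_weight_bound {e : ℝ} (he : e < 1) : ∃ w₀ : ℕ, ∀ w : ℕ, w₀ ≤ w → ∀ q : ℕ, 1 < q →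
    Squarefree q → Nat.Coprime (primorial w) q →
      (w : ℝ) ≤ q ∧ (q.divisors.card : ℝ) ^ 2 / q.totient ≤ (q : ℝ) ^ (-e) := by
  obtain ⟨w₀, hw₀⟩ := exists_prime_bound he
  refine ⟨w₀, fun w hw q hq hsf hc => ⟨?_, divisor_sq_le q (fun p hp hpq => hw₀ p ?_) hsf⟩⟩
  · exact_mod_cast (gt_of_coprime_primorial hq hc).le
  · have := prime_gt_of_coprime_primorial hp (Nat.Coprime.coprime_dvd_right hpq hc)
    omega

end Vino

namespace Vino

open Finset

/-- Squarefree moduli up to `F` coprime to `M`. -/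
def sieveD (M F : ℕ) : Finset ℕ := (Icc 1 F).filter (fun d => Squarefree d ∧ Nat.Coprime M d)

lemma mem_sieveD {M F d : ℕ} : d ∈ sieveD M F ↔ (1 ≤ d ∧ d ≤ F) ∧ Squarefree d ∧ Nat.Coprime M d := by
  simp [sieveD]

/-- The inverse as a monoid homomorphism. -/
noncomputable def invHom : ℕ →* ℝ where
  toFun n := (n : ℝ)⁻¹
  map_one' := by simp
  map_mul' a b := by push_cast; rw [mul_inv]

lemma sum_fiber_primeFactors_le {d : ℕ} (hd : Squarefree d) (A : Finset ℕ)
    (hA : ∀ n ∈ A, n ≠ 0 ∧ n.primeFactors = d.primeFactors) :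
    ∑ n ∈ A, (1 : ℝ) / n ≤ 1 / d.totient := by
  have hd0 : 0 < d := Nat.pos_of_ne_zero hd.ne_zero
  obtain ⟨hs, hsum⟩ := EulerProduct.summable_and_hasSum_factoredNumbers_prod_filter_prime_geometric
    (f := invHom) (fun {p} hp => by
      change ‖((p : ℝ))⁻¹‖ < 1
      rw [norm_inv, Real.norm_natCast]
      exact inv_lt_one_of_one_lt₀ (by exact_mod_cast hp.one_lt)) d.primeFactors
  have hfilt : d.primeFactors.filter Nat.Prime = d.primeFactors :=
    filter_true_of_mem fun p hp => Nat.prime_of_mem_primeFactors hp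
  rw [hfilt] at hsum
  have hdvd : ∀ n ∈ A, d ∣ n := by
    intro n hn
    rw [← Nat.prod_primeFactors_of_squarefree hd, ← (hA n hn).2]
    exact Nat.prod_primeFactors_dvd n
  have hmem : ∀ n ∈ A, n / d ∈ Nat.factoredNumbers d.primeFactors := by
    intro n hn
    have hnd := Nat.div_dvd_of_dvd (hdvd n hn)
    apply Nat.mem_factoredNumbers_of_dvd _ hnd
    rw [← (hA n hn).2]
    exact Nat.mem_factoredNumbers_of_primeFactors_subset (hA n hn).1 subset_rfl
  let B : Finset (Nat.factoredNumbers d.primeFactors) :=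
    A.attach.image fun n => ⟨n.1 / d, hmem n.1 n.2⟩
  have h1 : ∑ k ∈ B, invHom k ≤ ∏ p ∈ d.primeFactors, (1 - invHom p)⁻¹ := by
    apply sum_le_hasSum _ _ hsum
    intro k _
    change 0 ≤ ((k : ℕ) : ℝ)⁻¹
    positivity
  have h2 : ∑ n ∈ A, (1 : ℝ) / n = (d : ℝ)⁻¹ * ∑ k ∈ B, invHom k := by
    rw [sum_image, mul_sum, ← sum_attach]
    · apply sum_congr rfl
      intro n _
      change _ = (d : ℝ)⁻¹ * (((n.1 / d : ℕ) : ℝ))⁻¹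
      rw [Nat.cast_div (hdvd n.1 n.2) (by positivity), ← mul_inv, one_div]
      congr 1
      field_simp
    · intro a _ b _ hab
      have := congrArg Subtype.val hab
      simp only at this
      apply Subtype.ext
      rw [← Nat.div_mul_cancel (hdvd a.1 a.2), ← Nat.div_mul_cancel (hdvd b.1 b.2), this]
  have h3 : (d.totient : ℝ) = d * ∏ p ∈ d.primeFactors, (1 - invHom p) := by
    have := congrArg (fun z : ℚ => (z : ℝ)) (Nat.totient_eq_mul_prod_factors d)
    push_cast at this
    exact this
  rw [h2, h3, one_div, mul_inv, ← prod_inv_distrib]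
  gcongr

lemma sum_coprime_inv_le_sieveG (M F : ℕ) :
    ∑ n ∈ (Icc 1 F).filter (fun n => Nat.Coprime M n), (1 : ℝ) / n ≤ sieveG (sieveD M F) := by
  rw [← sum_fiberwise_of_maps_to (t := sieveD M F) (g := fun n => ∏ p ∈ n.primeFactors, p)]
  · apply sum_le_sum
    intro d hd
    obtain ⟨_, hsf, _⟩ := mem_sieveD.mp hd
    apply sum_fiber_primeFactors_le hsf
    intro n hn
    obtain ⟨h1, h2⟩ := mem_filter.mp hn
    have h3 := (mem_Icc.mp (mem_filter.mp h1).1).1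
    refine ⟨by omega, ?_⟩
    rw [← h2, Nat.primeFactors_prod fun p hp => Nat.prime_of_mem_primeFactors hp]
  · intro n hn
    obtain ⟨h1, h2⟩ := mem_filter.mp hn
    obtain ⟨h3, h4⟩ := mem_Icc.mp h1
    have hdvd := Nat.prod_primeFactors_dvd n
    rw [mem_sieveD]
    refine ⟨⟨Nat.pos_of_dvd_of_pos hdvd (by omega), (Nat.le_of_dvd (by omega) hdvd).trans h4⟩, ?_,
      Nat.Coprime.coprime_dvd_right hdvd h2⟩
    rw [← Nat.radical_eq_prod_primeFactors]
    exact UniqueFactorizationMonoid.squarefree_radical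

lemma log_le_sum_coprime_inv {M : ℕ} (hM : 0 < M) (F : ℕ) (hF : 0 < F) :
    (M.totient : ℝ) / M * Real.log ((F : ℝ) / M) ≤
      ∑ n ∈ (Icc 1 F).filter (fun n => Nat.Coprime M n), (1 : ℝ) / n := by
  set N := F / M with hN
  have hM0 : (0 : ℝ) < M := by exact_mod_cast hM
  have h1 : ∑ j ∈ range N, (M.totient : ℝ) * (1 / (((j + 1 : ℕ) : ℝ) * M)) ≤
      ∑ n ∈ (Icc 1 F).filter (fun n => Nat.Coprime M n), (1 : ℝ) / n := by
    have hsub : (range N).biUnion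
        (fun j => (Ico (j * M + 1) (j * M + 1 + M)).filter (fun n => Nat.Coprime M n)) ⊆
        (Icc 1 F).filter (fun n => Nat.Coprime M n) := by
      intro n hn
      obtain ⟨j, hj, hn⟩ := mem_biUnion.mp hn
      obtain ⟨h1, h2⟩ := mem_filter.mp hn
      obtain ⟨h3, h4⟩ := mem_Ico.mp h1
      refine mem_filter.mpr ⟨mem_Icc.mpr ⟨by omega, ?_⟩, h2⟩
      have h5 : (j + 1) * M ≤ N * M := Nat.mul_le_mul_right _ (mem_range.mp hj)
      have h6 : N * M ≤ F := Nat.div_mul_le_self _ _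
      have h7 : (j + 1) * M = j * M + M := by ring
      omega
    refine le_trans ?_ (sum_le_sum_of_subset_of_nonneg hsub fun n _ _ => by positivity)
    rw [sum_biUnion]
    · apply sum_le_sum
      intro j _
      rw [← Nat.filter_coprime_Ico_eq_totient M (j * M + 1), ← nsmul_eq_mul]
      apply card_nsmul_le_sum
      intro n hn
      obtain ⟨h3, h4⟩ := mem_Ico.mp (mem_filter.mp hn).1
      have h5 : 0 < n := by omega
      have h6 : n ≤ (j + 1) * M := by
        have : (j + 1) * M = j * M + M := by ring
        omega
      have h6' : (n : ℝ) ≤ ((j + 1 : ℕ) : ℝ) * M := by exact_mod_cast h6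
      gcongr
    · intro i _ j _ hij
      rw [Function.onFun, disjoint_left]
      intro n hn hn'
      obtain ⟨h3, h4⟩ := mem_Ico.mp (mem_filter.mp hn).1
      obtain ⟨h5, h6⟩ := mem_Ico.mp (mem_filter.mp hn').1
      rcases Nat.lt_or_gt_of_ne hij with h | h
      · have : (i + 1) * M ≤ j * M := Nat.mul_le_mul_right _ h
        have e : (i + 1) * M = i * M + M := by ring
        omega
      · have : (j + 1) * M ≤ i * M := Nat.mul_le_mul_right _ h
        have e : (j + 1) * M = j * M + M := by ring
        omega
  refine le_trans ?_ h1
  have h2 : ∑ j ∈ range N, (M.totient : ℝ) * (1 / (((j + 1 : ℕ) : ℝ) * M)) =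
      (M.totient : ℝ) / M * (harmonic N : ℝ) := by
    rw [harmonic]
    push_cast
    rw [mul_sum]
    apply sum_congr rfl
    intro j _
    have : (j : ℝ) + 1 ≠ 0 := by positivity
    field_simp
  rw [h2]
  gcongr
  refine le_trans ?_ (log_add_one_le_harmonic N)
  apply Real.log_le_log (by positivity)
  rw [div_le_iff₀ hM0]
  have := (Nat.lt_succ_iff.mp (Nat.lt_succ_of_lt (Nat.lt_mul_div_succ F hM)))
  have h3 : (F : ℝ) ≤ M * (((F / M : ℕ) : ℝ) + 1) := by exact_mod_cast this
  rw [hN]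
  push_cast
  linarith

lemma sieveG_lower {M : ℕ} (hM : 0 < M) (F : ℕ) (hF : 0 < F) :
    (M.totient : ℝ) / M * Real.log ((F : ℝ) / M) ≤ sieveG (sieveD M F) :=
  (log_le_sum_coprime_inv hM F hF).trans (sum_coprime_inv_le_sieveG M F)

lemma sieveG_mul_prime_le {p : ℕ} (hp : p.Prime) (M F : ℕ) :
    sieveG (sieveD M F) ≤ (p : ℝ) / (p - 1) * sieveG (sieveD (M * p) F) := by
  have hp1 : (1 : ℝ) < p := by exact_mod_cast hp.one_lt
  have hcop : ∀ d, Nat.Coprime p d ↔ ¬ p ∣ d := fun d => hp.coprime_iff_not_dvd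
  have h1 : (sieveD M F).filter (fun d => ¬ p ∣ d) = sieveD (M * p) F := by
    ext d
    simp only [mem_filter, mem_sieveD, Nat.coprime_mul_iff_left, hcop]
    tauto
  have h2 : ∑ d ∈ (sieveD M F).filter (fun d => p ∣ d), (1 : ℝ) / d.totient ≤
      1 / (p - 1) * sieveG (sieveD (M * p) F) := by
    have hquo : ∀ d ∈ (sieveD M F).filter (fun d => p ∣ d), ∃ a, d = p * a ∧
        a ∈ sieveD (M * p) F ∧ d / p = a ∧ Nat.Coprime p a := by
      intro d hd
      obtain ⟨h1, a, rfl⟩ := mem_filter.mp hd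
      obtain ⟨⟨h3, h4⟩, h5, h6⟩ := mem_sieveD.mp h1
      have hpa := Nat.coprime_of_squarefree_mul h5
      refine ⟨a, rfl, mem_sieveD.mpr ⟨⟨?_, ?_⟩, h5.of_mul_right, ?_⟩,
        Nat.mul_div_cancel_left _ hp.pos, hpa⟩
      · exact Nat.pos_of_mul_pos_left h3
      · exact (Nat.le_mul_of_pos_left a hp.pos).trans h4
      · exact Nat.Coprime.mul_left (Nat.Coprime.coprime_mul_left_right h6) hpa
    rw [sieveG, mul_sum]
    calc ∑ d ∈ (sieveD M F).filter (fun d => p ∣ d), (1 : ℝ) / d.totient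
        = ∑ d ∈ (sieveD M F).filter (fun d => p ∣ d), 1 / ((p : ℝ) - 1) *
            (1 / (d / p).totient) := by
          apply sum_congr rfl
          intro d hd
          obtain ⟨a, h1, _, h3, h4⟩ := hquo d hd
          rw [h3, h1, Nat.totient_mul h4, Nat.totient_prime hp]
          push_cast [Nat.cast_sub hp.one_lt.le]
          rw [one_div_mul_one_div]
      _ = ∑ a ∈ ((sieveD M F).filter (fun d => p ∣ d)).image (fun d => d / p),
            1 / ((p : ℝ) - 1) * (1 / (a.totient : ℝ)) := by
          rw [sum_image]
          intro d hd d' hd' h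
          obtain ⟨a, h1, _, h3, _⟩ := hquo d hd
          obtain ⟨a', h1', _, h3', _⟩ := hquo d' hd'
          simp only at h
          rw [h1, h1', ← h3, ← h3', h]
      _ ≤ _ := by
          apply sum_le_sum_of_subset_of_nonneg
          · intro a ha
            obtain ⟨d, hd, rfl⟩ := mem_image.mp ha
            obtain ⟨a, _, h2, h3, _⟩ := hquo d hd
            rwa [h3]
          · intro a _ _
            have : 0 < (p : ℝ) - 1 := by linarith
            positivity
  calc sieveG (sieveD M F) = ∑ d ∈ (sieveD M F).filter (fun d => p ∣ d), (1 : ℝ) / d.totient +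
        ∑ d ∈ (sieveD M F).filter (fun d => ¬ p ∣ d), (1 : ℝ) / d.totient := by
        rw [sum_filter_add_sum_filter_not, sieveG]
    _ ≤ 1 / (p - 1) * sieveG (sieveD (M * p) F) + sieveG (sieveD (M * p) F) := by
        rw [h1]
        exact add_le_add h2 le_rfl
    _ = _ := by
        have : (p : ℝ) - 1 ≠ 0 := by linarith
        field_simp
        ring

lemma sieveG_mul_primes_le (T : Finset ℕ) (hT : ∀ p ∈ T, p.Prime) (M F : ℕ) :
    sieveG (sieveD M F) ≤ (∏ p ∈ T, (p : ℝ) / (p - 1)) * sieveG (sieveD (M * ∏ p ∈ T, p) F) := by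
  classical
  induction T using Finset.induction_on with
  | empty => simp
  | insert p T hp ih =>
    have ih' := ih fun q hq => hT q (mem_insert_of_mem hq)
    have hpp := hT p (mem_insert_self _ _)
    rw [prod_insert hp, prod_insert hp]
    have h := sieveG_mul_prime_le hpp (M * ∏ q ∈ T, q) F
    have h0 : (0 : ℝ) ≤ ∏ q ∈ T, (q : ℝ) / (q - 1) := by
      apply prod_nonneg
      intro q hq
      have : (1 : ℝ) < q := by exact_mod_cast (hT q (mem_insert_of_mem hq)).one_lt
      have : 0 < (q : ℝ) - 1 := by linarith
      positivity
    calc _ ≤ _ := ih'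
      _ ≤ (∏ q ∈ T, (q : ℝ) / (q - 1)) *
          ((p : ℝ) / (p - 1) * sieveG (sieveD (M * (∏ q ∈ T, q) * p) F)) := by gcongr
      _ = _ := by
          rw [show M * (p * ∏ q ∈ T, q) = M * (∏ q ∈ T, q) * p by ring]
          ring

end Vino

namespace Vino

open Finset

/-- Hilbert-type bound for well-spaced frequencies. -/
lemma gram_bound {ι : Type*} [DecidableEq ι] (I : Finset ι) (θ : ι → ℝ) (H : ℕ) {κ : ℝ} (hκ : 0 ≤ κ)
    (h : ∀ i ∈ I, ∀ j ∈ I, i ≠ j → ‖geo H (θ i - θ j)‖ ≤ κ) (γ : ι → ℂ) :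
    ∑ n ∈ range H, ‖∑ i ∈ I, γ i * ee (n * θ i)‖ ^ 2 ≤ (H + κ * #I) * ∑ i ∈ I, ‖γ i‖ ^ 2 := by
  have h1 := sum_normSq_one I θ γ H
  have h2 : ∑ n ∈ range H, ‖∑ i ∈ I, γ i * ee (n * θ i)‖ ^ 2
      ≤ ∑ i ∈ I, ∑ j ∈ I, ‖γ i‖ * ‖γ j‖ * ‖geo H (θ i - θ j)‖ := by
    have h3 : ∑ n ∈ range H, ‖∑ i ∈ I, γ i * ee (n * θ i)‖ ^ 2 = ‖((∑ n ∈ range H, ‖∑ i ∈ I, γ i * ee (n * θ i)‖ ^ 2 : ℝ) : ℂ)‖ := by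
      rw [Complex.norm_real, Real.norm_of_nonneg (sum_nonneg fun _ _ => by positivity)]
    rw [h3, h1]
    refine (norm_sum_le _ _).trans (sum_le_sum fun i _ => (norm_sum_le _ _).trans (sum_le_sum fun j _ => ?_))
    simp
  refine h2.trans ?_
  have h4 : ∀ i ∈ I, ∀ j ∈ I, ‖γ i‖ * ‖γ j‖ * ‖geo H (θ i - θ j)‖ ≤
      κ * (‖γ i‖ * ‖γ j‖) + (if i = j then H * ‖γ i‖ ^ 2 else 0) := by
    intro i hi j hj
    by_cases hij : i = j
    · subst hij
      rw [sub_self, geo_zero, if_pos rfl]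
      simp only [Complex.norm_natCast]
      nlinarith [mul_nonneg hκ (mul_nonneg (norm_nonneg (γ i)) (norm_nonneg (γ i)))]
    · rw [if_neg hij, add_zero, mul_comm κ]
      exact mul_le_mul_of_nonneg_left (h i hi j hj hij) (by positivity)
  calc _ ≤ ∑ i ∈ I, ∑ j ∈ I, (κ * (‖γ i‖ * ‖γ j‖) + (if i = j then H * ‖γ i‖ ^ 2 else 0)) :=
        sum_le_sum fun i hi => sum_le_sum fun j hj => h4 i hi j hj
    _ = κ * (∑ i ∈ I, ∑ j ∈ I, ‖γ i‖ * ‖γ j‖) + H * ∑ i ∈ I, ‖γ i‖ ^ 2 := by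
        simp only [sum_add_distrib, mul_sum]
        congr 1
        apply sum_congr rfl
        intro i hi
        rw [sum_ite_eq, if_pos hi]
    _ ≤ κ * (#I * ∑ i ∈ I, ‖γ i‖ ^ 2) + H * ∑ i ∈ I, ‖γ i‖ ^ 2 := by
        gcongr
        exact sum_norm_sq_le_card I γ
    _ = _ := by ring

/-- Sequences supported on integers `W n + b` without small prime factors, with the energy expected of
the normalised primes. -/
structure SieveWeight (W b H : ℕ) (f : ℕ → ℝ) : Prop where
  cop : ∀ n < H, f n ≠ 0 → ∀ d, 1 ≤ d → d ≤ H → Nat.Coprime (W * n + b) d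
  energy : ∑ n ∈ range H, f n ^ 2 ≤ 1.001 * ((W.totient : ℝ) / W) * H * Real.log H

lemma log_sq_mul_rpow_le {δ : ℝ} (hδ : 0 < δ) :
    ∀ᶠ H : ℕ in atTop, 100 * (1 + Real.log H) ^ 2 * (H : ℝ) ^ (0.999 : ℝ) ≤ δ * H := by
  have h1 : (fun x : ℝ => (1 + Real.log x)) =o[atTop] (fun x : ℝ => x ^ (0.0005 : ℝ)) := by
    apply Asymptotics.IsLittleO.add
    · apply Asymptotics.isLittleO_const_left.2
      right
      exact tendsto_norm_atTop_atTop.comp (tendsto_rpow_atTop (by norm_num))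
    · exact isLittleO_log_rpow_atTop (by norm_num)
  have h2 := h1.pow (n := 2) (by norm_num)
  have h3 := (h2.def (c := δ / 100) (by positivity))
  filter_upwards [tendsto_natCast_atTop_atTop.eventually h3, eventually_ge_atTop 1] with H hH hH1
  have hH0 : (0 : ℝ) < H := by exact_mod_cast hH1
  rw [Real.norm_of_nonneg (by positivity), Real.norm_of_nonneg (by positivity),
    ← Real.rpow_natCast ((H : ℝ) ^ (0.0005 : ℝ)), ← Real.rpow_mul hH0.le] at hH
  have h4 : (H : ℝ) = (H : ℝ) ^ ((0.0005 : ℝ) * (2 : ℕ)) * (H : ℝ) ^ (0.999 : ℝ) := by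
    rw [← Real.rpow_add hH0]; norm_num
  have h5 : 0 ≤ (H : ℝ) ^ (0.999 : ℝ) := by positivity
  calc 100 * (1 + Real.log H) ^ 2 * (H : ℝ) ^ (0.999 : ℝ)
      ≤ 100 * (δ / 100 * (H : ℝ) ^ ((0.0005 : ℝ) * (2 : ℕ))) * (H : ℝ) ^ (0.999 : ℝ) := by gcongr
    _ = δ * ((H : ℝ) ^ ((0.0005 : ℝ) * (2 : ℕ)) * (H : ℝ) ^ (0.999 : ℝ)) := by ring
    _ = δ * H := by rw [← h4]

lemma floor_rpow_pow_le (a : ℝ) (k : ℕ) (H : ℕ) :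
    ((⌊(H : ℝ) ^ a⌋₊ : ℝ)) ^ k ≤ (H : ℝ) ^ (a * k) := by
  rw [Real.rpow_mul (by positivity), Real.rpow_natCast]
  gcongr
  exact Nat.floor_le (by positivity)

/-- The error bracket of `offdiag_bound` for the parameters used below. -/
lemma bracket_le {w : ℝ} (hw : 1 ≤ w) {H : ℕ} (hH : 1 ≤ H) :
    w ^ (-(0.999 : ℝ)) * (2 * H + ((H : ℝ) ^ (0.4 : ℝ)) ^ 2 * (1 + Real.log (((H : ℝ) ^ (0.4 : ℝ)) ^ 2)))
      + ((Nat.log 2 H + 1 : ℕ) : ℝ) * (2 * H * ((H : ℝ) ^ (0.4 : ℝ)) ^ (-(0.999 : ℝ))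
        + 4 * ((⌊(H : ℝ) ^ (0.499 : ℝ)⌋₊ : ℝ) ^ 2) ^ (2 - (0.999 : ℝ))
          * (1 + Real.log (4 * (⌊(H : ℝ) ^ (0.499 : ℝ)⌋₊ : ℝ) ^ 4)))
      ≤ 2 * w ^ (-(0.999 : ℝ)) * H + 100 * (1 + Real.log H) ^ 2 * (H : ℝ) ^ (0.999 : ℝ) := by
  have hH1 : (1 : ℝ) ≤ H := by exact_mod_cast hH
  have hH0 : (0 : ℝ) < H := by linarith
  set l := Real.log H with hl
  have hl0 : 0 ≤ l := Real.log_nonneg hH1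
  set Z := (H : ℝ) ^ (0.999 : ℝ) with hZ
  have hZ0 : 0 < Z := by positivity
  have hw1 : w ^ (-(0.999 : ℝ)) ≤ 1 := Real.rpow_le_one_of_one_le_of_nonpos hw (by norm_num)
  have hw0 : 0 ≤ w ^ (-(0.999 : ℝ)) := by positivity
  have hY : ((H : ℝ) ^ (0.4 : ℝ)) ^ 2 = (H : ℝ) ^ (0.8 : ℝ) := by
    rw [← Real.rpow_natCast, ← Real.rpow_mul hH0.le]; norm_num
  have hY1 : (H : ℝ) ^ (0.8 : ℝ) ≤ Z := Real.rpow_le_rpow_of_exponent_le hH1 (by norm_num)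
  have hY2 : 2 * H * ((H : ℝ) ^ (0.4 : ℝ)) ^ (-(0.999 : ℝ)) ≤ 2 * Z := by
    rw [← Real.rpow_mul hH0.le, mul_assoc]
    gcongr
    calc (H : ℝ) * (H : ℝ) ^ ((0.4 : ℝ) * (-(0.999 : ℝ))) = (H : ℝ) ^ ((1 : ℝ) + (0.4 : ℝ) * (-(0.999 : ℝ))) := by
          rw [Real.rpow_add hH0, Real.rpow_one]
      _ ≤ Z := Real.rpow_le_rpow_of_exponent_le hH1 (by norm_num)
  set F := ⌊(H : ℝ) ^ (0.499 : ℝ)⌋₊ with hF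
  have hF1 : 1 ≤ F := Nat.le_floor (by simpa using Real.one_le_rpow hH1 (by norm_num))
  have hF1' : (1 : ℝ) ≤ F := by exact_mod_cast hF1
  have hF2 : ((F : ℝ) ^ 2) ^ (2 - (0.999 : ℝ)) ≤ Z := by
    calc ((F : ℝ) ^ 2) ^ (2 - (0.999 : ℝ)) ≤ ((H : ℝ) ^ ((0.499 : ℝ) * (2 : ℕ))) ^ (2 - (0.999 : ℝ)) := by
          apply Real.rpow_le_rpow (by positivity) _ (by norm_num)
          exact floor_rpow_pow_le _ 2 H
      _ ≤ Z := by
          rw [← Real.rpow_mul hH0.le]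
          exact Real.rpow_le_rpow_of_exponent_le hH1 (by norm_num)
  have hF4 : (F : ℝ) ^ 4 ≤ (H : ℝ) ^ 2 := by
    refine (floor_rpow_pow_le _ 4 H).trans ?_
    rw [← Real.rpow_natCast]
    exact Real.rpow_le_rpow_of_exponent_le hH1 (by norm_num)
  have hlog4 : Real.log 4 ≤ 2 := by
    have := Real.log_two_lt_d9
    rw [show (4 : ℝ) = 2 ^ 2 by norm_num, Real.log_pow]
    push_cast; linarith
  have hlF : Real.log (4 * (F : ℝ) ^ 4) ≤ 2 + 2 * l := by
    calc Real.log (4 * (F : ℝ) ^ 4) ≤ Real.log (4 * (H : ℝ) ^ 2) := by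
          apply Real.log_le_log (by positivity); gcongr
      _ = Real.log 4 + 2 * l := by rw [Real.log_mul (by norm_num) (by positivity), Real.log_pow]; push_cast; rfl
      _ ≤ _ := by linarith
  have hlF0 : 0 ≤ Real.log (4 * (F : ℝ) ^ 4) := by
    apply Real.log_nonneg; nlinarith [one_le_pow₀ hF1' (n := 4)]
  have hK : ((Nat.log 2 H + 1 : ℕ) : ℝ) ≤ 2 * l + 1 := by
    push_cast
    have h1 : (2 : ℝ) ^ (Nat.log 2 H) ≤ H := by exact_mod_cast Nat.pow_log_le_self 2 (by omega)
    have h2 := Real.log_le_log (by positivity) h1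
    rw [Real.log_pow] at h2
    have h3 := Real.log_two_gt_d9
    have h4 : (0 : ℝ) ≤ Nat.log 2 H := by positivity
    nlinarith
  rw [hY, Real.log_rpow hH0, ← hl]
  have a1 : w ^ (-(0.999 : ℝ)) * (2 * H + (H : ℝ) ^ (0.8 : ℝ) * (1 + 0.8 * l)) ≤
      2 * w ^ (-(0.999 : ℝ)) * H + Z * (1 + 0.8 * l) := by
    have : w ^ (-(0.999 : ℝ)) * ((H : ℝ) ^ (0.8 : ℝ) * (1 + 0.8 * l)) ≤ 1 * (Z * (1 + 0.8 * l)) := by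
      gcongr
    linarith
  have a2 : ((Nat.log 2 H + 1 : ℕ) : ℝ) * (2 * H * ((H : ℝ) ^ (0.4 : ℝ)) ^ (-(0.999 : ℝ))
        + 4 * ((F : ℝ) ^ 2) ^ (2 - (0.999 : ℝ)) * (1 + Real.log (4 * (F : ℝ) ^ 4)))
      ≤ (2 * l + 1) * (2 * Z + 4 * Z * (1 + (2 + 2 * l))) := by
    gcongr
  have a3 : Z * (1 + 0.8 * l) + (2 * l + 1) * (2 * Z + 4 * Z * (1 + (2 + 2 * l))) ≤ 100 * (1 + l) ^ 2 * Z := by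
    nlinarith [mul_nonneg hZ0.le hl0, mul_nonneg hZ0.le (mul_nonneg hl0 hl0)]
  linarith

lemma log_floor_div_ge {a c : ℝ} (hc : 0 ≤ c) (hca : c < a) (W : ℕ) (hW : 0 < W) :
    ∀ᶠ H : ℕ in atTop, c * Real.log H ≤ Real.log ((⌊(H : ℝ) ^ a⌋₊ : ℝ) / W) := by
  have h1 : Tendsto (fun H : ℕ => (H : ℝ) ^ (a - c)) atTop atTop :=
    (tendsto_rpow_atTop (by linarith)).comp tendsto_natCast_atTop_atTop
  filter_upwards [h1.eventually_ge_atTop (2 * W), eventually_ge_atTop 1] with H hH hH1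
  have hH1' : (1 : ℝ) ≤ H := by exact_mod_cast hH1
  have hH0 : (0 : ℝ) < H := by linarith
  have hW0 : (1 : ℝ) ≤ W := by exact_mod_cast hW
  rw [← Real.log_rpow hH0]
  apply Real.log_le_log (by positivity)
  rw [le_div_iff₀ (by positivity)]
  have h2 := Nat.lt_floor_add_one ((H : ℝ) ^ a)
  have h3 : (H : ℝ) ^ a = (H : ℝ) ^ c * (H : ℝ) ^ (a - c) := by
    rw [← Real.rpow_add hH0]; congr 1; ring
  have h4 : 1 ≤ (H : ℝ) ^ c := Real.one_le_rpow hH1' hc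
  rw [h3] at h2 ⊢
  nlinarith

/-- The dual sieve for normalised primes. -/
theorem sieve_mean_value {ι : Type*} [DecidableEq ι] (B₀ : ℝ) (hB₀ : 0 < B₀) :
    ∃ w₀ : ℕ, ∀ w : ℕ, w₀ ≤ w →
    ∀ᶠ H : ℕ in atTop, ∀ (f : ℕ → ℝ) (b : ℕ), SieveWeight (primorial w) b H f →
    ∀ (I : Finset ι) (θ : ι → ℝ) (B : ℝ), 0 ≤ B → (#I : ℝ) ≤ B₀ →
    (∀ γ : ι → ℂ, ∑ n ∈ range H, ‖∑ i ∈ I, γ i * ee (n * θ i)‖ ^ 2 ≤ B * ∑ i ∈ I, ‖γ i‖ ^ 2) →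
    ∑ i ∈ I, ‖expS H f (θ i)‖ ^ 2 ≤ 2.01 * H * (B + 0.001 * H) := by
  obtain ⟨w₁, hw₁⟩ := exists_weight_bound (e := 0.999) (by norm_num)
  have hlim : Tendsto (fun w : ℕ => (w : ℝ) ^ (-(0.999 : ℝ))) atTop (nhds 0) :=
    (tendsto_rpow_neg_atTop (by norm_num)).comp tendsto_natCast_atTop_atTop
  have hev : ∀ᶠ w : ℕ in atTop, (w : ℝ) ^ (-(0.999 : ℝ)) < 0.00025 / B₀ :=
    hlim.eventually_lt_const (by positivity)
  obtain ⟨w₂, hw₂⟩ := eventually_atTop.1 hev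
  refine ⟨max (max w₁ w₂) 1, fun w hw => ?_⟩
  have hww1 : w₁ ≤ w := by omega
  have hww2 : w₂ ≤ w := by omega
  have hw1 : 1 ≤ w := by omega
  have hw1' : (1 : ℝ) ≤ w := by exact_mod_cast hw1
  set W := primorial w with hWdef
  have hWpos : 0 < W := primorial_pos w
  have hlogpos : ∀ᶠ H : ℕ in atTop, 1 ≤ Real.log H :=
    (Real.tendsto_log_atTop.comp tendsto_natCast_atTop_atTop).eventually_ge_atTop 1
  filter_upwards [log_sq_mul_rpow_le (δ := 0.0005 / B₀) (by positivity), log_floor_div_ge (a := 0.499) (c := 0.4985)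
      (by norm_num) (by norm_num) W hWpos,
    eventually_ge_atTop 1, hlogpos] with H hH1 hH2 hH3 hH4 f b hf I θ B hB0 hI hB
  have hHr : (1 : ℝ) ≤ H := by exact_mod_cast hH3
  set F := ⌊(H : ℝ) ^ (0.499 : ℝ)⌋₊ with hF
  have hF1 : 1 ≤ F := Nat.le_floor (by simpa using Real.one_le_rpow hHr (by norm_num))
  have hFH : F ≤ H := by
    have : (F : ℝ) ≤ H := (Nat.floor_le (by positivity)).trans
      ((Real.rpow_le_rpow_of_exponent_le hHr (by norm_num)).trans_eq (Real.rpow_one _))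
    exact_mod_cast this
  have hF2 : (F : ℝ) ^ 2 ≤ H := by
    refine (floor_rpow_pow_le _ 2 H).trans ?_
    exact (Real.rpow_le_rpow_of_exponent_le hHr (by norm_num)).trans_eq (Real.rpow_one _)
  set D := sieveD W F with hD
  have hdD : ∀ {d}, d ∈ D → _ := fun {d} hd => mem_sieveD.1 hd
  have hG := sieveG_lower hWpos F hF1
  rw [← hD] at hG
  set Φ : ℝ := (W.totient : ℝ) / W with hΦ
  have hΦ0 : 0 < Φ := by
    have := Nat.totient_pos.2 hWpos
    positivity
  have hG2 : Φ * (0.4985 * Real.log H) ≤ sieveG D := (mul_le_mul_of_nonneg_left hH2 hΦ0.le).trans hG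
  have hG0 : 0 < sieveG D := lt_of_lt_of_le (by positivity) hG2
  have hYge : 1 ≤ (H : ℝ) ^ (0.4 : ℝ) := Real.one_le_rpow hHr (by norm_num)
  have hKK : (F : ℝ) ^ 2 ≤ 2 ^ (Nat.log 2 H + 1) * (H : ℝ) ^ (0.4 : ℝ) := by
    have h1 : (H : ℝ) ≤ 2 ^ (Nat.log 2 H + 1) := by
      exact_mod_cast (Nat.lt_pow_succ_log_self (by norm_num) H).le
    calc (F : ℝ) ^ 2 ≤ 2 ^ (Nat.log 2 H + 1) * 1 := by linarith
      _ ≤ _ := by gcongr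
  have hoff := fun α : ℝ => (offdiag_bound D (fun d hd => (hdD hd).2.1)
    (fun d hd g hg => mem_sieveD.2 ⟨⟨Nat.pos_of_dvd_of_pos hg (hdD hd).1.1,
      (Nat.le_of_dvd (hdD hd).1.1 hg).trans (hdD hd).1.2⟩, (hdD hd).2.1.squarefree_of_dvd hg,
      (hdD hd).2.2.coprime_dvd_right hg⟩) (W := W) (F := F) (fun d hd => (hdD hd).2.2) (fun d hd => (hdD hd).1.2)
    hF1 (w := w) (e := 0.999) (by positivity) (by norm_num) (by norm_num)
    (fun q h1 h2 h3 => hw₁ w hww1 q h1 h2 h3) hYge hKK H α).trans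
      (mul_le_mul_of_nonneg_left (bracket_le hw1' hH3) hG0.le)
  set R := 2 * (w : ℝ) ^ (-(0.999 : ℝ)) * H + 100 * (1 + Real.log H) ^ 2 * (H : ℝ) ^ (0.999 : ℝ) with hR
  have hR0 : 0 ≤ R := by positivity
  have hRle : R ≤ 0.001 / B₀ * H := by
    have h1 := hw₂ w hww2
    have h2 : 2 * (w : ℝ) ^ (-(0.999 : ℝ)) * H ≤ 2 * (0.00025 / B₀) * H := by gcongr
    have h3 : 2 * (0.00025 / B₀) * H + 0.0005 / B₀ * H = 0.001 / B₀ * H := by ring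
    linarith
  have hmain := farey_sieve I D W b (fun d hd => (hdD hd).2.1) θ H f (B := B) (E := sieveG D * R) hB0
    (by positivity) (fun n hn hfn d hd => hf.cop n (mem_range.1 hn) hfn d (hdD hd).1.1 ((hdD hd).1.2.trans hFH))
    hB (fun i _ j _ => hoff (θ i - θ j))
  have hIR : #I * R ≤ 0.001 * H := by
    calc #I * R ≤ B₀ * (0.001 / B₀ * H) := by gcongr
      _ = 0.001 * H := by field_simp
  have hX0 : 0 ≤ ∑ i ∈ I, ‖expS H f (θ i)‖ ^ 2 := sum_nonneg fun _ _ => by positivity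
  set X := ∑ i ∈ I, ‖expS H f (θ i)‖ ^ 2
  have h5 : sieveG D * X ≤ (∑ n ∈ range H, f n ^ 2) * (B + #I * R) := by
    have : sieveG D * (sieveG D * X) ≤ sieveG D * ((∑ n ∈ range H, f n ^ 2) * (B + #I * R)) := by
      linarith
    exact le_of_mul_le_mul_left this hG0
  have h6 : sieveG D * X ≤ (1.001 * Φ * H * Real.log H) * (B + 0.001 * H) := by
    refine h5.trans (mul_le_mul hf.energy (by linarith) (by positivity) (by positivity))
  have h7 : (Φ * Real.log H) * (0.4985 * X) ≤ (Φ * Real.log H) * (1.001 * H * (B + 0.001 * H)) := by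
    have := mul_le_mul_of_nonneg_right hG2 hX0
    linarith
  have h8 := le_of_mul_le_mul_left h7 (by positivity)
  have h9 : 0 ≤ (H : ℝ) * (B + 0.001 * H) := by positivity
  linarith

end Vino

namespace Vino

open Finset

lemma nn_div_ge {P : ℕ} (hP : 0 < P) {L : ℝ} (k : ℤ) (h1 : L ≤ |(k : ℝ)|) (h2 : |(k : ℝ)| ≤ P - L) :
    L / P ≤ nn ((k : ℝ) / P) := by
  have hP0 : (0 : ℝ) < P := by exact_mod_cast hP
  rw [nn_eq]
  set m := round ((k : ℝ) / P)
  have h3 : (k : ℝ) / P - m = (k - m * P) / P := by field_simp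
  rw [h3, abs_div, abs_of_pos hP0]
  gcongr
  by_cases hm : m = 0
  · simpa [hm] using h1
  · have h4 : (1 : ℝ) ≤ |(m : ℝ)| := by exact_mod_cast Int.one_le_abs hm
    have h5 : |(m : ℝ) * P| = |(m : ℝ)| * P := by rw [abs_mul, abs_of_pos hP0]
    have h6 := abs_sub_abs_le_abs_sub ((m : ℝ) * P) k
    rw [abs_sub_comm] at h6
    nlinarith

/-- Mean square of the exponential sum over a bounded set of frequencies. -/
theorem mean_square_bounded_set (B₀ : ℝ) (hB₀ : 0 < B₀) :
    ∃ w₀ : ℕ, ∀ w : ℕ, w₀ ≤ w →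
    ∀ᶠ H : ℕ in atTop, ∀ (f : ℕ → ℝ) (b : ℕ), SieveWeight (primorial w) b H f →
    ∀ Λ ⊆ range (3 * H), (#Λ : ℝ) ≤ B₀ →
    ∑ j ∈ Λ, ‖expS H f ((j : ℝ) / (3 * H : ℕ))‖ ^ 2 ≤ 2.01 * H * (3.001 * H) := by
  obtain ⟨w₀, h⟩ := sieve_mean_value (ι := ℕ) B₀ hB₀
  refine ⟨w₀, fun w hw => ?_⟩
  filter_upwards [h w hw, eventually_ge_atTop 1] with H hH hH1 f b hf Λ hΛ hc
  have := hH f b hf Λ (fun j => (j : ℝ) / (3 * H : ℕ)) (3 * H : ℕ) (by positivity) hc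
    (fun γ => parseval_dual (by omega) (by omega) hΛ γ)
  refine this.trans (le_of_eq ?_)
  push_cast; ring

/-- A frequency far from `0` and `1/2` cannot carry a large exponential sum. -/
theorem far_frequency_bound :
    ∃ w₀ : ℕ, ∀ w : ℕ, w₀ ≤ w →
    ∀ᶠ H : ℕ in atTop, ∀ (f : ℕ → ℝ) (b : ℕ), SieveWeight (primorial w) b H f →
    ∀ j : ℕ, (1500 : ℝ) ≤ j → (j : ℝ) ≤ 3 * H - 1500 → 1500 ≤ |2 * (j : ℝ) - 3 * H| →
    ‖expS H f 0‖ ^ 2 + 2 * ‖expS H f ((j : ℝ) / (3 * H : ℕ))‖ ^ 2 ≤ 2.01 * H * (1.004 * H) := by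
  obtain ⟨w₀, h⟩ := sieve_mean_value (ι := ℕ) 3 (by norm_num)
  refine ⟨w₀, fun w hw => ?_⟩
  filter_upwards [h w hw, eventually_ge_atTop 1] with H hH hH1 f b hf j hj1 hj2 hj3
  have hHr : (1 : ℝ) ≤ H := by exact_mod_cast hH1
  have hP : 0 < 3 * H := by omega
  have hPr : ((3 * H : ℕ) : ℝ) = 3 * H := by push_cast; rfl
  have hj1' : 1500 ≤ j := by exact_mod_cast hj1
  have hj2' : j + 1500 ≤ 3 * H := by
    have : (j : ℝ) + 1500 ≤ 3 * H := by linarith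
    exact_mod_cast this
  obtain ⟨i, hi⟩ : ∃ i, i + j = 3 * H := ⟨3 * H - j, by omega⟩
  have hir : (i : ℝ) = 3 * H - j := by
    have : (i : ℝ) + j = 3 * H := by exact_mod_cast hi
    linarith
  have hij : i ≠ j := by
    rintro rfl
    rw [show 2 * (i : ℝ) - 3 * H = 0 by linarith] at hj3
    norm_num at hj3
  have h0j : (0 : ℕ) ≠ j := by omega
  have h0i : (0 : ℕ) ≠ i := by omega
  have key : ∀ k : ℤ, (1500 : ℝ) ≤ |(k : ℝ)| → |(k : ℝ)| ≤ (3 * H : ℕ) - 1500 →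
      ‖geo H ((k : ℝ) / (3 * H : ℕ))‖ ≤ 0.001 * H := by
    intro k h1 h2
    refine (norm_geo_le_inv H (by positivity) (nn_div_ge hP k h1 h2)).trans (le_of_eq ?_)
    rw [hPr]; field_simp; norm_num
  have habs : |2 * (j : ℝ) - 3 * H| ≤ 3 * H - 1500 := by
    rw [abs_le]; constructor <;> linarith
  have hgr : ∀ γ : ℕ → ℂ, ∑ n ∈ range H, ‖∑ i ∈ ({0, j, i} : Finset ℕ), γ i * ee (n * ((i : ℝ) / (3 * H : ℕ)))‖ ^ 2
      ≤ (H + 0.001 * H * #({0, j, i} : Finset ℕ)) * ∑ i ∈ ({0, j, i} : Finset ℕ), ‖γ i‖ ^ 2 := by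
    apply gram_bound _ _ _ (by positivity)
    intro x hx y hy hxy
    have hd : (x : ℝ) / (3 * H : ℕ) - (y : ℝ) / (3 * H : ℕ) = (((x : ℤ) - (y : ℤ) : ℤ) : ℝ) / (3 * H : ℕ) := by
      push_cast; ring
    rw [hd]
    have hk : 1500 ≤ |(x : ℝ) - y| ∧ |(x : ℝ) - y| ≤ 3 * H - 1500 := by
      simp only [mem_insert, mem_singleton] at hx hy
      rcases hx with rfl | rfl | rfl <;> rcases hy with rfl | rfl | rfl <;>
        first
        | exact absurd rfl hxy
        | (try simp only [Nat.cast_zero]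
           try rw [hir]
           first
           | (rw [abs_of_nonneg (by linarith)]; constructor <;> linarith)
           | (rw [abs_of_nonpos (by linarith)]; constructor <;> linarith)
           | (rw [show ∀ a : ℝ, ((a - (3 * (H:ℝ) - a)) = 2 * a - 3 * H) from fun a => by ring]; exact ⟨hj3, habs⟩)
           | (rw [abs_sub_comm, show ∀ a : ℝ, ((a - (3 * (H:ℝ) - a)) = 2 * a - 3 * H) from fun a => by ring]; exact ⟨hj3, habs⟩))
    apply key
    · push_cast; exact hk.1
    · push_cast; exact hk.2
  have hcard : #({0, j, i} : Finset ℕ) = 3 := by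
    rw [card_insert_of_notMem (by simp [h0j, h0i]), card_insert_of_notMem (by simp [hij.symm]), card_singleton]
  rw [hcard] at hgr
  have hmain := hH f b hf {0, j, i} (fun i => (i : ℝ) / (3 * H : ℕ)) _ (by positivity) (by rw [hcard]; norm_num) hgr
  rw [sum_insert (by simp [h0j, h0i]), sum_insert (by simp [hij.symm]), sum_singleton] at hmain
  have hsym : ‖expS H f ((i : ℝ) / (3 * H : ℕ))‖ = ‖expS H f ((j : ℝ) / (3 * H : ℕ))‖ := by
    have h1 : (i : ℝ) / (3 * H : ℕ) = -((j : ℝ) / (3 * H : ℕ)) + (1 : ℤ) := by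
      rw [hir, hPr]; field_simp; push_cast; ring
    rw [h1, expS_add_int, expS_neg]
    simp
  rw [hsym] at hmain
  simp only [Nat.cast_zero, zero_div] at hmain
  have : 2.01 * (H : ℝ) * (H + 0.001 * H * (3 : ℕ) + 0.001 * H) = 2.01 * H * (1.004 * H) := by push_cast; ring
  linarith

end Vino

namespace Vino

open Finset

/-- A weak form of Mertens' first theorem. -/
lemma sum_log_div_prime_le (n : ℕ) :
    ∑ p ∈ (range (n + 1)).filter Nat.Prime, Real.log p / p ≤ 2 * Real.log n := by
  rcases Nat.eq_zero_or_pos n with rfl | hn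
  · rw [sum_eq_zero]
    · simp
    · intro p hp; simp at hp; exact absurd hp.2 (by rw [hp.1]; exact Nat.not_prime_zero)
  set A := (range (n + 1)).filter Nat.Prime with hA
  have hmem : ∀ p ∈ A, p ≤ n ∧ p.Prime := by
    intro p hp; rw [hA, mem_filter, mem_range] at hp; exact ⟨by omega, hp.2⟩
  have hdvd : ∏ p ∈ A, p ^ (n / p) ∣ n.factorial := by
    apply Finset.prod_dvd_of_isRelPrime
    · intro p hp q hq hpq
      rw [Function.onFun, ← Nat.coprime_iff_isRelPrime]
      exact Nat.Coprime.pow _ _ ((Nat.coprime_primes (hmem p hp).2 (hmem q hq).2).2 hpq)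
    · intro p hp
      rw [Nat.Prime.pow_dvd_factorial_iff (hmem p hp).2 (Nat.lt_succ_self _)]
      have h1 : 1 ∈ Ico 1 (Nat.log p n).succ := by
        rw [mem_Ico]
        exact ⟨le_rfl, Nat.succ_lt_succ (Nat.log_pos (hmem p hp).2.one_lt (hmem p hp).1)⟩
      simpa using single_le_sum (f := fun i => n / p ^ i) (fun _ _ => Nat.zero_le _) h1
  have hle : ∏ p ∈ A, p ^ (n / p) ≤ n ^ n :=
    (Nat.le_of_dvd (Nat.factorial_pos n) hdvd).trans (Nat.factorial_le_pow n)
  have hpos : 0 < ∏ p ∈ A, p ^ (n / p) := prod_pos fun p hp => pow_pos (hmem p hp).2.pos _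
  have hlog : ∑ p ∈ A, ((n / p : ℕ) : ℝ) * Real.log p ≤ n * Real.log n := by
    have h1 : Real.log ((∏ p ∈ A, p ^ (n / p) : ℕ) : ℝ) ≤ Real.log ((n ^ n : ℕ) : ℝ) :=
      Real.log_le_log (by exact_mod_cast hpos) (by exact_mod_cast hle)
    push_cast at h1
    rw [Real.log_pow, Real.log_prod (fun p hp => by
      have := (hmem p hp).2.pos; positivity)] at h1
    simpa [Real.log_pow] using h1
  have hn0 : (0 : ℝ) < n := by exact_mod_cast hn
  have h2 : (n : ℝ) * ∑ p ∈ A, Real.log p / p ≤ n * (2 * Real.log n) := by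
    rw [mul_sum]
    calc ∑ p ∈ A, (n : ℝ) * (Real.log p / p) ≤ ∑ p ∈ A, 2 * (((n / p : ℕ) : ℝ) * Real.log p) := by
          apply sum_le_sum
          intro p hp
          obtain ⟨hpn, hpp⟩ := hmem p hp
          have hp0 : (0 : ℝ) < p := by exact_mod_cast hpp.pos
          have hl : 0 ≤ Real.log p := Real.log_nonneg (by exact_mod_cast hpp.one_lt.le)
          have h3 : 1 ≤ n / p := Nat.div_pos hpn hpp.pos
          have h4 : n < p * (n / p + 1) := Nat.lt_mul_div_succ n hpp.pos
          have h5 : n ≤ 2 * (n / p) * p := by nlinarith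
          have h6 : (n : ℝ) ≤ 2 * ((n / p : ℕ) : ℝ) * p := by exact_mod_cast h5
          have h7 : (n : ℝ) / p ≤ 2 * ((n / p : ℕ) : ℝ) := by rwa [div_le_iff₀ hp0]
          calc (n : ℝ) * (Real.log p / p) = (n : ℝ) / p * Real.log p := by ring
            _ ≤ 2 * ((n / p : ℕ) : ℝ) * Real.log p := by gcongr
            _ = _ := by ring
      _ ≤ n * (2 * Real.log n) := by rw [← mul_sum]; linarith
  exact le_of_mul_le_mul_left h2 hn0

/-- Euler products over small sets of primes are small. -/
lemma exists_euler_factor_bound : ∃ C : ℝ, 1 ≤ C ∧ ∀ (T : Finset ℕ) (N : ℕ), (∀ p ∈ T, p.Prime) → 1 ≤ N →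
    #T ≤ N ^ 2 → ∏ p ∈ T, (p : ℝ) / (p - 1) ≤ C * (N : ℝ) ^ (0.2 : ℝ) := by
  set p₀ := ⌈Real.exp 40⌉₊ with hp₀
  refine ⟨Real.exp (p₀ + 1 + 2), Real.one_le_exp (by positivity), fun T N hT hN hc => ?_⟩
  have hN0 : (0 : ℝ) < N := by exact_mod_cast hN
  have hN1 : (1 : ℝ) ≤ N := by exact_mod_cast hN
  set A := (range (N ^ 2 + 1)).filter Nat.Prime with hA
  have hpt : ∀ p ∈ T, (p : ℝ) / (p - 1) ≤ Real.exp (2 / (N : ℝ) ^ 2 + (if p ∈ range (p₀ + 1) then 1 else 0)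
      + (if p ∈ A then 0.05 * (Real.log p / p) else 0)) := by
    intro p hp
    have h2 : (2 : ℝ) ≤ p := by exact_mod_cast (hT p hp).two_le
    have h3 : (p : ℝ) / (p - 1) = 1 / (p - 1) + 1 := by
      have : (p : ℝ) - 1 ≠ 0 := by linarith
      field_simp; ring
    have h4 : 1 / ((p : ℝ) - 1) ≤ 2 / p := by
      rw [div_le_div_iff₀ (by linarith) (by linarith)]; linarith
    have h5 := Real.add_one_le_exp (1 / ((p : ℝ) - 1))
    rw [h3]
    refine h5.trans (Real.exp_le_exp.2 ?_)
    have hl : 0 ≤ Real.log p := Real.log_nonneg (by linarith)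
    have n1 : 0 ≤ 2 / (N : ℝ) ^ 2 := by positivity
    have n2 : (0 : ℝ) ≤ if p ∈ range (p₀ + 1) then 1 else 0 := by split_ifs <;> norm_num
    have n3 : 0 ≤ if p ∈ A then 0.05 * (Real.log p / p) else 0 := by split_ifs <;> positivity
    by_cases h6 : p ∈ range (p₀ + 1)
    · rw [if_pos h6]
      have : 1 / ((p : ℝ) - 1) ≤ 1 := by rw [div_le_one (by linarith)]; linarith
      linarith
    · by_cases h7 : p ∈ A
      · rw [if_pos h7]
        rw [mem_range] at h6
        have h8 : (40 : ℝ) ≤ Real.log p := by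
          rw [Real.le_log_iff_exp_le (by linarith)]
          refine (Nat.le_ceil _).trans ?_
          have : p₀ ≤ p := by omega
          exact_mod_cast this
        have h9 : 2 / (p : ℝ) ≤ 0.05 * (Real.log p / p) := by
          rw [← mul_div_assoc]; gcongr; linarith
        linarith
      · have h8 : N ^ 2 < p := by
          by_contra hcon
          exact h7 (mem_filter.2 ⟨mem_range.2 (by omega), hT p hp⟩)
        have h8' : (N : ℝ) ^ 2 ≤ p := by exact_mod_cast h8.le
        have h9 : 2 / (p : ℝ) ≤ 2 / (N : ℝ) ^ 2 := by gcongr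
        linarith
  have hpos : ∀ p ∈ T, (0 : ℝ) ≤ (p : ℝ) / (p - 1) := by
    intro p hp
    have h2 : (2 : ℝ) ≤ p := by exact_mod_cast (hT p hp).two_le
    exact div_nonneg (by linarith) (by linarith)
  refine (prod_le_prod hpos hpt).trans ?_
  rw [← Real.exp_sum, Real.rpow_def_of_pos hN0, ← Real.exp_add]
  apply Real.exp_le_exp.2
  rw [sum_add_distrib, sum_add_distrib, sum_const, nsmul_eq_mul]
  have e1 : (#T : ℝ) * (2 / (N : ℝ) ^ 2) ≤ 2 := by
    have : (#T : ℝ) ≤ (N : ℝ) ^ 2 := by exact_mod_cast hc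
    rw [← mul_div_assoc, div_le_iff₀ (by positivity)]; linarith
  have e2 : ∑ p ∈ T, (if p ∈ range (p₀ + 1) then (1 : ℝ) else 0) ≤ p₀ + 1 := by
    rw [← sum_filter, sum_const, nsmul_eq_mul, mul_one]
    have : #(T.filter (fun p => p ∈ range (p₀ + 1))) ≤ p₀ + 1 := by
      refine (card_le_card fun p hp => (mem_filter.1 hp).2).trans (card_range _).le
    exact_mod_cast this
  have e3 : ∑ p ∈ T, (if p ∈ A then 0.05 * (Real.log p / p) else 0) ≤ Real.log N * 0.2 := by
    rw [← sum_filter]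
    have h1 : ∑ p ∈ T.filter (fun p => p ∈ A), 0.05 * (Real.log p / p) ≤ ∑ p ∈ A, 0.05 * (Real.log p / p) := by
      apply sum_le_sum_of_subset_of_nonneg
      · intro p hp; exact (mem_filter.1 hp).2
      · intro p hp _
        have : (1 : ℝ) ≤ p := by exact_mod_cast (mem_filter.1 hp).2.one_lt.le
        have := Real.log_nonneg this
        positivity
    refine h1.trans ?_
    rw [← mul_sum]
    have h2 := sum_log_div_prime_le (N ^ 2)
    push_cast at h2
    rw [Real.log_pow] at h2
    push_cast at h2
    linarith
  linarith

end Vino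

namespace Vino

open Finset

/-- Removing one prime per pair of frequencies makes all the differences well separated. -/
lemma exists_hitting_primes (W F : ℕ) (J : Finset ℕ) (θ : ℕ → ℝ) {δ : ℝ} (hδ : 2 * δ ≤ 1 / (F : ℝ) ^ 4) :
    ∃ T : Finset ℕ, (∀ p ∈ T, p.Prime) ∧ #T ≤ #J ^ 2 ∧ ∀ i ∈ J, ∀ j ∈ J,
      ∀ x ∈ fareyIdx (sieveD (W * ∏ p ∈ T, p) F), ∀ y ∈ (fareyIdx (sieveD (W * ∏ p ∈ T, p) F)).erase x,
      δ ≤ nn (θ i - θ j + W * (x.2 / x.1 : ℝ) - W * (y.2 / y.1 : ℝ)) := by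
  classical
  set D := sieveD W F with hD
  have hspec := fun {β : ℚ} (hβ : β ∈ farDiff D) => farDiff_spec (D := D) (fun d hd => (mem_sieveD.1 hd).2.1)
    (W := W) (F := F) (fun d hd => (mem_sieveD.1 hd).2.2) (fun d hd => (mem_sieveD.1 hd).1.2) hβ
  let hit : ℝ → ℚ → Prop := fun α β => β ∈ farDiff D ∧ nn (α + W * (β : ℝ)) < δ
  have huniq : ∀ α β β', hit α β → hit α β' → β = β' := by
    intro α β β' h h'
    by_contra hne
    obtain ⟨a1, a2, a3, -, a4, a5, -⟩ := hspec h.1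
    obtain ⟨b1, b2, b3, -, b4, b5, -⟩ := hspec h'.1
    have h1 := nn_rat_sep a1 a2 b1 b2 hne a4 b4
    have h2 := nn_sub_le (α + W * (β : ℝ)) (α + W * (β' : ℝ))
    rw [show α + W * (β : ℝ) - (α + W * (β' : ℝ)) = W * (β : ℝ) - W * (β' : ℝ) by ring] at h2
    have ha : (0 : ℝ) < β.den := by exact_mod_cast β.den_pos
    have hb : (0 : ℝ) < β'.den := by exact_mod_cast β'.den_pos
    have ha5 : (β.den : ℝ) ≤ (F : ℝ) ^ 2 := by exact_mod_cast a5
    have hb5 : (β'.den : ℝ) ≤ (F : ℝ) ^ 2 := by exact_mod_cast b5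
    have h3 : 1 / (F : ℝ) ^ 4 ≤ 1 / ((β.den : ℝ) * β'.den) := by
      apply one_div_le_one_div_of_le (by positivity)
      calc (β.den : ℝ) * β'.den ≤ (F : ℝ) ^ 2 * (F : ℝ) ^ 2 := by gcongr
        _ = (F : ℝ) ^ 4 := by ring
    have h4 := h.2
    have h5 := h'.2
    linarith
  let pr : ℕ × ℕ → ℕ := fun ij => if h : ∃ β, hit (θ ij.1 - θ ij.2) β then h.choose.den.minFac else 2
  refine ⟨(J ×ˢ J).image pr, ?_, ?_, ?_⟩
  · intro p hp
    obtain ⟨ij, -, rfl⟩ := mem_image.1 hp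
    simp only [pr]
    split_ifs with h
    · exact Nat.minFac_prime (hspec h.choose_spec.1).2.2.1.ne'
    · exact Nat.prime_two
  · refine card_image_le.trans ?_
    rw [card_product, pow_two]
  · intro i hi j hj x hx y hy
    by_contra hlt
    rw [not_le] at hlt
    set T := (J ×ˢ J).image pr
    have hsub : sieveD (W * ∏ p ∈ T, p) F ⊆ D := by
      intro d hd
      obtain ⟨h1, h2, h3⟩ := mem_sieveD.1 hd
      exact mem_sieveD.2 ⟨h1, h2, Nat.Coprime.coprime_mul_right h3⟩
    obtain ⟨hyx, hy'⟩ := mem_erase.1 hy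
    have hfmem : ∀ z ∈ fareyIdx (sieveD (W * ∏ p ∈ T, p) F), z ∈ fareyIdx D := by
      intro z hz
      obtain ⟨h1, h2⟩ := mem_fareyIdx.1 hz
      exact mem_fareyIdx.2 ⟨hsub h1, h2⟩
    have hβ : Int.fract (fr x - fr y) ∈ farDiff D :=
      mem_biUnion.2 ⟨x, hfmem x hx, mem_image.2 ⟨y, mem_erase.2 ⟨hyx, hfmem y hy'⟩, rfl⟩⟩
    have hβ' : Int.fract (fr x - fr y) ∈ farDiff (sieveD (W * ∏ p ∈ T, p) F) :=
      mem_biUnion.2 ⟨x, hx, mem_image.2 ⟨y, hy, rfl⟩⟩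
    have hhit : hit (θ i - θ j) (Int.fract (fr x - fr y)) := by
      refine ⟨hβ, ?_⟩
      have h1 : θ i - θ j + W * (x.2 / x.1 : ℝ) - W * (y.2 / y.1 : ℝ)
          = θ i - θ j + W * ((Int.fract (fr x - fr y) : ℚ) : ℝ) + ((W * ⌊fr x - fr y⌋ : ℤ) : ℝ) := by
        rw [Int.fract]; unfold fr; push_cast; ring
      rw [h1, nn_add_int] at hlt
      exact hlt
    have hex : ∃ β, hit (θ i - θ j) β := ⟨_, hhit⟩
    have hpr : pr (i, j) = (Int.fract (fr x - fr y)).den.minFac := by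
      simp only [pr]
      rw [dif_pos hex, huniq _ _ _ hex.choose_spec hhit]
    obtain ⟨-, -, hden, -, -, -, d, hd, d', hd', hdvd⟩ := farDiff_spec (D := sieveD (W * ∏ p ∈ T, p) F)
      (fun d hd => (mem_sieveD.1 hd).2.1)
      (W := W * ∏ p ∈ T, p) (F := F) (fun d hd => (mem_sieveD.1 hd).2.2) (fun d hd => (mem_sieveD.1 hd).1.2) hβ'
    have hpT : pr (i, j) ∈ T := mem_image_of_mem _ (mem_product.2 ⟨hi, hj⟩)
    have hprime : (pr (i, j)).Prime := by rw [hpr]; exact Nat.minFac_prime hden.ne'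
    have hp1 : pr (i, j) ∣ W * ∏ p ∈ T, p := (dvd_prod_of_mem (fun p => p) hpT).mul_left _
    have hp2 : pr (i, j) ∣ d * d' := by rw [hpr]; exact (Nat.minFac_dvd _).trans hdvd
    have hcop : Nat.Coprime (W * ∏ p ∈ T, p) (d * d') :=
      Nat.Coprime.mul_right (mem_sieveD.1 hd).2.2 (mem_sieveD.1 hd').2.2
    exact hprime.one_lt.ne' (Nat.eq_one_of_dvd_coprimes hcop hp1 hp2)

lemma sum_fareyIdx_inv (D : Finset ℕ) (hD : ∀ d ∈ D, 0 < d) :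
    ∑ x ∈ fareyIdx D, (1 / x.1.totient : ℝ) = #D := by
  unfold fareyIdx
  rw [sum_sigma, card_eq_sum_ones, Nat.cast_sum]
  apply sum_congr rfl
  intro d hd
  have h0 : (0 : ℝ) < d.totient := by exact_mod_cast Nat.totient_pos.2 (hD d hd)
  simp only [sum_const, card_coprime_range, nsmul_eq_mul]
  field_simp
  simp

lemma weighted_pairs_le (D : Finset ℕ) (hD : ∀ d ∈ D, 0 < d) {F : ℕ} (hF : #D ≤ F)
    (g : (Σ _ : ℕ, ℕ) → (Σ _ : ℕ, ℕ) → ℝ) {κ : ℝ} (hκ : 0 ≤ κ)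
    (h : ∀ x ∈ fareyIdx D, ∀ y ∈ (fareyIdx D).erase x, g x y ≤ κ) :
    ∑ x ∈ fareyIdx D, ∑ y ∈ (fareyIdx D).erase x, (1 / x.1.totient : ℝ) * (1 / y.1.totient : ℝ) * g x y
      ≤ (F : ℝ) ^ 2 * κ := by
  calc _ ≤ ∑ x ∈ fareyIdx D, ∑ y ∈ fareyIdx D, (1 / x.1.totient : ℝ) * (1 / y.1.totient : ℝ) * κ := by
        apply sum_le_sum
        intro x hx
        calc _ ≤ ∑ y ∈ (fareyIdx D).erase x, (1 / x.1.totient : ℝ) * (1 / y.1.totient : ℝ) * κ := by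
              apply sum_le_sum
              intro y hy
              exact mul_le_mul_of_nonneg_left (h x hx y hy) (by positivity)
          _ ≤ _ := sum_le_sum_of_subset_of_nonneg (erase_subset _ _) (fun _ _ _ => by positivity)
    _ = (#D : ℝ) ^ 2 * κ := by
        simp only [← sum_mul, ← mul_sum]
        rw [sum_fareyIdx_inv D hD, pow_two]
    _ ≤ _ := by gcongr

end Vino

namespace Vino

open Finset

/-- A restriction estimate with constants independent of the modulus. -/
theorem restriction_estimate : ∃ C : ℝ, 1 ≤ C ∧ ∀ W : ℕ, 0 < W → ∀ᶠ H : ℕ in atTop, ∀ (f : ℕ → ℝ) (b : ℕ),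
    SieveWeight W b H f → ∀ J ⊆ range (3 * H), J.Nonempty → (#J : ℝ) ≤ (H : ℝ) ^ (3 / 8 : ℝ) →
    ∑ j ∈ J, ‖expS H f ((j : ℝ) / (3 * H : ℕ))‖ ^ 2 ≤ C * (H : ℝ) ^ 2 * (#J : ℝ) ^ (0.2 : ℝ) := by
  obtain ⟨C, hC1, hC⟩ := exists_euler_factor_bound
  refine ⟨70 * C, by linarith, fun W hW => ?_⟩
  have hlogpos : ∀ᶠ H : ℕ in atTop, 1 ≤ Real.log H :=
    (Real.tendsto_log_atTop.comp tendsto_natCast_atTop_atTop).eventually_ge_atTop 1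
  have hq : ∀ᶠ H : ℕ in atTop, 2 ≤ (H : ℝ) ^ (1 / 4 : ℝ) :=
    ((tendsto_rpow_atTop (by norm_num)).comp tendsto_natCast_atTop_atTop).eventually_ge_atTop 2
  filter_upwards [log_floor_div_ge (a := 1 / 16) (c := 1 / 17) (by norm_num) (by norm_num) W hW,
    eventually_ge_atTop 1, hlogpos, hq] with H hH2 hH1 hl hq f b hf J hJ hJne hJc
  have hHr : (1 : ℝ) ≤ H := by exact_mod_cast hH1
  have hH0 : (0 : ℝ) < H := by linarith
  set F := ⌊(H : ℝ) ^ (1 / 16 : ℝ)⌋₊ with hF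
  have hF1 : 1 ≤ F := Nat.le_floor (by simpa using Real.one_le_rpow hHr (by norm_num))
  have hFr : (1 : ℝ) ≤ F := by exact_mod_cast hF1
  have hF4 : (F : ℝ) ^ 4 ≤ (H : ℝ) ^ (1 / 4 : ℝ) := by
    refine (floor_rpow_pow_le _ 4 H).trans (le_of_eq ?_); norm_num
  have hF2 : (F : ℝ) ^ 2 ≤ (H : ℝ) ^ (1 / 8 : ℝ) := by
    refine (floor_rpow_pow_le _ 2 H).trans (le_of_eq ?_); norm_num
  have hFH : F ≤ H := by
    have : (F : ℝ) ≤ H := (Nat.floor_le (by positivity)).trans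
      ((Real.rpow_le_rpow_of_exponent_le hHr (by norm_num)).trans_eq (Real.rpow_one _))
    exact_mod_cast this
  set δ : ℝ := (H : ℝ) ^ (-(1 / 2) : ℝ) with hδ
  have hδ0 : 0 < δ := by positivity
  have hδ1 : 2 * δ ≤ 1 / (F : ℝ) ^ 4 := by
    rw [le_div_iff₀ (by positivity)]
    calc 2 * δ * (F : ℝ) ^ 4 ≤ (H : ℝ) ^ (1 / 4 : ℝ) * (H : ℝ) ^ (-(1 / 2) : ℝ) * (H : ℝ) ^ (1 / 4 : ℝ) := by
          rw [← hδ]; gcongr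
      _ = 1 := by rw [← Real.rpow_add hH0, ← Real.rpow_add hH0]; norm_num
  obtain ⟨T, hT1, hT2, hT3⟩ := exists_hitting_primes W F J (fun j => (j : ℝ) / (3 * H : ℕ)) hδ1
  set D := sieveD (W * ∏ p ∈ T, p) F with hD
  have hdD : ∀ {d}, d ∈ D → _ := fun {d} hd => mem_sieveD.1 hd
  have hDc : #D ≤ F := (card_filter_le _ _).trans (by simp)
  have hσ : ∏ p ∈ T, (p : ℝ) / (p - 1) ≤ C * (#J : ℝ) ^ (0.2 : ℝ) :=
    hC T #J hT1 hJne.card_pos hT2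
  set σ := ∏ p ∈ T, (p : ℝ) / (p - 1) with hσdef
  have hG := sieveG_lower hW F hF1
  set Φ : ℝ := (W.totient : ℝ) / W with hΦ
  have hΦ0 : 0 < Φ := by
    have := Nat.totient_pos.2 hW
    positivity
  have hG2 : Φ * (1 / 17 * Real.log H) ≤ σ * sieveG D :=
    ((mul_le_mul_of_nonneg_left hH2 hΦ0.le).trans hG).trans (sieveG_mul_primes_le T hT1 W F)
  have hG1 : 1 ≤ sieveG D := by
    have h1 : 1 ∈ D := mem_sieveD.2 ⟨⟨le_rfl, hF1⟩, squarefree_one, Nat.coprime_one_right _⟩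
    have := single_le_sum (f := fun d : ℕ => (1 : ℝ) / d.totient) (fun _ _ => by positivity) h1
    simpa [sieveG] using this
  have hE := fun (i : ℕ) hi (j : ℕ) hj => weighted_pairs_le D (fun d hd => (hdD hd).1.1) hDc
    (fun x y => ‖geo H ((i : ℝ) / (3 * H : ℕ) - (j : ℝ) / (3 * H : ℕ) + W * (x.2 / x.1 : ℝ) - W * (y.2 / y.1 : ℝ))‖)
    (κ := 1 / (2 * δ)) (by positivity) (fun x hx y hy => norm_geo_le_inv H hδ0 (hT3 i hi j hj x hx y hy))
  have hmain := farey_sieve J D W b (fun d hd => (hdD hd).2.1) (fun j : ℕ => (j : ℝ) / (3 * H : ℕ)) H f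
    (B := (3 * H : ℕ)) (E := (F : ℝ) ^ 2 * (1 / (2 * δ))) (by positivity) (by positivity)
    (fun n hn hfn d hd => hf.cop n (mem_range.1 hn) hfn d (hdD hd).1.1 ((hdD hd).1.2.trans hFH))
    (fun γ => parseval_dual (by omega) (by omega) hJ γ) hE
  have hJE : #J * ((F : ℝ) ^ 2 * (1 / (2 * δ))) ≤ H := by
    have h1 : 1 / (2 * δ) ≤ (H : ℝ) ^ (1 / 2 : ℝ) := by
      rw [hδ, Real.rpow_neg hH0.le, div_le_iff₀ (by positivity)]
      have : 0 < (H : ℝ) ^ (1 / 2 : ℝ) := by positivity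
      field_simp
      norm_num
    calc #J * ((F : ℝ) ^ 2 * (1 / (2 * δ)))
        ≤ (H : ℝ) ^ (3 / 8 : ℝ) * ((H : ℝ) ^ (1 / 8 : ℝ) * (H : ℝ) ^ (1 / 2 : ℝ)) := by gcongr
      _ = H := by rw [← Real.rpow_add hH0, ← Real.rpow_add hH0]; norm_num
  have hX0 : 0 ≤ ∑ j ∈ J, ‖expS H f ((j : ℝ) / (3 * H : ℕ))‖ ^ 2 := sum_nonneg fun _ _ => by positivity
  set X := ∑ j ∈ J, ‖expS H f ((j : ℝ) / (3 * H : ℕ))‖ ^ 2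
  have hG0 : 0 < sieveG D := by linarith
  have hf0 : 0 ≤ ∑ n ∈ range H, f n ^ 2 := sum_nonneg fun _ _ => by positivity
  have h5 : sieveG D * X ≤ (1.001 * Φ * H * Real.log H) * (4 * H) := by
    have h6 : sieveG D ^ 2 * X ≤ (∑ n ∈ range H, f n ^ 2) * (sieveG D * (4 * H)) := by
      refine hmain.trans (mul_le_mul_of_nonneg_left ?_ hf0)
      push_cast
      nlinarith
    have h7 : sieveG D * (sieveG D * X) ≤ sieveG D * ((∑ n ∈ range H, f n ^ 2) * (4 * H)) := by linarith
    exact (le_of_mul_le_mul_left h7 hG0).trans (mul_le_mul_of_nonneg_right hf.energy (by positivity))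
  have hσ0 : 0 ≤ σ := prod_nonneg fun p hp => by
    have h2 : (2 : ℝ) ≤ p := by exact_mod_cast (hT1 p hp).two_le
    exact div_nonneg (by linarith) (by linarith)
  have h8 : Φ * Real.log H * X ≤ Φ * Real.log H * (70 * (H : ℝ) ^ 2 * σ) := by
    have h9 := mul_le_mul_of_nonneg_right hG2 hX0
    have h10 := mul_le_mul_of_nonneg_left h5 hσ0
    have h11 : 0 ≤ Φ * Real.log H * (H : ℝ) ^ 2 * σ := by positivity
    linarith
  have h12 := le_of_mul_le_mul_left h8 (by positivity)
  calc X ≤ 70 * (H : ℝ) ^ 2 * σ := h12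
    _ ≤ 70 * (H : ℝ) ^ 2 * (C * (#J : ℝ) ^ (0.2 : ℝ)) := by gcongr
    _ = _ := by ring

end Vino

namespace Vino

open Finset

/-- The number of large values of the exponential sum. -/
theorem level_set_bound : ∃ C : ℝ, 1 ≤ C ∧ ∀ W : ℕ, 0 < W → ∀ᶠ H : ℕ in atTop, ∀ (f : ℕ → ℝ) (b : ℕ),
    SieveWeight W b H f → ∀ μ : ℝ, (H : ℝ) ^ (-(0.1) : ℝ) ≤ μ →
    (#((range (3 * H)).filter fun j : ℕ => μ * H ≤ ‖expS H f ((j : ℝ) / (3 * H : ℕ))‖) : ℝ)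
      ≤ C * μ ^ (-(2.5) : ℝ) := by
  obtain ⟨C, hC1, hC⟩ := restriction_estimate
  have hC0 : 0 < C := by linarith
  refine ⟨C ^ (1.25 : ℝ), Real.one_le_rpow hC1 (by norm_num), fun W hW => ?_⟩
  have hq : ∀ᶠ H : ℕ in atTop, C ^ (1.25 : ℝ) + 1 < (H : ℝ) ^ (1 / 8 : ℝ) :=
    ((tendsto_rpow_atTop (by norm_num)).comp tendsto_natCast_atTop_atTop).eventually_gt_atTop _
  filter_upwards [hC W hW, eventually_ge_atTop 1, hq] with H hH hH1 hq f b hf μ hμ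
  have hHr : (1 : ℝ) ≤ H := by exact_mod_cast hH1
  have hH0 : (0 : ℝ) < H := by linarith
  have hμ0 : 0 < μ := lt_of_lt_of_le (by positivity) hμ
  have hsub : ∀ J ⊆ (range (3 * H)).filter fun j : ℕ => μ * H ≤ ‖expS H f ((j : ℝ) / (3 * H : ℕ))‖,
      (#J : ℝ) ≤ (H : ℝ) ^ (3 / 8 : ℝ) → (#J : ℝ) ≤ C ^ (1.25 : ℝ) * μ ^ (-(2.5) : ℝ) := by
    intro J hJ hJc
    rcases J.eq_empty_or_nonempty with rfl | hne
    · simp; positivity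
    have h1 := hH f b hf J (fun j hj => (mem_filter.1 (hJ hj)).1) hne hJc
    have hn0 : (0 : ℝ) < #J := by exact_mod_cast hne.card_pos
    have h2 : (#J : ℝ) * (μ * H) ^ 2 ≤ C * (H : ℝ) ^ 2 * (#J : ℝ) ^ (0.2 : ℝ) := by
      refine le_trans ?_ h1
      rw [← nsmul_eq_mul]
      apply card_nsmul_le_sum
      intro j hj
      have := (mem_filter.1 (hJ hj)).2
      gcongr
    have h3 : (#J : ℝ) = (#J : ℝ) ^ (0.8 : ℝ) * (#J : ℝ) ^ (0.2 : ℝ) := by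
      rw [← Real.rpow_add hn0]; norm_num
    have h4 : (#J : ℝ) ^ (0.8 : ℝ) ≤ C * μ ^ (-(2 : ℝ)) := by
      rw [Real.rpow_neg hμ0.le, ← div_eq_mul_inv, le_div_iff₀ (by positivity)]
      have h5 : ((#J : ℝ) ^ (0.2 : ℝ) * (H : ℝ) ^ 2) * ((#J : ℝ) ^ (0.8 : ℝ) * μ ^ (2 : ℝ)) ≤
          ((#J : ℝ) ^ (0.2 : ℝ) * (H : ℝ) ^ 2) * C := by
        rw [Real.rpow_two]
        calc _ = ((#J : ℝ) ^ (0.8 : ℝ) * (#J : ℝ) ^ (0.2 : ℝ)) * (μ * H) ^ 2 := by ring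
          _ = #J * (μ * H) ^ 2 := by rw [← h3]
          _ ≤ _ := h2.trans_eq (by ring)
      exact le_of_mul_le_mul_left h5 (mul_pos (Real.rpow_pos_of_pos hn0 _) (pow_pos hH0 2))
    calc (#J : ℝ) = ((#J : ℝ) ^ (0.8 : ℝ)) ^ (1.25 : ℝ) := by
          rw [← Real.rpow_mul hn0.le, show (0.8 : ℝ) * 1.25 = 1 by norm_num, Real.rpow_one]
      _ ≤ (C * μ ^ (-(2 : ℝ))) ^ (1.25 : ℝ) :=
          Real.rpow_le_rpow (Real.rpow_nonneg hn0.le _) h4 (by norm_num)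
      _ = C ^ (1.25 : ℝ) * μ ^ (-(2.5) : ℝ) := by
          rw [Real.mul_rpow hC0.le (by positivity), ← Real.rpow_mul hμ0.le,
            show -(2 : ℝ) * 1.25 = -(2.5) by norm_num]
  set A := (range (3 * H)).filter fun j : ℕ => μ * H ≤ ‖expS H f ((j : ℝ) / (3 * H : ℕ))‖ with hA
  by_cases hc : (#A : ℝ) ≤ (H : ℝ) ^ (3 / 8 : ℝ)
  · exact hsub A subset_rfl hc
  · exfalso
    rw [not_le] at hc
    have h1 : ⌊(H : ℝ) ^ (3 / 8 : ℝ)⌋₊ ≤ #A := by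
      have := (Nat.floor_le (show 0 ≤ (H : ℝ) ^ (3 / 8 : ℝ) by positivity)).trans hc.le
      exact_mod_cast this
    obtain ⟨J, hJ, hJc⟩ := exists_subset_card_eq h1
    have h2 := hsub J hJ (by rw [hJc]; exact Nat.floor_le (by positivity))
    rw [hJc] at h2
    have h3 := Nat.lt_floor_add_one ((H : ℝ) ^ (3 / 8 : ℝ))
    have h4 : μ ^ (-(2.5) : ℝ) ≤ (H : ℝ) ^ (1 / 4 : ℝ) := by
      calc μ ^ (-(2.5) : ℝ) ≤ ((H : ℝ) ^ (-(0.1) : ℝ)) ^ (-(2.5) : ℝ) :=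
            Real.rpow_le_rpow_of_nonpos (by positivity) hμ (by norm_num)
        _ = (H : ℝ) ^ (1 / 4 : ℝ) := by rw [← Real.rpow_mul hH0.le]; norm_num
    have h5 : (H : ℝ) ^ (3 / 8 : ℝ) = (H : ℝ) ^ (1 / 8 : ℝ) * (H : ℝ) ^ (1 / 4 : ℝ) := by
      rw [← Real.rpow_add hH0]; norm_num
    have h6 : 1 ≤ (H : ℝ) ^ (1 / 4 : ℝ) := Real.one_le_rpow hHr (by norm_num)
    have h7 : C ^ (1.25 : ℝ) * μ ^ (-(2.5) : ℝ) ≤ C ^ (1.25 : ℝ) * (H : ℝ) ^ (1 / 4 : ℝ) := by gcongr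
    nlinarith

lemma sum_cube_le_of_lt {H : ℕ} (hH : 1 ≤ H) (f : ℕ → ℝ) {c : ℝ} (hc : 0 ≤ c) :
    ∑ j ∈ (range (3 * H)).filter (fun j : ℕ => ‖expS H f ((j : ℝ) / (3 * H : ℕ))‖ < c),
      ‖expS H f ((j : ℝ) / (3 * H : ℕ))‖ ^ 3 ≤ c * (3 * H * ∑ n ∈ range H, f n ^ 2) := by
  have h1 := parseval_expS (P := 3 * H) (H := H) (by omega) (by omega) f
  push_cast at h1
  rw [← h1, mul_sum]
  push_cast
  calc _ ≤ ∑ j ∈ (range (3 * H)).filter (fun j : ℕ => ‖expS H f ((j : ℝ) / (3 * H))‖ < c),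
        c * ‖expS H f ((j : ℝ) / (3 * H))‖ ^ 2 := by
        apply sum_le_sum
        intro j hj
        rw [pow_succ', mul_comm]
        rw [mul_comm]
        exact mul_le_mul_of_nonneg_right (mem_filter.1 hj).2.le (by positivity)
    _ ≤ _ := sum_le_sum_of_subset_of_nonneg (filter_subset _ _) (fun _ _ _ => by positivity)

/-- The third moment over small values. -/
theorem small_values_cube : ∃ C : ℝ, 1 ≤ C ∧ ∀ W : ℕ, 0 < W → ∀ μ : ℝ, 0 < μ →
    ∀ᶠ H : ℕ in atTop, ∀ (f : ℕ → ℝ) (b : ℕ), SieveWeight W b H f →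
    ∑ j ∈ (range (3 * H)).filter (fun j : ℕ => ‖expS H f ((j : ℝ) / (3 * H : ℕ))‖ < μ * H),
      ‖expS H f ((j : ℝ) / (3 * H : ℕ))‖ ^ 3 ≤ C * μ ^ (0.5 : ℝ) * (H : ℝ) ^ 3 := by
  obtain ⟨C, hC1, hC⟩ := level_set_bound
  have hC0 : 0 < C := by linarith
  refine ⟨25 * C, by linarith, fun W hW μ hμ => ?_⟩
  have hlogpos : ∀ᶠ H : ℕ in atTop, 1 ≤ Real.log H :=
    (Real.tendsto_log_atTop.comp tendsto_natCast_atTop_atTop).eventually_ge_atTop 1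
  have hsmall : ∀ᶠ H : ℕ in atTop, 7 * Real.log H * (H : ℝ) ^ (-(0.1) : ℝ) ≤ C * μ ^ (0.5 : ℝ) := by
    have h1 : Tendsto (fun x : ℝ => Real.log x / x ^ (0.1 : ℝ)) atTop (nhds 0) :=
      (isLittleO_log_rpow_atTop (by norm_num)).tendsto_div_nhds_zero
    have h2 := (h1.comp tendsto_natCast_atTop_atTop).eventually_lt_const
      (show (0 : ℝ) < C * μ ^ (0.5 : ℝ) / 7 by positivity)
    filter_upwards [h2] with H hH
    simp only [Function.comp] at hH
    rw [Real.rpow_neg (by positivity)]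
    rw [lt_div_iff₀ (by norm_num)] at hH
    calc _ = Real.log H / (H : ℝ) ^ (0.1 : ℝ) * 7 := by ring
      _ ≤ _ := hH.le
  filter_upwards [hC W hW, eventually_ge_atTop 1, hlogpos, hsmall] with H hH hH1 hl hs f b hf
  have hHr : (1 : ℝ) ≤ H := by exact_mod_cast hH1
  have hH0 : (0 : ℝ) < H := by linarith
  set g : ℕ → ℝ := fun j => ‖expS H f ((j : ℝ) / (3 * H : ℕ))‖ with hg
  set Sm : ℝ → ℝ := fun ν => ∑ j ∈ (range (3 * H)).filter (fun j : ℕ => g j < ν * H), g j ^ 3 with hSm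
  change Sm μ ≤ _
  set η : ℝ := (H : ℝ) ^ (-(0.1) : ℝ) with hη
  have hη0 : 0 < η := by positivity
  have hmono : ∀ a b : ℝ, a ≤ b → Sm a ≤ Sm b := by
    intro a b hab
    apply sum_le_sum_of_subset_of_nonneg
    · intro j hj
      rw [mem_filter] at hj ⊢
      exact ⟨hj.1, hj.2.trans_le (by gcongr)⟩
    · intro j _ _; positivity
  have hbase : Sm (2 * η) ≤ C * μ ^ (0.5 : ℝ) * (H : ℝ) ^ 3 := by
    have h1 := sum_cube_le_of_lt hH1 f (c := 2 * η * H) (by positivity)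
    have h2 := hf.energy
    have hΦ : (W.totient : ℝ) / W ≤ 1 := by
      rw [div_le_one (by exact_mod_cast hW)]; exact_mod_cast Nat.totient_le W
    have hΦ0 : 0 ≤ (W.totient : ℝ) / W := by positivity
    have h3 : ∑ n ∈ range H, f n ^ 2 ≤ 1.001 * 1 * H * Real.log H := by
      refine h2.trans ?_
      gcongr
    calc Sm (2 * η) ≤ 2 * η * H * (3 * H * ∑ n ∈ range H, f n ^ 2) := h1
      _ ≤ 2 * η * H * (3 * H * (1.001 * 1 * H * Real.log H)) := by gcongr
      _ = 6.006 * Real.log H * η * (H : ℝ) ^ 3 := by ring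
      _ ≤ 7 * Real.log H * η * (H : ℝ) ^ 3 := by gcongr; norm_num
      _ ≤ _ := by gcongr
  have hstep : ∀ ν : ℝ, 2 * η ≤ ν → Sm ν ≤ Sm (ν / 2) + 6 * C * ν ^ (0.5 : ℝ) * (H : ℝ) ^ 3 := by
    intro ν hν
    have hν0 : 0 < ν := by linarith
    have h1 := hH f b hf (ν / 2) (by linarith)
    set A := (range (3 * H)).filter fun j : ℕ => ν / 2 * H ≤ g j with hA
    have h2 : Sm ν ≤ Sm (ν / 2) + ∑ j ∈ A, (ν * H) ^ 3 := by
      have h3 : (range (3 * H)).filter (fun j : ℕ => g j < ν * H) ⊆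
          (range (3 * H)).filter (fun j : ℕ => g j < ν / 2 * H) ∪ A.filter (fun j => g j < ν * H) := by
        intro j hj
        simp only [mem_union, mem_filter, hA] at hj ⊢
        rcases lt_or_ge (g j) (ν / 2 * H) with h | h
        · exact Or.inl ⟨hj.1, h⟩
        · exact Or.inr ⟨⟨hj.1, h⟩, hj.2⟩
      calc Sm ν ≤ ∑ j ∈ (range (3 * H)).filter (fun j : ℕ => g j < ν / 2 * H) ∪ A.filter (fun j => g j < ν * H), g j ^ 3 :=
            sum_le_sum_of_subset_of_nonneg h3 (fun _ _ _ => by positivity)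
        _ ≤ Sm (ν / 2) + ∑ j ∈ A.filter (fun j => g j < ν * H), g j ^ 3 := by
            have := sum_union_inter (s₁ := (range (3 * H)).filter (fun j : ℕ => g j < ν / 2 * H))
              (s₂ := A.filter (fun j => g j < ν * H)) (f := fun j => g j ^ 3)
            have h0 : 0 ≤ ∑ j ∈ (range (3 * H)).filter (fun j : ℕ => g j < ν / 2 * H) ∩ A.filter (fun j => g j < ν * H), g j ^ 3 :=
              sum_nonneg fun _ _ => by positivity
            linarith
        _ ≤ _ := by
            gcongr
            calc _ ≤ ∑ j ∈ A.filter (fun j => g j < ν * H), (ν * H) ^ 3 := by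
                  apply sum_le_sum
                  intro j hj
                  have : g j ≤ ν * H := (mem_filter.1 hj).2.le
                  have : 0 ≤ g j := norm_nonneg _
                  gcongr
              _ ≤ _ := sum_le_sum_of_subset_of_nonneg (filter_subset _ _) (fun _ _ _ => by positivity)
    rw [sum_const, nsmul_eq_mul] at h2
    have h4 : (ν / 2) ^ (-(2.5) : ℝ) ≤ 6 * ν ^ (-(2.5) : ℝ) := by
      rw [Real.div_rpow hν0.le (by norm_num), Real.rpow_neg (by norm_num : (0 : ℝ) ≤ 2), div_inv_eq_mul, mul_comm]
      gcongr
      calc (2 : ℝ) ^ (2.5 : ℝ) = ((2 : ℝ) ^ (5 : ℝ)) ^ (0.5 : ℝ) := by rw [← Real.rpow_mul (by norm_num)]; norm_num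
        _ ≤ ((6 : ℝ) ^ (2 : ℝ)) ^ (0.5 : ℝ) := by
            apply Real.rpow_le_rpow (by positivity) _ (by norm_num); norm_num
        _ = 6 := by rw [← Real.rpow_mul (by norm_num)]; norm_num
    have h5 : ν ^ (-(2.5) : ℝ) * ν ^ 3 = ν ^ (0.5 : ℝ) := by
      rw [← Real.rpow_natCast ν 3, ← Real.rpow_add hν0]; norm_num
    calc Sm ν ≤ Sm (ν / 2) + #A * (ν * H) ^ 3 := h2
      _ ≤ Sm (ν / 2) + (C * (6 * ν ^ (-(2.5) : ℝ))) * (ν * H) ^ 3 := by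
          gcongr
          exact h1.trans (by gcongr)
      _ = Sm (ν / 2) + 6 * C * (ν ^ (-(2.5) : ℝ) * ν ^ 3) * (H : ℝ) ^ 3 := by ring
      _ = _ := by rw [h5]
  have hind : ∀ k : ℕ, ∀ ν : ℝ, 0 < ν → ν ≤ 2 ^ k * (2 * η) →
      Sm ν ≤ 24 * C * ν ^ (0.5 : ℝ) * (H : ℝ) ^ 3 + C * μ ^ (0.5 : ℝ) * (H : ℝ) ^ 3 := by
    intro k
    induction k with
    | zero =>
      intro ν hν0 hν
      rw [pow_zero, one_mul] at hν
      have := (hmono _ _ hν).trans hbase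
      have : 0 ≤ 24 * C * ν ^ (0.5 : ℝ) * (H : ℝ) ^ 3 := by positivity
      linarith
    | succ k ih =>
      intro ν hν0 hν
      rcases le_or_gt ν (2 * η) with h | h
      · have := (hmono _ _ h).trans hbase
        have : 0 ≤ 24 * C * ν ^ (0.5 : ℝ) * (H : ℝ) ^ 3 := by positivity
        linarith
      · have h1 := hstep ν h.le
        have h2 := ih (ν / 2) (by positivity) (by rw [pow_succ] at hν; linarith)
        have h3 : (ν / 2) ^ (0.5 : ℝ) ≤ 0.75 * ν ^ (0.5 : ℝ) := by
          have : (ν / 2) ≤ 0.75 ^ 2 * ν := by linarith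
          calc (ν / 2) ^ (0.5 : ℝ) ≤ (0.75 ^ 2 * ν) ^ (0.5 : ℝ) := by gcongr
            _ = 0.75 * ν ^ (0.5 : ℝ) := by
                rw [Real.mul_rpow (by positivity) hν0.le, ← Real.rpow_natCast, ← Real.rpow_mul (by norm_num)]
                norm_num
        have h4 : 24 * C * (ν / 2) ^ (0.5 : ℝ) * (H : ℝ) ^ 3 ≤ 24 * C * (0.75 * ν ^ (0.5 : ℝ)) * (H : ℝ) ^ 3 := by
          gcongr
        linarith
  obtain ⟨k, hk⟩ := pow_unbounded_of_one_lt (μ / (2 * η)) (by norm_num : (1 : ℝ) < 2)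
  have := hind k μ hμ (by rw [div_lt_iff₀ (by positivity)] at hk; exact hk.le)
  linarith

end Vino

namespace Vino

open MeasureTheory Set

/-- The complex half of the Fejér kernel. -/
noncomputable def kerC (y : ℝ) : ℂ := ∫ t in (0 : ℝ)..1, ((1 - t : ℝ) : ℂ) * Complex.exp (Complex.I * (y * t : ℝ))

/-- The Fejér kernel. -/
noncomputable def fej (y : ℝ) : ℝ := 2 * (kerC y).re

lemma kerC_continuous : Continuous kerC := by
  apply intervalIntegral.continuous_parametric_intervalIntegral_of_continuous'
    (f := fun (y t : ℝ) => ((1 - t : ℝ) : ℂ) * Complex.exp (Complex.I * (y * t : ℝ)))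
  fun_prop

lemma fej_continuous : Continuous fej :=
  continuous_const.mul (Complex.continuous_re.comp kerC_continuous)

lemma fej_eq (y : ℝ) : fej y = 2 * ∫ t in (0 : ℝ)..1, (1 - t) * Real.cos (y * t) := by
  rw [fej, kerC]
  congr 1
  have h : IntervalIntegrable (fun t : ℝ => ((1 - t : ℝ) : ℂ) * Complex.exp (Complex.I * (y * t : ℝ))) volume 0 1 := by
    apply Continuous.intervalIntegrable; fun_prop
  have := Complex.reCLM.intervalIntegral_comp_comm h
  simp only [Complex.reCLM_apply] at this
  rw [← this]
  apply intervalIntegral.integral_congr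
  intro t _
  simp only [Complex.re_ofReal_mul]
  rw [mul_comm Complex.I, Complex.exp_ofReal_mul_I_re]

lemma fej_of_ne_zero {y : ℝ} (hy : y ≠ 0) : fej y = 2 * (1 - Real.cos y) / y ^ 2 := by
  rw [fej_eq]
  have h : ∫ t in (0 : ℝ)..1, (1 - t) * Real.cos (y * t) =
      ((1 - 1) * Real.sin (y * 1) / y - Real.cos (y * 1) / y ^ 2)
      - ((1 - 0) * Real.sin (y * 0) / y - Real.cos (y * 0) / y ^ 2) := by
    apply intervalIntegral.integral_eq_sub_of_hasDerivAt
      (f := fun t => (1 - t) * Real.sin (y * t) / y - Real.cos (y * t) / y ^ 2)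
    · intro t _
      have h1 : HasDerivAt (fun t : ℝ => y * t) y t := by simpa using (hasDerivAt_id t).const_mul y
      have h2 : HasDerivAt (fun t : ℝ => 1 - t) (-1) t := by simpa using (hasDerivAt_id t).const_sub 1
      have h3 := ((h2.mul h1.sin).div_const y).sub (h1.cos.div_const (y ^ 2))
      refine h3.congr_deriv ?_
      field_simp
      ring
    · apply Continuous.intervalIntegrable; fun_prop
  rw [h]
  simp
  field_simp
  ring

lemma fej_zero : fej 0 = 1 := by
  rw [fej_eq]
  simp only [zero_mul, Real.cos_zero, mul_one]
  rw [intervalIntegral.integral_sub (by simp) (by simp)]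
  simp
  norm_num

lemma fej_nonneg (y : ℝ) : 0 ≤ fej y := by
  by_cases hy : y = 0
  · rw [hy, fej_zero]; norm_num
  · rw [fej_of_ne_zero hy]
    have := Real.cos_le_one y
    apply div_nonneg _ (sq_nonneg _)
    linarith

lemma fej_le_one (y : ℝ) : fej y ≤ 1 := by
  by_cases hy : y = 0
  · rw [hy, fej_zero]
  · rw [fej_of_ne_zero hy, div_le_one (by positivity)]
    have := Real.one_sub_sq_div_two_le_cos (x := y)
    linarith

lemma fej_le (y : ℝ) : fej y ≤ 5 * (1 + y ^ 2)⁻¹ := by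
  rw [← div_eq_mul_inv, le_div_iff₀ (by positivity)]
  by_cases hy : y = 0
  · rw [hy, fej_zero]; norm_num
  · have h1 := fej_le_one y
    have h2 : fej y * y ^ 2 ≤ 4 := by
      rw [fej_of_ne_zero hy, div_mul_cancel₀ _ (by positivity)]
      have := Real.neg_one_le_cos y
      linarith
    linarith

lemma fej_integrable : Integrable fej := by
  apply Integrable.mono' (integrable_inv_one_add_sq.const_mul 5) fej_continuous.aestronglyMeasurable
  filter_upwards with y
  rw [Real.norm_of_nonneg (fej_nonneg y)]
  exact fej_le y

lemma fej_integral_pos : 0 < ∫ y, fej y := by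
  rw [integral_pos_iff_support_of_nonneg fej_nonneg fej_integrable]
  apply IsOpen.measure_pos
  · exact fej_continuous.isOpen_support
  · exact ⟨0, by simp [fej_zero]⟩

end Vino

namespace Vino

open MeasureTheory Set

lemma measurable_of_monotone_exp_mul {b : ℝ → ℝ} (hm : Monotone fun u => Real.exp u * b u) :
    Measurable b := by
  have h : b = fun u => Real.exp (-u) * (Real.exp u * b u) := by
    funext u
    rw [← mul_assoc, ← Real.exp_add]
    simp
  rw [h]
  exact (Real.measurable_exp.comp measurable_neg).mul hm.measurable

lemma exp_neg_mul_integrableOn {σ : ℝ} (hσ : 0 < σ) :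
    Integrable (fun u : ℝ => Real.exp (-(σ * u))) (volume.restrict (Ioi 0)) := by
  have := exp_neg_integrableOn_Ioi 0 hσ
  simpa [IntegrableOn, neg_mul] using this

/-- Smoothed Laplace inversion at positive abscissa. -/
lemma smoothed_inversion_pos {c : ℝ → ℝ} (hc : Measurable c) {C : ℝ} (hC : ∀ u, |c u| ≤ C)
    {g : ℂ → ℂ} (hg : ∀ z : ℂ, 0 < z.re → ∫ u in Ioi (0 : ℝ), (c u : ℂ) * Complex.exp (-z * u) = g z)
    {σ : ℝ} (hσ : 0 < σ) (l x : ℝ) :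
    ∫ u in Ioi (0 : ℝ), c u * Real.exp (-(σ * u)) * fej (l * (x - u)) =
      2 * (∫ t in (0 : ℝ)..1, ((1 - t : ℝ) : ℂ) * Complex.exp (Complex.I * (l * t * x : ℝ)) *
        g (σ + Complex.I * (l * t : ℝ))).re := by
  have hi : Integrable (Function.uncurry fun u t : ℝ => ((c u * Real.exp (-(σ * u)) : ℝ) : ℂ) *
      (((1 - t : ℝ) : ℂ) * Complex.exp (Complex.I * (l * (x - u) * t : ℝ))))
      ((volume.restrict (Ioi (0 : ℝ))).prod (volume.restrict (Ioc (0 : ℝ) 1))) := by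
    have h1 : Integrable (fun z : ℝ × ℝ => (C * Real.exp (-(σ * z.1))) * |1 - z.2|)
        ((volume.restrict (Ioi (0 : ℝ))).prod (volume.restrict (Ioc (0 : ℝ) 1))) := by
      apply Integrable.mul_prod (f := fun u => C * Real.exp (-(σ * u))) (g := fun t => |1 - t|)
      · exact (exp_neg_mul_integrableOn hσ).const_mul C
      · apply Continuous.integrableOn_Ioc
        fun_prop
    apply h1.mono'
    · apply Measurable.aestronglyMeasurable
      unfold Function.uncurry
      fun_prop
    · filter_upwards with z
      simp only [Function.uncurry, norm_mul, Complex.norm_real, Real.norm_eq_abs, Real.abs_exp]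
      rw [mul_comm Complex.I, Complex.norm_exp_ofReal_mul_I, mul_one]
      gcongr
      exact hC _
  have hsw := integral_integral_swap hi
  have hL : ∫ u in Ioi (0 : ℝ), c u * Real.exp (-(σ * u)) * fej (l * (x - u)) =
      2 * (∫ u in Ioi (0 : ℝ), ∫ t in Ioc (0 : ℝ) 1, ((c u * Real.exp (-(σ * u)) : ℝ) : ℂ) *
      (((1 - t : ℝ) : ℂ) * Complex.exp (Complex.I * (l * (x - u) * t : ℝ)))).re := by
    have h_int := hi.integral_prod_left
    have := Complex.reCLM.integral_comp_comm h_int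
    simp only [Complex.reCLM_apply, Function.uncurry] at this
    rw [← this, ← integral_const_mul]
    apply integral_congr_ae
    filter_upwards with u
    rw [integral_const_mul, ← intervalIntegral.integral_of_le zero_le_one, Complex.re_ofReal_mul, fej, kerC]
    ring
  rw [hL, hsw, intervalIntegral.integral_of_le zero_le_one]
  congr 2
  apply integral_congr_ae
  filter_upwards with t
  rw [← hg _ (by simpa using hσ), ← integral_const_mul]
  apply integral_congr_ae
  filter_upwards with u
  push_cast
  have : Complex.exp (-(σ * u)) * Complex.exp (Complex.I * (l * (x - u) * t)) =
    Complex.exp (Complex.I * (l * t * x)) * Complex.exp (-(σ + Complex.I * (l * t)) * u) := by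
    rw [← Complex.exp_add, ← Complex.exp_add]
    congr 1
    ring
  calc _ = (c u : ℂ) * (1 - t) * (Complex.exp (-(σ * u)) * Complex.exp (Complex.I * (l * (x - u) * t))) := by ring
    _ = _ := by rw [this]; ring

lemma fej_scaled_integrable {l : ℝ} (hl : l ≠ 0) (x : ℝ) :
    Integrable fun u => fej (l * (x - u)) :=
  (fej_integrable.comp_mul_left' hl).comp_sub_left x

lemma smoothed_inversion {c : ℝ → ℝ} (hc : Measurable c) {C : ℝ} (hC : ∀ u, |c u| ≤ C)
    {g : ℂ → ℂ} (hgc : ContinuousOn g {z | 0 ≤ z.re})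
    (hg : ∀ z : ℂ, 0 < z.re → ∫ u in Ioi (0 : ℝ), (c u : ℂ) * Complex.exp (-z * u) = g z)
    {l : ℝ} (hl : 0 < l) (x : ℝ) :
    ∫ u in Ioi (0 : ℝ), c u * fej (l * (x - u)) =
      2 * (∫ t in (0 : ℝ)..1, ((1 - t : ℝ) : ℂ) * Complex.exp (Complex.I * (l * t * x : ℝ)) *
        g (Complex.I * (l * t : ℝ))).re := by
  have hre : ∀ s y : ℝ, ((s : ℂ) + Complex.I * (y : ℝ)).re = s := by simp
  have hσ : ∀ n : ℕ, (0 : ℝ) < 1 / ((n : ℝ) + 1) := fun n => by positivity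
  have h0 : Tendsto (fun n : ℕ => 1 / ((n : ℝ) + 1)) atTop (nhds 0) := tendsto_one_div_add_atTop_nhds_zero_nat
  have h1 : Tendsto (fun n : ℕ => ∫ u in Ioi (0 : ℝ), c u * Real.exp (-(1 / ((n : ℝ) + 1) * u)) * fej (l * (x - u)))
      atTop (nhds (∫ u in Ioi (0 : ℝ), c u * fej (l * (x - u)))) := by
    apply tendsto_integral_of_dominated_convergence (fun u => C * fej (l * (x - u)))
    · intro n
      have := fej_continuous.measurable
      apply Measurable.aestronglyMeasurable
      fun_prop
    · exact ((fej_scaled_integrable hl.ne' x).const_mul C).integrableOn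
    · intro n
      rw [ae_restrict_iff' measurableSet_Ioi]
      filter_upwards with u hu
      have hu' : (0 : ℝ) < u := hu
      rw [norm_mul, norm_mul, Real.norm_of_nonneg (fej_nonneg _), Real.norm_eq_abs, Real.norm_eq_abs, Real.abs_exp]
      apply mul_le_mul_of_nonneg_right _ (fej_nonneg _)
      have : Real.exp (-(1 / ((n : ℝ) + 1) * u)) ≤ 1 := by
        rw [Real.exp_le_one_iff]
        have := mul_pos (hσ n) hu'
        linarith
      calc _ ≤ |c u| * 1 := by gcongr
        _ ≤ C := by rw [mul_one]; exact hC u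
    · filter_upwards with u
      have h2 : Tendsto (fun n : ℕ => Real.exp (-(1 / ((n : ℝ) + 1) * u))) atTop (nhds (Real.exp (-(0 * u)))) :=
        (Real.continuous_exp.tendsto _).comp (h0.mul_const u).neg
      have := (h2.const_mul (c u)).mul_const (fej (l * (x - u)))
      simpa using this
  have h2 : Tendsto (fun n : ℕ => ∫ t in (0 : ℝ)..1, ((1 - t : ℝ) : ℂ) * Complex.exp (Complex.I * (l * t * x : ℝ)) *
        g ((1 / ((n : ℝ) + 1) : ℝ) + Complex.I * (l * t : ℝ))) atTop
      (nhds (∫ t in (0 : ℝ)..1, ((1 - t : ℝ) : ℂ) * Complex.exp (Complex.I * (l * t * x : ℝ)) *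
        g (Complex.I * (l * t : ℝ)))) := by
    have hK : IsCompact ((fun p : ℝ × ℝ => (p.1 : ℂ) + Complex.I * (l * p.2 : ℝ)) '' (Icc 0 1 ×ˢ Icc 0 1)) := by
      apply IsCompact.image (isCompact_Icc.prod isCompact_Icc)
      fun_prop
    have hKs : ((fun p : ℝ × ℝ => (p.1 : ℂ) + Complex.I * (l * p.2 : ℝ)) '' (Icc 0 1 ×ˢ Icc 0 1)) ⊆ {z | 0 ≤ z.re} := by
      rintro z ⟨p, hp, rfl⟩
      simpa using hp.1.1
    obtain ⟨B, hB⟩ := hK.exists_bound_of_continuousOn (hgc.mono hKs)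
    apply intervalIntegral.tendsto_integral_filter_of_dominated_convergence (fun _ => B)
    · filter_upwards with n
      have hcont : ContinuousOn (fun t : ℝ => g ((1 / ((n : ℝ) + 1) : ℝ) + Complex.I * (l * t : ℝ))) univ := by
        apply hgc.comp (t := {z | 0 ≤ z.re}) (by fun_prop)
        intro t _
        exact (hσ n).le.trans_eq (hre _ _).symm
      rw [continuousOn_univ] at hcont
      apply Continuous.aestronglyMeasurable
      exact Continuous.mul (by fun_prop) hcont
    · filter_upwards with n
      filter_upwards with t ht
      rw [uIoc_of_le zero_le_one] at ht
      have h3 := hB ((1 / ((n : ℝ) + 1) : ℝ) + Complex.I * (l * t : ℝ)) ⟨(1 / ((n : ℝ) + 1), t), ⟨⟨(hσ n).le, by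
        rw [div_le_one (by positivity)]; linarith [(Nat.cast_nonneg n : (0 : ℝ) ≤ n)]⟩, ht.1.le, ht.2⟩, rfl⟩
      rw [norm_mul, norm_mul, Complex.norm_real, mul_comm Complex.I (l * t * x : ℝ), Complex.norm_exp_ofReal_mul_I, mul_one,
        Real.norm_of_nonneg (by linarith [ht.2])]
      have h4 := norm_nonneg (g ((1 / ((n : ℝ) + 1) : ℝ) + Complex.I * (l * t : ℝ)))
      nlinarith [ht.1, ht.2]
    · exact intervalIntegrable_const
    · filter_upwards with t ht
      rw [uIoc_of_le zero_le_one] at ht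
      apply Tendsto.const_mul
      have h3 : ContinuousWithinAt g {z | 0 ≤ z.re} (Complex.I * (l * t : ℝ)) := hgc _ (by simp)
      apply h3.tendsto.comp
      apply tendsto_nhdsWithin_of_tendsto_nhds_of_eventually_within
      · have h4 : Tendsto (fun n : ℕ => ((1 / ((n : ℝ) + 1) : ℝ) : ℂ)) atTop (nhds ((0 : ℝ) : ℂ)) :=
          (Complex.continuous_ofReal.tendsto _).comp h0
        simpa using h4.add_const (Complex.I * (l * t : ℝ))
      · filter_upwards with n
        exact (hσ n).le.trans_eq (hre _ _).symm
  have h3 := ((Complex.continuous_re.tendsto _).comp h2).const_mul 2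
  refine tendsto_nhds_unique h1 (h3.congr fun n => ?_)
  exact (smoothed_inversion_pos hc hC hg (hσ n) l x).symm

lemma smoothed_tendsto_zero {c : ℝ → ℝ} (hc : Measurable c) {C : ℝ} (hC : ∀ u, |c u| ≤ C)
    {g : ℂ → ℂ} (hgc : ContinuousOn g {z | 0 ≤ z.re})
    (hg : ∀ z : ℂ, 0 < z.re → ∫ u in Ioi (0 : ℝ), (c u : ℂ) * Complex.exp (-z * u) = g z)
    {l : ℝ} (hl : 0 < l) :
    Tendsto (fun x => ∫ u in Ioi (0 : ℝ), c u * fej (l * (x - u))) atTop (nhds 0) := by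
  have h1 := Real.tendsto_integral_exp_smul_cocompact
    ((Ioc (0 : ℝ) 1).indicator fun t => ((1 - t : ℝ) : ℂ) * g (Complex.I * (l * t : ℝ)))
  have h2 : Tendsto (fun x : ℝ => -(l / (2 * Real.pi)) * x) atTop (cocompact ℝ) := by
    have : Tendsto (fun x : ℝ => -(l / (2 * Real.pi)) * x) atTop atBot :=
      Tendsto.const_mul_atTop_of_neg (by have := Real.pi_pos; simp; positivity) tendsto_id
    exact this.mono_right atBot_le_cocompact
  have h3 := ((Complex.continuous_re.tendsto _).comp (h1.comp h2)).const_mul 2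
  simp only [Complex.zero_re, mul_zero] at h3
  refine h3.congr fun x => ?_
  rw [smoothed_inversion hc hC hgc hg hl x, intervalIntegral.integral_of_le zero_le_one,
    ← integral_indicator measurableSet_Ioc]
  simp only [Function.comp_apply]
  congr 2
  apply integral_congr_ae
  filter_upwards with t
  by_cases ht : t ∈ Ioc (0 : ℝ) 1
  · rw [indicator_of_mem ht, indicator_of_mem ht, Circle.smul_def, Real.fourierChar_apply, smul_eq_mul]
    have : (2 * Real.pi * (-(t * (-(l / (2 * Real.pi)) * x))) : ℝ) = l * t * x := by
      have := Real.pi_pos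
      field_simp
    rw [this, mul_comm Complex.I (l * t * x : ℝ)]
    ring
  · rw [indicator_of_notMem ht, indicator_of_notMem ht, smul_zero]

end Vino

namespace Vino

open MeasureTheory Set

lemma integral_fej_scaled {l : ℝ} (hl : 0 < l) (x : ℝ) :
    ∫ u, fej (l * (x - u)) = l⁻¹ * ∫ y, fej y := by
  rw [integral_sub_left_eq_self (fun u => fej (l * u)) volume x, Measure.integral_comp_mul_left,
    abs_of_pos (inv_pos.mpr hl), smul_eq_mul]

lemma integral_fej_window {l : ℝ} (hl : 0 < l) (x δ : ℝ) :
    ∫ u in (x - δ)..(x + δ), fej (l * (x - u)) = l⁻¹ * ∫ y in (-(l * δ))..(l * δ), fej y := by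
  have h : ∀ u, l * (x - u) = l * x - l * u := fun u => by ring
  simp_rw [h]
  rw [intervalIntegral.integral_comp_sub_mul _ hl.ne', smul_eq_mul]
  congr 2 <;> ring

/-- Window estimates for averages of a slowly decreasing function. -/
lemma window_estimates {b : ℝ → ℝ} {C : ℝ} (hb0 : ∀ u, 0 ≤ b u) (hbC : ∀ u, b u ≤ C)
    (hm : Monotone fun u => Real.exp u * b u) {A : ℝ} (hA : 0 ≤ A) {l δ : ℝ} (hl : 0 < l) (hδ : 0 < δ) :
    (∀ y, 0 ≤ y → b y * Real.exp (-(2 * δ)) * ∫ v in (-(l * δ))..(l * δ), fej v ≤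
        A * (∫ v, fej v) + l * ∫ u in Ioi (0 : ℝ), (b u - A) * fej (l * (y + δ - u))) ∧
    (∀ y, 2 * δ ≤ y → A * (∫ v in (-(l * δ))..(l * δ), fej v) +
        l * (∫ u in Ioi (0 : ℝ), (b u - A) * fej (l * (y - δ - u))) ≤
        b y * Real.exp (2 * δ) * (∫ v, fej v) +
        C * ((∫ v, fej v) - ∫ v in (-(l * δ))..(l * δ), fej v)) := by
  have hbm := measurable_of_monotone_exp_mul hm
  have hfi := fun x => fej_scaled_integrable hl.ne' x
  have hbi : ∀ x, Integrable fun u => b u * fej (l * (x - u)) := by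
    intro x
    apply (hfi x).bdd_mul hbm.aestronglyMeasurable (c := C)
    filter_upwards with u
    rw [Real.norm_of_nonneg (hb0 u)]
    exact hbC u
  have hsplit : ∀ x, ∫ u in Ioi (0 : ℝ), (b u - A) * fej (l * (x - u)) =
      (∫ u in Ioi (0 : ℝ), b u * fej (l * (x - u))) - A * ∫ u in Ioi (0 : ℝ), fej (l * (x - u)) := by
    intro x
    rw [← integral_const_mul, ← integral_sub (hbi x).integrableOn ((hfi x).const_mul A).integrableOn]
    simp only [sub_mul]
  have hw : ∀ x, ∫ u in Ioc (x - δ) (x + δ), fej (l * (x - u)) = l⁻¹ * ∫ v in (-(l * δ))..(l * δ), fej v := by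
    intro x
    rw [← integral_fej_window hl x δ, intervalIntegral.integral_of_le (by linarith)]
  have hmono : ∀ u v, u ≤ v → b u ≤ Real.exp (v - u) * b v := by
    intro u v huv
    have h1 : Real.exp u * b u ≤ Real.exp v * b v := hm huv
    have h2 : Real.exp v = Real.exp u * Real.exp (v - u) := by rw [← Real.exp_add]; ring_nf
    rw [h2, mul_assoc] at h1
    exact le_of_mul_le_mul_left h1 (Real.exp_pos u)
  constructor
  · intro y hy
    have hw1 := hw (y + δ)
    rw [show y + δ - δ = y by ring] at hw1
    have hsub : Ioc y (y + δ + δ) ⊆ Ioi (0 : ℝ) := fun u hu => lt_of_le_of_lt hy hu.1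
    have h1 : b y * Real.exp (-(2 * δ)) * (∫ u in Ioc y (y + δ + δ), fej (l * (y + δ - u))) ≤
        ∫ u in Ioi (0 : ℝ), b u * fej (l * (y + δ - u)) := by
      rw [← integral_const_mul]
      calc _ ≤ ∫ u in Ioc y (y + δ + δ), b u * fej (l * (y + δ - u)) := by
            apply setIntegral_mono_on ((hfi _).const_mul _).integrableOn (hbi _).integrableOn measurableSet_Ioc
            intro u hu
            apply mul_le_mul_of_nonneg_right _ (fej_nonneg _)
            have h3 := hmono y u hu.1.le
            calc b y * Real.exp (-(2 * δ)) ≤ (Real.exp (u - y) * b u) * Real.exp (-(2 * δ)) := by gcongr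
              _ = b u * Real.exp (u - y - 2 * δ) := by
                  rw [sub_eq_add_neg (u - y), Real.exp_add]; ring
              _ ≤ b u * 1 := by
                  apply mul_le_mul_of_nonneg_left _ (hb0 u)
                  rw [Real.exp_le_one_iff]
                  linarith [hu.2]
              _ = b u := mul_one _
        _ ≤ _ := by
            apply setIntegral_mono_set (hbi _).integrableOn
            · filter_upwards with u
              exact mul_nonneg (hb0 u) (fej_nonneg _)
            · exact hsub.eventuallyLE
    have h2 : ∫ u in Ioi (0 : ℝ), fej (l * (y + δ - u)) ≤ l⁻¹ * ∫ v, fej v := by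
      rw [← integral_fej_scaled hl (y + δ)]
      apply setIntegral_le_integral (hfi _)
      filter_upwards with u
      exact fej_nonneg _
    rw [hsplit]
    rw [hw1] at h1
    have h3 := mul_le_mul_of_nonneg_left h1 hl.le
    have h4 := mul_le_mul_of_nonneg_left h2 (mul_nonneg hl.le hA)
    have h5 : l * (b y * Real.exp (-(2 * δ)) * (l⁻¹ * ∫ v in (-(l * δ))..(l * δ), fej v)) =
      b y * Real.exp (-(2 * δ)) * ∫ v in (-(l * δ))..(l * δ), fej v := by field_simp
    have h6 : l * A * (l⁻¹ * ∫ v, fej v) = A * ∫ v, fej v := by field_simp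
    rw [h5] at h3
    rw [h6] at h4
    linarith
  · intro y hy
    have hw1 := hw (y - δ)
    rw [show y - δ + δ = y by ring] at hw1
    have hsub : Ioc (y - δ - δ) y ⊆ Ioi (0 : ℝ) := fun u hu => by
      have := hu.1
      simp only [mem_Ioi]
      linarith
    have h1 : ∫ u in Ioc (y - δ - δ) y, fej (l * (y - δ - u)) ≤ ∫ u in Ioi (0 : ℝ), fej (l * (y - δ - u)) := by
      apply setIntegral_mono_set (hfi _).integrableOn
      · filter_upwards with u
        exact fej_nonneg _
      · exact hsub.eventuallyLE
    have h2 : ∫ u in Ioi (0 : ℝ), b u * fej (l * (y - δ - u)) ≤ ∫ u, b u * fej (l * (y - δ - u)) := by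
      apply setIntegral_le_integral (hbi _)
      filter_upwards with u
      exact mul_nonneg (hb0 u) (fej_nonneg _)
    have h3 := integral_add_compl (measurableSet_Ioc (a := y - δ - δ) (b := y)) (hbi (y - δ))
    have h3' := integral_add_compl (measurableSet_Ioc (a := y - δ - δ) (b := y)) (hfi (y - δ))
    have h4 : ∫ u in Ioc (y - δ - δ) y, b u * fej (l * (y - δ - u)) ≤
        b y * Real.exp (2 * δ) * ∫ u in Ioc (y - δ - δ) y, fej (l * (y - δ - u)) := by
      rw [← integral_const_mul]
      apply setIntegral_mono_on (hbi _).integrableOn ((hfi _).const_mul _).integrableOn measurableSet_Ioc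
      intro u hu
      apply mul_le_mul_of_nonneg_right _ (fej_nonneg _)
      refine (hmono u y hu.2).trans ?_
      rw [mul_comm]
      apply mul_le_mul_of_nonneg_left _ (hb0 y)
      apply Real.exp_le_exp.mpr
      linarith [hu.1]
    have h5 : ∫ u in (Ioc (y - δ - δ) y)ᶜ, b u * fej (l * (y - δ - u)) ≤
        C * ∫ u in (Ioc (y - δ - δ) y)ᶜ, fej (l * (y - δ - u)) := by
      rw [← integral_const_mul]
      apply setIntegral_mono_on (hbi _).integrableOn ((hfi _).const_mul _).integrableOn measurableSet_Ioc.compl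
      intro u hu
      exact mul_le_mul_of_nonneg_right (hbC u) (fej_nonneg _)
    have h6 : l⁻¹ * (∫ v in (-(l * δ))..(l * δ), fej v) ≤ l⁻¹ * ∫ v, fej v := by
      rw [← hw1, ← integral_fej_scaled hl (y - δ)]
      apply setIntegral_le_integral (hfi _)
      filter_upwards with u
      exact fej_nonneg _
    rw [hsplit]
    rw [integral_fej_scaled hl] at h3'
    rw [hw1] at h1 h4 h3'
    have hy0 := mul_nonneg (hb0 y) (Real.exp_pos (2 * δ)).le
    set K := ∫ v, fej v
    set J := ∫ v in (-(l * δ))..(l * δ), fej v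
    have h7 := mul_le_mul_of_nonneg_left h6 hy0
    have h8 := mul_le_mul_of_nonneg_left h1 hA
    have h9 : (∫ u in Ioi (0 : ℝ), b u * fej (l * (y - δ - u))) ≤
      b y * Real.exp (2 * δ) * (l⁻¹ * K) + C * (l⁻¹ * K - l⁻¹ * J) := by
      have : ∫ u in (Ioc (y - δ - δ) y)ᶜ, fej (l * (y - δ - u)) = l⁻¹ * K - l⁻¹ * J := by linarith
      rw [this] at h5
      linarith
    have h10 : A * (l⁻¹ * J) + ((∫ u in Ioi (0 : ℝ), b u * fej (l * (y - δ - u))) - A * ∫ u in Ioi (0 : ℝ), fej (l * (y - δ - u)))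
       ≤ b y * Real.exp (2 * δ) * (l⁻¹ * K) + C * (l⁻¹ * K - l⁻¹ * J) := by linarith
    have h11 := mul_le_mul_of_nonneg_left h10 hl.le
    have e1 : l * (A * (l⁻¹ * J) + ((∫ u in Ioi (0 : ℝ), b u * fej (l * (y - δ - u))) - A * ∫ u in Ioi (0 : ℝ), fej (l * (y - δ - u))))
      = A * J + l * ((∫ u in Ioi (0 : ℝ), b u * fej (l * (y - δ - u))) - A * ∫ u in Ioi (0 : ℝ), fej (l * (y - δ - u))) := by
      field_simp
    have e2 : l * (b y * Real.exp (2 * δ) * (l⁻¹ * K) + C * (l⁻¹ * K - l⁻¹ * J)) = b y * Real.exp (2 * δ) * K + C * (K - J) := by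
      field_simp
    rw [e1, e2] at h11
    exact h11

/-- The Wiener–Ikehara theorem in Laplace transform form. -/
theorem wiener_ikehara {b : ℝ → ℝ} {C : ℝ} (hb0 : ∀ u, 0 ≤ b u) (hbC : ∀ u, b u ≤ C)
    (hm : Monotone fun u => Real.exp u * b u) {A : ℝ} (hA : 0 ≤ A)
    {g : ℂ → ℂ} (hgc : ContinuousOn g {z | 0 ≤ z.re})
    (hg : ∀ z : ℂ, 0 < z.re →
      ∫ u in Ioi (0 : ℝ), ((b u - A : ℝ) : ℂ) * Complex.exp (-z * u) = g z) :
    Tendsto b atTop (nhds A) := by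
  have hC0 : 0 ≤ C := (hb0 0).trans (hbC 0)
  rw [Metric.tendsto_atTop']
  intro ε hε
  obtain ⟨τ, hτ0, hτ1, hτε⟩ : ∃ τ : ℝ, 0 < τ ∧ τ ≤ 1 / 2 ∧ τ * (A + 2 + 2 * C) < ε := by
    refine ⟨min (1 / 2) (ε / (2 * (A + 2 + 2 * C))), by positivity, min_le_left _ _, ?_⟩
    calc min (1 / 2) (ε / (2 * (A + 2 + 2 * C))) * (A + 2 + 2 * C)
        ≤ ε / (2 * (A + 2 + 2 * C)) * (A + 2 + 2 * C) := by gcongr; exact min_le_right _ _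
      _ = ε / 2 := by field_simp
      _ < ε := by linarith
  set δ := Real.log (1 + τ) / 2 with hδdef
  have hδ : 0 < δ := by have := Real.log_pos (show 1 < 1 + τ by linarith); positivity
  have hexp : Real.exp (2 * δ) = 1 + τ := by
    rw [hδdef, mul_div_cancel₀ _ (by norm_num), Real.exp_log (by linarith)]
  have hexp' : Real.exp (-(2 * δ)) = (1 + τ)⁻¹ := by rw [Real.exp_neg, hexp]
  have hκ := fej_integral_pos
  set K := ∫ v, fej v with hK
  obtain ⟨l, hl, hJ, hJ'⟩ : ∃ l : ℝ, 0 < l ∧ (1 - τ) * K ≤ (∫ v in (-(l * δ))..(l * δ), fej v) ∧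
      (∫ v in (-(l * δ))..(l * δ), fej v) ≤ K := by
    have h1 : Tendsto (fun l : ℝ => l * δ) atTop atTop := tendsto_id.atTop_mul_const hδ
    have h2 := intervalIntegral_tendsto_integral fej_integrable (tendsto_neg_atTop_atBot.comp h1) h1
    have h3 := h2.eventually_const_le (show (1 - τ) * K < K by nlinarith)
    obtain ⟨l, hl1, hl2⟩ := (h3.and (eventually_gt_atTop 0)).exists
    refine ⟨l, hl2, hl1, ?_⟩
    rw [intervalIntegral.integral_of_le (by have := mul_pos hl2 hδ; linarith)]
    apply setIntegral_le_integral fej_integrable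
    filter_upwards with u
    exact fej_nonneg _
  obtain ⟨hup, hlo⟩ := window_estimates hb0 hbC hm hA hl hδ
  have hbm := measurable_of_monotone_exp_mul hm
  have hz := smoothed_tendsto_zero (c := fun u => b u - A) (hbm.sub_const A) (C := C + A) (fun u => by
    rw [abs_le]; constructor <;> linarith [hb0 u, hbC u]) hgc hg hl
  have hz2 : ∀ᶠ x in atTop, |l * ∫ u in Ioi (0 : ℝ), (b u - A) * fej (l * (x - u))| < τ * K := by
    have := (hz.const_mul l).abs
    rw [mul_zero, abs_zero] at this
    exact this.eventually_lt_const (by positivity)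
  obtain ⟨X, hX⟩ := eventually_atTop.mp hz2
  refine ⟨max X 0 + 2 * δ, fun y hy => ?_⟩
  have hy1 : X + 2 * δ < y := lt_of_le_of_lt (by gcongr; exact le_max_left _ _) hy
  have hy2 : 2 * δ < y := lt_of_le_of_lt (by linarith [le_max_right X 0]) hy
  have u1 := hup y (by linarith)
  have u2 := hlo y hy2.le
  have u3 := abs_lt.mp (hX (y + δ) (by linarith))
  have u4 := abs_lt.mp (hX (y - δ) (by linarith))
  rw [hexp'] at u1
  rw [hexp] at u2
  set J := ∫ v in (-(l * δ))..(l * δ), fej v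
  have v1 : b y * (1 - τ) ≤ (A + τ) * (1 + τ) := by
    have : b y * (1 + τ)⁻¹ * ((1 - τ) * K) ≤ (A + τ) * K := by
      have : b y * (1 + τ)⁻¹ * ((1 - τ) * K) ≤ b y * (1 + τ)⁻¹ * J := by
        have := hb0 y
        gcongr
      linarith [u3.2]
    have h2 : b y * (1 + τ)⁻¹ * (1 - τ) ≤ A + τ := le_of_mul_le_mul_right (by linarith) hκ
    have h3 := mul_le_mul_of_nonneg_right h2 (show 0 ≤ 1 + τ by linarith)
    have h4 : b y * (1 + τ)⁻¹ * (1 - τ) * (1 + τ) = b y * (1 - τ) := by field_simp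
    linarith
  have v2 : A * (1 - τ) - τ ≤ b y * (1 + τ) + C * τ := by
    have h1 : A * ((1 - τ) * K) ≤ A * J := by gcongr
    have h2 : C * (K - J) ≤ C * (τ * K) := by gcongr; linarith
    have h3 : (A * (1 - τ) - τ) * K ≤ (b y * (1 + τ) + C * τ) * K := by linarith [u4.1]
    exact le_of_mul_le_mul_right h3 hκ
  have hb1 := mul_le_mul_of_nonneg_left (hbC y) hτ0.le
  rw [Real.dist_eq, abs_lt]
  constructor <;> nlinarith

end Vino

namespace Vino

open MeasureTheory Set ArithmeticFunction ArithmeticFunction.vonMangoldt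

/-- Chebyshev sum of von Mangoldt over a residue class. -/
noncomputable def psiClass {q : ℕ} (a : ZMod q) (x : ℝ) : ℝ := ∑ k ∈ Finset.Icc 1 ⌊x⌋₊, residueClass a k

lemma psiClass_nonneg {q : ℕ} (a : ZMod q) (x : ℝ) : 0 ≤ psiClass a x :=
  Finset.sum_nonneg fun _ _ => residueClass_nonneg a _

lemma psiClass_mono {q : ℕ} (a : ZMod q) : Monotone (psiClass a) := by
  intro x y hxy
  apply Finset.sum_le_sum_of_subset_of_nonneg
  · exact Finset.Icc_subset_Icc_right (Nat.floor_mono hxy)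
  · intro i _ _
    exact residueClass_nonneg a i

lemma psiClass_le {q : ℕ} (a : ZMod q) {x : ℝ} (hx : 0 ≤ x) : psiClass a x ≤ (Real.log 4 + 4) * x := by
  refine le_trans ?_ (Chebyshev.psi_le_const_mul_self hx)
  rw [psiClass, Chebyshev.psi]
  exact Finset.sum_le_sum fun i _ => residueClass_le a i

lemma image_exp_Ioi_zero : Real.exp '' Ioi 0 = Ioi 1 := by
  ext y
  constructor
  · rintro ⟨x, hx, rfl⟩
    exact Real.one_lt_exp_iff.mpr hx
  · intro hy
    exact ⟨Real.log y, Real.log_pos hy, Real.exp_log (lt_trans one_pos hy)⟩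

lemma laplace_psiClass {q : ℕ} (a : ZMod q) {z : ℂ} (hz : 0 < z.re) :
    LSeries (fun n => (residueClass a n : ℂ)) (z + 1) =
      (z + 1) * ∫ u in Ioi (0 : ℝ), ((Real.exp (-u) * psiClass a (Real.exp u) : ℝ) : ℂ) * Complex.exp (-z * u) := by
  rw [LSeries_eq_mul_integral_of_nonneg (residueClass a) zero_le_one (s := z + 1) (by simpa using hz) _
    (residueClass_nonneg a)]
  · congr 1
    rw [← image_exp_Ioi_zero, integral_image_eq_integral_abs_deriv_smul measurableSet_Ioi
      (fun x _ => (Real.hasDerivAt_exp x).hasDerivWithinAt) Real.exp_injective.injOn]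
    apply integral_congr_ae
    filter_upwards with u
    rw [Real.abs_exp, Complex.real_smul, psiClass, Complex.cpow_def_of_ne_zero (by exact_mod_cast (Real.exp_pos u).ne'),
      ← Complex.ofReal_log (Real.exp_pos u).le, Real.log_exp]
    push_cast
    have h : Complex.exp u * Complex.exp (u * -(z + 1 + 1)) = Complex.exp (-u) * Complex.exp (-z * u) := by
      rw [← Complex.exp_add, ← Complex.exp_add]
      ring_nf
    calc _ = (∑ k ∈ Finset.Icc 1 ⌊Real.exp u⌋₊, (residueClass a k : ℂ)) *
          (Complex.exp u * Complex.exp (u * -(z + 1 + 1))) := by ring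
      _ = _ := by rw [h]; ring
  · apply Asymptotics.IsBigO.of_bound (Real.log 4 + 4)
    filter_upwards with n
    have h := psiClass_le a (Nat.cast_nonneg (α := ℝ) n)
    have h0 := psiClass_nonneg a n
    rw [psiClass, Nat.floor_natCast] at h h0
    rw [Real.norm_of_nonneg h0, Real.rpow_one, Real.norm_of_nonneg (Nat.cast_nonneg n)]
    exact h

lemma tendsto_psiClass {q : ℕ} [NeZero q] {a : ZMod q} (ha : IsUnit a) :
    Tendsto (fun u => Real.exp (-u) * psiClass a (Real.exp u)) atTop (nhds ((q.totient : ℝ)⁻¹)) := by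
  set A : ℝ := (q.totient : ℝ)⁻¹ with hA
  have hA0 : 0 ≤ A := by positivity
  have hmon : Monotone fun u => Real.exp u * (Real.exp (-u) * psiClass a (Real.exp u)) := by
    have : (fun u => Real.exp u * (Real.exp (-u) * psiClass a (Real.exp u))) = fun u => psiClass a (Real.exp u) := by
      funext u
      rw [← mul_assoc, ← Real.exp_add]
      simp
    rw [this]
    exact (psiClass_mono a).comp Real.exp_monotone
  have h0 : ∀ u, 0 ≤ Real.exp (-u) * psiClass a (Real.exp u) := fun u =>
    mul_nonneg (Real.exp_pos _).le (psiClass_nonneg a _)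
  have hC : ∀ u, Real.exp (-u) * psiClass a (Real.exp u) ≤ Real.log 4 + 4 := by
    intro u
    calc _ ≤ Real.exp (-u) * ((Real.log 4 + 4) * Real.exp u) := by
          gcongr
          exact psiClass_le a (Real.exp_pos u).le
      _ = (Real.log 4 + 4) * (Real.exp (-u) * Real.exp u) := by ring
      _ = Real.log 4 + 4 := by rw [← Real.exp_add]; simp
  apply wiener_ikehara h0 hC hmon hA0 (g := fun z => (LFunctionResidueClassAux a (z + 1) - A) / (z + 1))
  · apply ContinuousOn.div
    · apply ContinuousOn.sub _ continuousOn_const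
      apply (continuousOn_LFunctionResidueClassAux a).comp (by fun_prop)
      intro z hz
      have : 0 ≤ z.re := hz
      show 1 ≤ (z + 1).re
      simpa using this
    · fun_prop
    · intro z hz h
      have h1 : 0 ≤ z.re := hz
      have h2 := congrArg Complex.re h
      simp at h2
      linarith
  · intro z hz
    have hz1 : z + 1 ≠ 0 := fun h => by
      have h2 := congrArg Complex.re h
      simp at h2
      linarith
    have hz0 : z ≠ 0 := fun h => by rw [h] at hz; simp at hz
    have hL := laplace_psiClass a hz
    have hG := eqOn_LFunctionResidueClassAux ha (show 1 < (z + 1).re by simpa using hz)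
    simp only [add_sub_cancel_right] at hG
    have hexpi : IntegrableOn (fun u : ℝ => Complex.exp (-z * u)) (Ioi 0) :=
      integrableOn_exp_mul_complex_Ioi (by simpa using hz) 0
    have hexp : ∫ u in Ioi (0 : ℝ), Complex.exp (-z * u) = 1 / z := by
      rw [integral_exp_mul_complex_Ioi (by simpa using hz)]
      simp [neg_div, div_neg]
    have hbi : IntegrableOn (fun u : ℝ => ((Real.exp (-u) * psiClass a (Real.exp u) : ℝ) : ℂ) * Complex.exp (-z * u)) (Ioi 0) := by
      apply hexpi.bdd_mul (c := Real.log 4 + 4)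
      · exact (Complex.measurable_ofReal.comp (measurable_of_monotone_exp_mul hmon)).aestronglyMeasurable
      · filter_upwards with u
        rw [Complex.norm_real, Real.norm_of_nonneg (h0 u)]
        exact hC u
    have hsplit : ∫ u in Ioi (0 : ℝ), ((Real.exp (-u) * psiClass a (Real.exp u) - A : ℝ) : ℂ) * Complex.exp (-z * u) =
        (∫ u in Ioi (0 : ℝ), ((Real.exp (-u) * psiClass a (Real.exp u) : ℝ) : ℂ) * Complex.exp (-z * u)) - A * (1 / z) := by
      rw [← hexp, ← integral_const_mul, ← integral_sub hbi (hexpi.const_mul _)]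
      congr 1
      funext u
      push_cast
      ring
    rw [hsplit, hG, hL, hA]
    push_cast
    generalize (∫ u in Ioi (0 : ℝ), _ : ℂ) = I
    field_simp
    ring

/-- Logarithm restricted to primes. -/
noncomputable def lp (n : ℕ) : ℝ := if n.Prime then Real.log n else 0

lemma lp_nonneg (n : ℕ) : 0 ≤ lp n := by
  unfold lp
  split_ifs
  · exact Real.log_natCast_nonneg n
  · exact le_rfl

lemma lp_le_log (n : ℕ) : lp n ≤ Real.log n := by
  unfold lp
  split_ifs
  · exact le_rfl
  · exact Real.log_natCast_nonneg n

lemma lp_le_vonMangoldt (n : ℕ) : lp n ≤ vonMangoldt n := by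
  unfold lp
  split_ifs with h
  · exact (vonMangoldt_apply_prime h).ge
  · exact vonMangoldt_nonneg

/-- The prime number theorem in arithmetic progressions. -/
theorem prime_sum_residue_class {q : ℕ} [NeZero q] {a : ZMod q} (ha : IsUnit a) :
    Tendsto (fun N : ℕ => (∑ n ∈ (Finset.Icc 1 N).filter (fun n : ℕ => (n : ZMod q) = a), lp n) / N) atTop
      (nhds ((q.totient : ℝ)⁻¹)) := by
  have h1 := (tendsto_psiClass ha).comp (Real.tendsto_log_atTop.comp tendsto_natCast_atTop_atTop)
  obtain ⟨C, hC⟩ := Chebyshev.psi_sub_theta_le_mul_sqrt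
  have h2 : Tendsto (fun N : ℕ => C * (1 / Real.sqrt N)) atTop (nhds 0) := by
    have : Tendsto (fun N : ℕ => Real.sqrt (N : ℝ)) atTop atTop :=
      Real.tendsto_sqrt_atTop.comp tendsto_natCast_atTop_atTop
    simpa using (this.inv_tendsto_atTop).const_mul C
  have h3 : ∀ᶠ N : ℕ in atTop, |(∑ n ∈ (Finset.Icc 1 N).filter (fun n : ℕ => (n : ZMod q) = a), lp n) / N -
      Real.exp (-Real.log N) * psiClass a (Real.exp (Real.log N))| ≤ C * (1 / Real.sqrt N) := by
    filter_upwards [eventually_ge_atTop 1] with N hN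
    have hN0 : (0 : ℝ) < N := by exact_mod_cast hN
    rw [Real.exp_neg, Real.exp_log hN0, psiClass, Nat.floor_natCast, Finset.sum_filter, inv_mul_eq_div, ← sub_div,
      abs_div, abs_of_pos hN0, div_le_iff₀ hN0, ← Finset.sum_sub_distrib]
    have hs : C * (1 / Real.sqrt N) * N = C * Real.sqrt N := by
      have := Real.sq_sqrt hN0.le
      have hp := Real.sqrt_pos.mpr hN0
      field_simp
      rw [this]
    rw [hs]
    refine le_trans ?_ (hC N)
    have hψ : Chebyshev.psi (N : ℝ) - Chebyshev.theta N = ∑ n ∈ Finset.Icc 1 N, (vonMangoldt n - lp n) := by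
      rw [Finset.sum_sub_distrib, Chebyshev.psi, Chebyshev.theta, Nat.floor_natCast, Finset.sum_filter]
      rfl
    rw [hψ]
    refine (Finset.abs_sum_le_sum_abs _ _).trans (Finset.sum_le_sum fun n hn => ?_)
    by_cases hna : (n : ZMod q) = a
    · rw [if_pos hna, residueClass, indicator_of_mem (by exact hna), abs_sub_comm,
        abs_of_nonneg (sub_nonneg.mpr (lp_le_vonMangoldt n))]
    · rw [if_neg hna, residueClass, indicator_of_notMem (by exact hna), sub_zero, abs_zero]
      exact sub_nonneg.mpr (lp_le_vonMangoldt n)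
  have h4 := squeeze_zero_norm' (a := fun N : ℕ => C * (1 / Real.sqrt N)) (h3.mono fun N h => (Real.norm_eq_abs _).trans_le h) h2
  have h5 := h4.add h1
  simpa using h5

end Vino

namespace Vino

open Finset

lemma eventually_uniform_of_tendsto_div {g : ℕ → ℝ} {L : ℝ}
    (h : Tendsto (fun N : ℕ => g N / N) atTop (nhds L)) {η : ℝ} (hη : 0 < η) :
    ∀ᶠ Y : ℕ in atTop, ∀ X ≤ Y, |g X - X * L| ≤ η * Y := by
  have h1 : ∀ᶠ X : ℕ in atTop, |g X - X * L| ≤ η * X := by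
    rw [Metric.tendsto_atTop] at h
    obtain ⟨N, hN⟩ := h η hη
    filter_upwards [eventually_ge_atTop N, eventually_gt_atTop 0] with X hX hX0
    have hX1 : (0 : ℝ) < X := by exact_mod_cast hX0
    have := (hN X hX).le
    rw [Real.dist_eq] at this
    have e1 : g X - X * L = X * (g X / X - L) := by field_simp
    rw [e1, abs_mul, abs_of_pos hX1, mul_comm]
    gcongr
  obtain ⟨X0, hX0⟩ := eventually_atTop.mp h1
  obtain ⟨D, hD⟩ := ((range X0).image fun X : ℕ => |g X - X * L|).bddAbove
  filter_upwards [tendsto_natCast_atTop_atTop.eventually_ge_atTop (D / η)] with Y hY X hXY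
  by_cases hX : X0 ≤ X
  · refine (hX0 X hX).trans ?_
    gcongr
  · have h2 : |g X - X * L| ≤ D := hD (by
      simp only [coe_image, Set.mem_image]
      exact ⟨X, by simpa using hX, rfl⟩)
    rw [div_le_iff₀ hη] at hY
    linarith

/-- Prime sum in a residue class. -/
noncomputable def thetaClass {q : ℕ} (a : ZMod q) (N : ℕ) : ℝ :=
  ∑ n ∈ (Icc 1 N).filter (fun n : ℕ => (n : ZMod q) = a), lp n

lemma thetaClass_uniform {q : ℕ} [NeZero q] {η : ℝ} (hη : 0 < η) :
    ∀ᶠ Y : ℕ in atTop, ∀ a : ZMod q, IsUnit a → ∀ X ≤ Y,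
      |thetaClass a X - X * (q.totient : ℝ)⁻¹| ≤ η * Y := by
  rw [eventually_all]
  intro a
  by_cases ha : IsUnit a
  · filter_upwards [eventually_uniform_of_tendsto_div (prime_sum_residue_class ha) hη] with Y hY _
    exact hY
  · filter_upwards with Y h
    exact absurd h ha

lemma sum_progression_eq {W c r : ℕ} (hW : 0 < W) (hc : 1 ≤ c) (hr : r < 2) (v : ℕ) :
    ∑ n ∈ (range v).filter (fun n => n % 2 = r), lp (W * n + c) =
      thetaClass ((W * r + c : ℕ) : ZMod (2 * W)) (W * v + c - 1) -
      thetaClass ((W * r + c : ℕ) : ZMod (2 * W)) (c - 1) := by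
  have hsub : (Icc 1 (c - 1)).filter (fun n : ℕ => (n : ZMod (2 * W)) = ((W * r + c : ℕ) : ZMod (2 * W))) ⊆
    (Icc 1 (W * v + c - 1)).filter (fun n : ℕ => (n : ZMod (2 * W)) = ((W * r + c : ℕ) : ZMod (2 * W))) := by
    apply filter_subset_filter
    apply Icc_subset_Icc_right
    have := Nat.zero_le (W * v)
    omega
  rw [thetaClass, thetaClass, ← sum_sdiff hsub, add_sub_cancel_right]
  apply sum_nbij (fun n => W * n + c)
  · intro n hn
    simp only [mem_filter, mem_range] at hn
    have h1 : W * (n + 1) ≤ W * v := Nat.mul_le_mul_left _ hn.1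
    rw [mul_add] at h1
    refine Finset.mem_sdiff.mpr ⟨mem_filter.mpr ⟨mem_Icc.mpr ⟨by omega, by omega⟩, ?_⟩, fun h => by
      have := (mem_Icc.mp (mem_filter.mp h).1).2
      omega⟩
    rw [ZMod.natCast_eq_natCast_iff]
    apply Nat.ModEq.add_right
    rw [mul_comm 2 W]
    apply Nat.ModEq.mul_left'
    show n % 2 = r % 2
    rw [hn.2, Nat.mod_eq_of_lt hr]
  · intro x _ y _ hxy
    have : W * x = W * y := by simpa using hxy
    exact Nat.eq_of_mul_eq_mul_left hW this
  · intro k hk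
    simp only [coe_sdiff, coe_filter, mem_Icc, Set.mem_sdiff, Set.mem_ofPred_eq, not_and] at hk
    obtain ⟨⟨⟨hk1, hk2⟩, hk3⟩, hk4⟩ := hk
    have hkc : c ≤ k := by
      by_contra h
      exact hk4 ⟨hk1, by omega⟩ hk3
    rw [ZMod.natCast_eq_natCast_iff] at hk3
    obtain ⟨m, rfl⟩ := Nat.exists_eq_add_of_le' hkc
    have h1 : m ≡ W * r [MOD 2 * W] := Nat.ModEq.add_right_cancel' c hk3
    have h2 : W ∣ m := by
      have h3 : m ≡ W * r [MOD W] := h1.of_mul_left 2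
      rw [Nat.ModEq, Nat.mul_mod_right] at h3
      exact Nat.dvd_of_mod_eq_zero h3
    obtain ⟨n, rfl⟩ := h2
    refine ⟨n, ?_, rfl⟩
    simp only [coe_filter, mem_range, Set.mem_ofPred_eq]
    constructor
    · have : W * n < W * v := by omega
      exact lt_of_mul_lt_mul_left this (Nat.zero_le _)
    · rw [mul_comm 2 W] at h1
      have h4 : n ≡ r [MOD 2] := Nat.ModEq.mul_left_cancel' hW.ne' h1
      rw [Nat.ModEq, Nat.mod_eq_of_lt hr] at h4
      exact h4
  · intro n _
    rfl

/-- The normalised prime weight on the progression `W n + c`. -/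
noncomputable def primeWeight (W c n : ℕ) : ℝ := (W.totient : ℝ) / W * lp (W * n + c)

lemma primeWeight_nonneg (W c n : ℕ) : 0 ≤ primeWeight W c n := by
  have := lp_nonneg (W * n + c)
  unfold primeWeight
  positivity

lemma class_sums {W : ℕ} (hW : 0 < W) (hW2 : Even W) (K : ℕ) {η : ℝ} (hη : 0 < η) :
    ∀ᶠ H : ℕ in atTop, ∀ c, 1 ≤ c → c ≤ K * H → Nat.Coprime c W → ∀ r < 2, ∀ v ≤ H,
      |∑ n ∈ range v, ((if n % 2 = r then primeWeight W c n else 0) - 1 / 2)| ≤ η * H := by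
  have : NeZero (2 * W) := ⟨by omega⟩
  set η' := η / (2 * (W + K)) with hη'
  have hWK : (0 : ℝ) < W + K := by positivity
  have hη'0 : 0 < η' := by positivity
  have h1 := thetaClass_uniform (q := 2 * W) hη'0
  have h2 : Tendsto (fun H : ℕ => (W + K) * H) atTop atTop :=
    tendsto_id.const_mul_atTop' (by omega)
  filter_upwards [h2.eventually h1] with H hH c hc hcK hcop r hr v hv
  have hunit : IsUnit ((W * r + c : ℕ) : ZMod (2 * W)) := by
    rw [ZMod.isUnit_iff_coprime]
    apply Nat.Coprime.mul_right
    · rw [Nat.coprime_comm, Nat.coprime_two_left]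
      have : Odd c := by
        rw [← Nat.coprime_two_right]
        exact hcop.coprime_dvd_right hW2.two_dvd
      rw [Nat.odd_add']
      simp [this, hW2]
    · rw [add_comm]
      simpa using hcop
  have h3 := hH _ hunit (W * v + c - 1) (by
    have : W * v ≤ W * H := Nat.mul_le_mul_left _ hv
    rw [add_mul]; omega)
  have h4 := hH _ hunit (c - 1) (by rw [add_mul]; omega)
  have h5 := sum_progression_eq hW hc hr v
  have hφ : (Nat.totient (2 * W) : ℝ) = 2 * W.totient := by
    rw [Nat.totient_two_mul_of_even hW2]; push_cast; ring
  have hφ0 : (0 : ℝ) < W.totient := by exact_mod_cast Nat.totient_pos.mpr hW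
  have hW0 : (0 : ℝ) < W := by exact_mod_cast hW
  have h6 : ∑ n ∈ range v, ((if n % 2 = r then primeWeight W c n else 0) - 1 / 2) =
      (W.totient : ℝ) / W * (∑ n ∈ (range v).filter (fun n => n % 2 = r), lp (W * n + c) -
        W * v * ((2 * W).totient : ℝ)⁻¹) := by
    rw [sum_sub_distrib, ← sum_filter, mul_sub, mul_sum, hφ]
    simp only [primeWeight, sum_const, card_range, nsmul_eq_mul]
    congr 1
    field_simp
  rw [h6, h5]
  have hratio : (W.totient : ℝ) / W ≤ 1 := by
    rw [div_le_one hW0]; exact_mod_cast Nat.totient_le W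
  have h7 : (((W * v + c - 1 : ℕ) : ℝ)) = W * v + ((c - 1 : ℕ) : ℝ) := by
    rw [Nat.cast_sub (by omega), Nat.cast_sub hc]; push_cast; ring
  rw [abs_mul, abs_of_nonneg (by positivity)]
  rw [h7] at h3
  set t1 := thetaClass ((W * r + c : ℕ) : ZMod (2 * W)) (W * v + c - 1)
  set t2 := thetaClass ((W * r + c : ℕ) : ZMod (2 * W)) (c - 1)
  have h8 : |t1 - t2 - W * v * ((2 * W).totient : ℝ)⁻¹| ≤ η * H := by
    have e1 : t1 - t2 - W * v * ((2 * W).totient : ℝ)⁻¹ =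
      (t1 - (W * v + ((c - 1 : ℕ) : ℝ)) * ((2 * W).totient : ℝ)⁻¹) - (t2 - ((c - 1 : ℕ) : ℝ) * ((2 * W).totient : ℝ)⁻¹) := by ring
    rw [e1]
    refine (abs_sub _ _).trans ((add_le_add h3 h4).trans_eq ?_)
    rw [hη']
    push_cast
    field_simp
    ring
  calc _ ≤ 1 * |t1 - t2 - W * v * ((2 * W).totient : ℝ)⁻¹| := by gcongr
    _ ≤ _ := by rw [one_mul]; exact h8

end Vino

namespace Vino

open Finset

lemma norm_expS_le_of_partial_sums {H : ℕ} {a : ℕ → ℝ} {E : ℝ}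
    (hE : ∀ v ≤ H, |∑ n ∈ range v, a n| ≤ E) (t : ℝ) :
    ‖expS H a t‖ ≤ E * (1 + 2 * Real.pi * H * |t|) := by
  have hE0 : 0 ≤ E := (abs_nonneg _).trans (hE 0 (Nat.zero_le _))
  have hsum : ∀ v, ∑ i ∈ range v, (a i : ℂ) = ((∑ i ∈ range v, a i : ℝ) : ℂ) := fun v => by push_cast; rfl
  have h1 := Finset.sum_range_by_parts (fun i : ℕ => ee (i * t)) (fun i => (a i : ℂ)) H
  have h2 : expS H a t = ∑ i ∈ range H, ee (i * t) • (a i : ℂ) := by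
    rw [expS]
    exact sum_congr rfl fun i _ => by rw [smul_eq_mul, mul_comm]
  rw [h2, h1]
  refine (norm_sub_le _ _).trans ?_
  rw [mul_add, mul_one]
  apply add_le_add
  · rw [smul_eq_mul, norm_mul, norm_ee, one_mul, hsum, Complex.norm_real]
    exact hE H le_rfl
  · refine (norm_sum_le _ _).trans ?_
    have h3 : ∀ i ∈ range (H - 1), ‖(ee ((i + 1 : ℕ) * t) - ee (i * t)) • ∑ j ∈ range (i + 1), (a j : ℂ)‖ ≤
        2 * Real.pi * |t| * E := by
      intro i hi
      rw [smul_eq_mul, norm_mul, hsum, Complex.norm_real]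
      have h4 : ee ((i + 1 : ℕ) * t) - ee (i * t) = ee (i * t) * (ee t - 1) := by
        have : ((i + 1 : ℕ) : ℝ) * t = i * t + t := by push_cast; ring
        rw [this, ee_add]
        ring
      rw [h4, norm_mul, norm_ee, one_mul]
      apply mul_le_mul (norm_ee_sub_one_le t) (hE _ (by have := mem_range.mp hi; omega)) (abs_nonneg _)
      have := Real.pi_pos
      positivity
    refine (sum_le_sum h3).trans ?_
    rw [sum_const, card_range, nsmul_eq_mul]
    have : ((H - 1 : ℕ) : ℝ) ≤ H := by exact_mod_cast Nat.sub_le H 1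
    have hp := Real.pi_pos
    calc ((H - 1 : ℕ) : ℝ) * (2 * Real.pi * |t| * E) ≤ H * (2 * Real.pi * |t| * E) := by gcongr
      _ = _ := by ring

/-- Equidistribution of a weight in both parity classes. -/
def ParityUniform (H : ℕ) (f : ℕ → ℝ) (η : ℝ) : Prop :=
  ∀ r < 2, ∀ v ≤ H, |∑ n ∈ range v, ((if n % 2 = r then f n else 0) - 1 / 2)| ≤ η * H

lemma ParityUniform.near_zero {H : ℕ} {f : ℕ → ℝ} {η : ℝ} (h : ParityUniform H f η) (t : ℝ) :
    ‖expS H f t - geo H t‖ ≤ 2 * (η * H * (1 + 2 * Real.pi * H * |t|)) := by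
  have h1 : expS H f t - geo H t = expS H (fun n => (if n % 2 = 0 then f n else 0) - 1 / 2) t +
      expS H (fun n => (if n % 2 = 1 then f n else 0) - 1 / 2) t := by
    simp only [expS, geo]
    rw [← sum_sub_distrib, ← sum_add_distrib]
    apply sum_congr rfl
    intro n _
    rcases Nat.mod_two_eq_zero_or_one n with h0 | h0 <;> rw [h0] <;> norm_num <;> ring
  rw [h1, two_mul]
  exact (norm_add_le _ _).trans (add_le_add (norm_expS_le_of_partial_sums (h 0 (by norm_num)) t)
    (norm_expS_le_of_partial_sums (h 1 (by norm_num)) t))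

lemma ee_nat_half (n : ℕ) : ee (n * (1 / 2)) = if n % 2 = 0 then 1 else -1 := by
  have h2 : ee (1 / 2) = -1 := by
    rw [ee]
    have : 2 * (Real.pi : ℂ) * Complex.I * ((1 / 2 : ℝ) : ℂ) = Real.pi * Complex.I := by push_cast; ring
    convert Complex.exp_pi_mul_I using 2
    push_cast
    ring
  rw [ee_nat_mul, h2]
  rcases Nat.even_or_odd n with hn | hn
  · rw [hn.neg_one_pow, if_pos (Nat.even_iff.mp hn)]
  · rw [hn.neg_one_pow, if_neg (by rw [Nat.odd_iff.mp hn]; norm_num)]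

lemma ParityUniform.near_half {H : ℕ} {f : ℕ → ℝ} {η : ℝ} (h : ParityUniform H f η) (s : ℝ) :
    ‖expS H f (1 / 2 + s)‖ ≤ 2 * (η * H * (1 + 2 * Real.pi * H * |s|)) := by
  have h1 : expS H f (1 / 2 + s) = expS H (fun n => (if n % 2 = 0 then f n else 0) - 1 / 2) s -
      expS H (fun n => (if n % 2 = 1 then f n else 0) - 1 / 2) s := by
    simp only [expS]
    rw [← sum_sub_distrib]
    apply sum_congr rfl
    intro n _
    rw [mul_add, ee_add, ee_nat_half]
    rcases Nat.mod_two_eq_zero_or_one n with h0 | h0 <;> rw [h0] <;> norm_num <;> ring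
  rw [h1, two_mul]
  exact (norm_sub_le _ _).trans (add_le_add (norm_expS_le_of_partial_sums (h 0 (by norm_num)) s)
    (norm_expS_le_of_partial_sums (h 1 (by norm_num)) s))

lemma ParityUniform.sum_le {H : ℕ} {f : ℕ → ℝ} {η : ℝ} (h : ParityUniform H f η) :
    ∑ n ∈ range H, f n ≤ (1 + 2 * η) * H := by
  have h0 := (abs_le.mp (h 0 (by norm_num) H le_rfl)).2
  have h1 := (abs_le.mp (h 1 (by norm_num) H le_rfl)).2
  have h2 := add_le_add h0 h1
  rw [← sum_add_distrib] at h2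
  have h3 : ∑ n ∈ range H, (((if n % 2 = 0 then f n else 0) - 1 / 2) + ((if n % 2 = 1 then f n else 0) - 1 / 2)) =
      ∑ n ∈ range H, f n - H := by
    rw [← mul_one (H : ℝ), ← nsmul_eq_mul, ← card_range H, ← sum_const, card_range, ← sum_sub_distrib]
    apply sum_congr rfl
    intro n _
    rcases Nat.mod_two_eq_zero_or_one n with h0 | h0 <;> rw [h0] <;> norm_num <;> ring
  rw [h3] at h2
  linarith

lemma primeWeight_sieveWeight {W : ℕ} (hW : 0 < W) (hW2 : Even W) (K : ℕ) {η : ℝ} (hη : 0 < η) :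
    ∀ᶠ H : ℕ in atTop, ∀ c, H < c → c ≤ K * H → Nat.Coprime c W →
      SieveWeight W c H (primeWeight W c) ∧ ParityUniform H (primeWeight W c) η := by
  have hlog : ∀ᶠ H : ℕ in atTop, Real.log ((W : ℝ) + K) ≤ 0.0005 * Real.log H := by
    have h1 : Tendsto (fun H : ℕ => 0.0005 * Real.log (H : ℝ)) atTop atTop :=
      (Real.tendsto_log_atTop.comp tendsto_natCast_atTop_atTop).const_mul_atTop (by norm_num)
    exact h1.eventually_ge_atTop _
  filter_upwards [class_sums hW hW2 K hη, class_sums hW hW2 K (show (0 : ℝ) < 0.0001 by norm_num), hlog,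
    eventually_ge_atTop 2] with H hH hH' hl hH2 c hc hcK hcop
  have hu : ParityUniform H (primeWeight W c) 0.0001 := fun r hr v hv => hH' c (by omega) hcK hcop r hr v hv
  refine ⟨⟨?_, ?_⟩, fun r hr v hv => hH c (by omega) hcK hcop r hr v hv⟩
  · intro n hn hf d hd1 hdH
    have hp : (W * n + c).Prime := by
      by_contra h
      apply hf
      rw [primeWeight, lp, if_neg h, mul_zero]
    rw [Nat.Prime.coprime_iff_not_dvd hp]
    intro hdvd
    have := Nat.le_of_dvd (by omega) hdvd
    have := Nat.zero_le (W * n)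
    omega
  · have hH0 : (0 : ℝ) < H := by exact_mod_cast (show 0 < H by omega)
    have hW0 : (0 : ℝ) < W := by exact_mod_cast hW
    have hlH : 0 ≤ Real.log H := Real.log_natCast_nonneg H
    have h1 : ∀ n ∈ range H, primeWeight W c n ^ 2 ≤
        (W.totient : ℝ) / W * (1.0005 * Real.log H) * primeWeight W c n := by
      intro n hn
      have hn' := mem_range.mp hn
      rw [sq]
      apply mul_le_mul_of_nonneg_right _ (primeWeight_nonneg W c n)
      rw [primeWeight]
      apply mul_le_mul_of_nonneg_left _ (by positivity)
      refine (lp_le_log _).trans ?_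
      have h2 : ((W * n + c : ℕ) : ℝ) ≤ (W + K) * H := by
        have : W * n + c ≤ (W + K) * H := by
          have := Nat.mul_le_mul_left W hn'.le
          rw [add_mul]; omega
        exact_mod_cast this
      have h3 : (0 : ℝ) < ((W * n + c : ℕ) : ℝ) := by exact_mod_cast (by omega)
      refine (Real.log_le_log h3 h2).trans ?_
      rw [Real.log_mul (by positivity) hH0.ne']
      linarith
    refine (sum_le_sum h1).trans ?_
    rw [← mul_sum]
    have h4 := hu.sum_le
    calc _ ≤ (W.totient : ℝ) / W * (1.0005 * Real.log H) * ((1 + 2 * 0.0001) * H) := by gcongr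
      _ = (W.totient : ℝ) / W * H * Real.log H * (1.0005 * (1 + 2 * 0.0001)) := by ring
      _ ≤ (W.totient : ℝ) / W * H * Real.log H * 1.001 := by gcongr; norm_num
      _ = _ := by ring

end Vino

namespace Vino

open Finset

/-- Weighted number of representations as a sum of three integers below `H`. -/
noncomputable def triSum (H : ℕ) (a b c : ℕ → ℝ) (M : ℕ) : ℝ :=
  ∑ x ∈ range H, ∑ y ∈ range H, ∑ z ∈ range H, if x + y + z = M then a x * b y * c z else 0

lemma triSum_fourier {H M : ℕ} (hH : 0 < H) (hM : M < 3 * H) (a b c : ℕ → ℝ) :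
    ∑ j ∈ range (3 * H), expS H a ((j : ℝ) / (3 * H : ℕ)) * expS H b ((j : ℝ) / (3 * H : ℕ)) *
      expS H c ((j : ℝ) / (3 * H : ℕ)) * ee (-(j * M / (3 * H : ℕ))) = ((3 * H : ℕ) : ℂ) * triSum H a b c M := by
  have h1 : ∀ j ∈ range (3 * H), expS H a ((j : ℝ) / (3 * H : ℕ)) * expS H b ((j : ℝ) / (3 * H : ℕ)) *
      expS H c ((j : ℝ) / (3 * H : ℕ)) * ee (-(j * M / (3 * H : ℕ))) =
      ∑ x ∈ range H, ∑ y ∈ range H, ∑ z ∈ range H, ((a x * b y * c z : ℝ) : ℂ) *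
        ee (j * (((x + y + z : ℕ) - M : ℤ) / (3 * H : ℕ))) := by
    intro j _
    simp only [expS]
    rw [sum_mul_sum, sum_mul, sum_mul]
    refine sum_congr rfl fun x _ => ?_
    rw [sum_mul, sum_mul]
    refine sum_congr rfl fun y _ => ?_
    rw [mul_sum, sum_mul]
    refine sum_congr rfl fun z _ => ?_
    have : (j : ℝ) * (((x + y + z : ℕ) - M : ℤ) / (3 * H : ℕ)) =
      x * (j / (3 * H : ℕ)) + y * (j / (3 * H : ℕ)) + z * (j / (3 * H : ℕ)) + -(j * M / (3 * H : ℕ)) := by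
      push_cast; ring
    rw [this, ee_add, ee_add, ee_add]
    push_cast
    ring
  rw [sum_congr rfl h1, sum_comm, triSum]
  push_cast
  rw [mul_sum]
  refine sum_congr rfl fun x hx => ?_
  rw [sum_comm, mul_sum]
  refine sum_congr rfl fun y hy => ?_
  rw [sum_comm, mul_sum]
  refine sum_congr rfl fun z hz => ?_
  have hx := mem_range.mp hx
  have hy := mem_range.mp hy
  have hz := mem_range.mp hz
  have h3 := sum_ee_div (P := 3 * H) (by omega) ((x + y + z : ℕ) - M : ℤ)
  have hiff : ((3 * H : ℕ) : ℤ) ∣ ((x + y + z : ℕ) - M : ℤ) ↔ x + y + z = M := by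
    constructor
    · intro h
      have := Int.eq_zero_of_abs_lt_dvd h (by rw [abs_lt]; constructor <;> omega)
      omega
    · intro h
      rw [h]
      simp
  rw [← mul_sum]
  push_cast at h3 ⊢
  rw [h3]
  push_cast at hiff
  simp only [hiff]
  split_ifs
  · push_cast; ring
  · simp

lemma exists_of_triSum_ne_zero {H : ℕ} {a b c : ℕ → ℝ} {M : ℕ} (h : triSum H a b c M ≠ 0) :
    ∃ x y z, x < H ∧ y < H ∧ z < H ∧ x + y + z = M ∧ a x ≠ 0 ∧ b y ≠ 0 ∧ c z ≠ 0 := by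
  obtain ⟨x, hx, h1⟩ := exists_ne_zero_of_sum_ne_zero h
  obtain ⟨y, hy, h2⟩ := exists_ne_zero_of_sum_ne_zero h1
  obtain ⟨z, hz, h3⟩ := exists_ne_zero_of_sum_ne_zero h2
  rw [mem_range] at hx hy hz
  split_ifs at h3 with h4
  · exact ⟨x, y, z, hx, hy, hz, h4, left_ne_zero_of_mul (left_ne_zero_of_mul h3),
      right_ne_zero_of_mul (left_ne_zero_of_mul h3), right_ne_zero_of_mul h3⟩
  · exact absurd rfl h3

lemma triSum_one_row {H h x : ℕ} (hx : x < H) (hh : h < H) :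
    (if x ≤ h then (H : ℝ) - h - 1 + x else H + h + 1 - x) ≤
      ∑ y ∈ range H, ∑ z ∈ range H, if x + y + z = H + h then (1 : ℝ) * 1 * 1 else 0 := by
  have h1 : ∀ y, y < H → x + y ≤ H + h → h < x + y → ∑ z ∈ range H, (if x + y + z = H + h then (1 : ℝ) * 1 * 1 else 0) = 1 := by
    intro y hy h2 h3
    rw [sum_eq_single_of_mem (H + h - (x + y)) (by rw [mem_range]; omega)]
    · rw [if_pos (by omega)]; norm_num
    · intro z _ hz
      rw [if_neg (by omega)]
  have h0 : ∀ y, 0 ≤ ∑ z ∈ range H, (if x + y + z = H + h then (1 : ℝ) * 1 * 1 else 0) := by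
    intro y
    apply sum_nonneg
    intro z _
    split_ifs <;> norm_num
  split_ifs with hxh
  · have hsub : Ico (h - x + 1) H ⊆ range H := by
      intro y hy
      rw [mem_Ico] at hy
      exact mem_range.mpr hy.2
    refine le_trans ?_ (sum_le_sum_of_subset_of_nonneg hsub fun y _ _ => h0 y)
    rw [sum_congr rfl fun y hy => h1 y (mem_Ico.mp hy).2 (by have := mem_Ico.mp hy; omega) (by have := mem_Ico.mp hy; omega)]
    rw [sum_const, Nat.card_Ico, nsmul_eq_mul, mul_one, Nat.cast_sub (by omega)]
    push_cast [Nat.cast_sub hxh]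
    linarith
  · have hsub : range (H + h - x + 1) ⊆ range H := range_subset_range.mpr (by omega)
    refine le_trans ?_ (sum_le_sum_of_subset_of_nonneg hsub fun y _ _ => h0 y)
    rw [sum_congr rfl fun y hy => h1 y (by have := mem_range.mp hy; omega) (by have := mem_range.mp hy; omega) (by have := mem_range.mp hy; omega)]
    rw [sum_const, card_range, nsmul_eq_mul, mul_one]
    push_cast [Nat.cast_sub (show x ≤ H + h by omega)]
    linarith

lemma sum_range_cast (n : ℕ) : ∑ i ∈ range n, (i : ℝ) = n * (n - 1) / 2 := by
  induction n with
  | zero => simp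
  | succ n ih => rw [sum_range_succ, ih]; push_cast; ring

lemma triSum_one_ge {H M : ℕ} (hH : 10000 ≤ H) (h1 : 3 * H ≤ 2 * M) (h2 : 2 * M ≤ 3 * H + 6) :
    0.74 * (H : ℝ) ^ 2 ≤ triSum H (fun _ => 1) (fun _ => 1) (fun _ => 1) M := by
  obtain ⟨h, rfl⟩ := Nat.exists_eq_add_of_le (show H ≤ M by omega)
  have hh : h < H := by omega
  have h3 : ∑ x ∈ range H, (if x ≤ h then (H : ℝ) - h - 1 + x else H + h + 1 - x) ≤
      triSum H (fun _ => 1) (fun _ => 1) (fun _ => 1) (H + h) :=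
    sum_le_sum fun x hx => triSum_one_row (mem_range.mp hx) hh
  refine le_trans ?_ h3
  rw [← sum_range_add_sum_Ico _ (show h + 1 ≤ H by omega), sum_Ico_eq_sum_range]
  have e1 : ∑ x ∈ range (h + 1), (if x ≤ h then (H : ℝ) - h - 1 + x else H + h + 1 - x) =
      (h + 1) * (H - h - 1) + (h + 1) * h / 2 := by
    rw [sum_congr rfl fun x hx => if_pos (by have := mem_range.mp hx; omega), sum_add_distrib, sum_range_cast, sum_const,
      card_range, nsmul_eq_mul]
    push_cast
    ring
  have e2 : ∑ i ∈ range (H - (h + 1)), (if h + 1 + i ≤ h then (H : ℝ) - h - 1 + (h + 1 + i : ℕ) else H + h + 1 - (h + 1 + i : ℕ)) =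
      (H - h - 1) * H - (H - h - 1) * (H - h - 2) / 2 := by
    have : ∀ i ∈ range (H - (h + 1)), (if h + 1 + i ≤ h then (H : ℝ) - h - 1 + (h + 1 + i : ℕ) else H + h + 1 - (h + 1 + i : ℕ)) =
        H - (i : ℝ) := by
      intro i _
      rw [if_neg (by omega)]
      push_cast
      ring
    rw [sum_congr rfl this, sum_sub_distrib, sum_range_cast, sum_const, card_range, nsmul_eq_mul,
      Nat.cast_sub (by omega)]
    push_cast
    ring
  rw [e1, e2]
  have a1 : (H : ℝ) ≤ 2 * h := by exact_mod_cast (by omega)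
  have a2 : 2 * (h : ℝ) ≤ H + 6 := by exact_mod_cast (by omega)
  have a3 : (10000 : ℝ) ≤ H := by exact_mod_cast hH
  nlinarith

/-- Frequencies away from the integers. -/
def farFreq (H : ℕ) : Finset ℕ := (range (3 * H)).filter fun j => 1500 < j ∧ j + 1500 < 3 * H

lemma geo_far_le {H j : ℕ} (hj : j ∈ farFreq H) : ‖geo H ((j : ℝ) / (3 * H : ℕ))‖ ≤ 0.001 * H := by
  simp only [farFreq, mem_filter, mem_range] at hj
  have hP : 0 < 3 * H := by omega
  have hP0 : (0 : ℝ) < (3 * H : ℕ) := by exact_mod_cast hP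
  have h1 : (1500 : ℝ) ≤ |((j : ℤ) : ℝ)| := by
    rw [Int.cast_natCast, Nat.abs_cast]; exact_mod_cast hj.2.1.le
  have h2 : |((j : ℤ) : ℝ)| ≤ (3 * H : ℕ) - 1500 := by
    rw [Int.cast_natCast, Nat.abs_cast, le_sub_iff_add_le]; exact_mod_cast hj.2.2.le
  have h3 := nn_div_ge hP (j : ℤ) h1 h2
  rw [Int.cast_natCast] at h3
  refine (norm_geo_le_inv H (by positivity) h3).trans (le_of_eq ?_)
  push_cast
  field_simp
  ring

lemma geo_sq_le {H j : ℕ} (h0 : 0 < j) (h1 : j < 3 * H) :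
    ‖geo H ((j : ℝ) / (3 * H : ℕ))‖ ^ 2 ≤ ((3 * H : ℕ) : ℝ) ^ 2 / 4 * (((j : ℝ) ^ 2)⁻¹ + (((3 * H - j : ℕ) : ℝ) ^ 2)⁻¹) := by
  have hP : 0 < 3 * H := by omega
  have hP0 : (0 : ℝ) < (3 * H : ℕ) := by exact_mod_cast hP
  have hk : ∀ L : ℕ, 0 < L → L ≤ j → j + L ≤ 3 * H →
      ‖geo H ((j : ℝ) / (3 * H : ℕ))‖ ^ 2 ≤ ((3 * H : ℕ) : ℝ) ^ 2 / 4 * ((L : ℝ) ^ 2)⁻¹ := by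
    intro L hL0 hLj hjL
    have hL : (0 : ℝ) < L := by exact_mod_cast hL0
    have h3 := nn_div_ge (L := (L : ℝ)) hP (j : ℤ)
      (by rw [Int.cast_natCast, Nat.abs_cast]; exact_mod_cast hLj)
      (by rw [Int.cast_natCast, Nat.abs_cast, le_sub_iff_add_le]; exact_mod_cast hjL)
    rw [Int.cast_natCast] at h3
    have h4 := norm_geo_le_inv H (by positivity) h3
    refine (pow_le_pow_left₀ (norm_nonneg _) h4 2).trans (le_of_eq ?_)
    field_simp
    norm_num
  rw [mul_add]
  rcases le_total (2 * j) (3 * H) with h | h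
  · have := hk j h0 le_rfl (by omega)
    refine this.trans (le_add_of_nonneg_right (by positivity))
  · have := hk (3 * H - j) (by omega) (by omega) (by omega)
    refine this.trans (le_add_of_nonneg_left (by positivity))

lemma geo_far_sq_sum {H : ℕ} (hH : 1000 ≤ H) :
    ∑ j ∈ farFreq H, ‖geo H ((j : ℝ) / (3 * H : ℕ))‖ ^ 2 ≤ 0.003 * (H : ℝ) ^ 2 := by
  have h1 : ∀ j ∈ farFreq H, ‖geo H ((j : ℝ) / (3 * H : ℕ))‖ ^ 2 ≤
      ((3 * H : ℕ) : ℝ) ^ 2 / 4 * (((j : ℝ) ^ 2)⁻¹ + (((3 * H - j : ℕ) : ℝ) ^ 2)⁻¹) := by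
    intro j hj
    simp only [farFreq, mem_filter, mem_range] at hj
    exact geo_sq_le (by omega) hj.1
  have h2 : ∑ j ∈ farFreq H, ((j : ℝ) ^ 2)⁻¹ ≤ 1 / 1500 := by
    have hs : farFreq H ⊆ Ioc 1500 (3 * H) := by
      intro j hj
      simp only [farFreq, mem_filter, mem_range] at hj
      rw [mem_Ioc]; omega
    refine (sum_le_sum_of_subset_of_nonneg hs fun i _ _ => by positivity).trans ?_
    refine (sum_Ioc_inv_sq_le_sub (by norm_num) (by omega)).trans ?_
    have : (0 : ℝ) ≤ ((3 * H : ℕ) : ℝ)⁻¹ := by positivity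
    push_cast at *
    linarith
  have h3 : ∑ j ∈ farFreq H, (((3 * H - j : ℕ) : ℝ) ^ 2)⁻¹ = ∑ j ∈ farFreq H, ((j : ℝ) ^ 2)⁻¹ := by
    apply sum_nbij' (fun j => 3 * H - j) (fun j => 3 * H - j)
    all_goals
      intro j hj
      simp only [farFreq, mem_filter, mem_range] at hj ⊢
      try omega
  refine (sum_le_sum h1).trans ?_
  rw [← mul_sum, sum_add_distrib, h3]
  have hp : (0 : ℝ) ≤ ((3 * H : ℕ) : ℝ) ^ 2 / 4 := by positivity
  calc _ ≤ ((3 * H : ℕ) : ℝ) ^ 2 / 4 * (1 / 1500 + 1 / 1500) := by gcongr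
    _ = _ := by push_cast; ring

end Vino

namespace Vino

open Finset

lemma expS_one (H : ℕ) (t : ℝ) : expS H (fun _ => 1) t = geo H t := by
  simp [expS, geo]

/-- Frequencies near an integer. -/
def nearFreq (H : ℕ) : Finset ℕ := (range (3 * H)).filter fun j => ¬ (1500 < j ∧ j + 1500 < 3 * H)

lemma sum_near_add_far {M : Type*} [AddCommMonoid M] (H : ℕ) (g : ℕ → M) :
    ∑ j ∈ farFreq H, g j + ∑ j ∈ nearFreq H, g j = ∑ j ∈ range (3 * H), g j :=
  sum_filter_add_sum_filter_not _ _ _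

lemma card_nearFreq_le (H : ℕ) : #(nearFreq H) ≤ 3001 := by
  have h : nearFreq H ⊆ range 1501 ∪ Ico (3 * H - 1500) (3 * H) := by
    intro j hj
    simp only [nearFreq, mem_filter, mem_range] at hj
    simp only [mem_union, mem_range, mem_Ico]
    omega
  refine (card_le_card h).trans ((card_union_le _ _).trans ?_)
  rw [card_range, Nat.card_Ico]
  omega

lemma ParityUniform.near_le {H : ℕ} {f : ℕ → ℝ} {η : ℝ} (h : ParityUniform H f η) (hη : 0 < η)
    (hη1 : η ≤ 0.000000000001) {j : ℕ} (hj : j ∈ nearFreq H) :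
    ‖expS H f ((j : ℝ) / (3 * H : ℕ)) - geo H ((j : ℝ) / (3 * H : ℕ))‖ ≤ 0.00000001 * H := by
  simp only [nearFreq, mem_filter, mem_range] at hj
  have hH : 0 < H := by omega
  have hH0 : (0 : ℝ) < H := by exact_mod_cast hH
  have key : ∀ t : ℝ, |t| ≤ 500 / H → ‖expS H f t - geo H t‖ ≤ 0.00000001 * H := by
    intro t ht
    refine (h.near_zero t).trans ?_
    have h1 : 2 * Real.pi * H * |t| ≤ 3150 := by
      have hp := Real.pi_lt_d2
      calc 2 * Real.pi * H * |t| ≤ 2 * 3.15 * H * (500 / H) := by gcongr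
        _ = 3150 := by field_simp; norm_num
    calc 2 * (η * H * (1 + 2 * Real.pi * H * |t|)) ≤ 2 * (0.000000000001 * H * (1 + 3150)) := by gcongr
      _ ≤ 0.00000001 * H := by nlinarith
  by_cases hlow : j ≤ 1500
  · apply key
    rw [abs_of_nonneg (by positivity), div_le_div_iff₀ (by positivity) hH0]
    have : (j : ℝ) ≤ 1500 := by exact_mod_cast hlow
    push_cast
    nlinarith
  · have h1 := key ((j : ℝ) / (3 * H : ℕ) - 1) (by
      have h2 : (j : ℝ) ≤ 3 * H := by exact_mod_cast hj.1.le
      have h3 : (3 * H : ℝ) ≤ j + 1500 := by exact_mod_cast (by omega)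
      have e : (j : ℝ) / (3 * H : ℕ) - 1 = (j - 3 * H) / (3 * H) := by push_cast; field_simp
      rw [e, abs_div, abs_of_nonneg (show (0 : ℝ) ≤ 3 * H by positivity),
        div_le_div_iff₀ (by positivity) hH0]
      have : |(j : ℝ) - 3 * H| ≤ 1500 := by rw [abs_le]; constructor <;> linarith
      nlinarith)
    have e1 := expS_add_int H f ((j : ℝ) / (3 * H : ℕ) - 1) 1
    have e2 := geo_add_int H ((j : ℝ) / (3 * H : ℕ) - 1) 1
    rw [Int.cast_one, sub_add_cancel] at e1 e2
    rwa [e1, e2]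

lemma ParityUniform.half_le {H : ℕ} {f : ℕ → ℝ} {η : ℝ} (h : ParityUniform H f η)
    (hη1 : η ≤ 0.000000000001) (hH : 0 < H) {j : ℕ} (hj : |2 * (j : ℝ) - 3 * H| ≤ 1500) :
    ‖expS H f ((j : ℝ) / (3 * H : ℕ))‖ ≤ 0.00000001 * H := by
  have hH0 : (0 : ℝ) < H := by exact_mod_cast hH
  have e : (j : ℝ) / (3 * H : ℕ) = 1 / 2 + (2 * j - 3 * H) / (6 * H) := by
    push_cast; field_simp; ring
  rw [e]
  refine (h.near_half _).trans ?_
  have h2 : |(2 * (j : ℝ) - 3 * H) / (6 * H)| ≤ 500 / H := by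
    rw [abs_div, abs_of_nonneg (show (0 : ℝ) ≤ 6 * H by positivity),
        div_le_div_iff₀ (by positivity) hH0]
    nlinarith
  have h1 : 2 * Real.pi * H * |(2 * (j : ℝ) - 3 * H) / (6 * H)| ≤ 3150 := by
    have hp := Real.pi_lt_d2
    calc 2 * Real.pi * H * |(2 * (j : ℝ) - 3 * H) / (6 * H)| ≤ 2 * 3.15 * H * (500 / H) := by gcongr
      _ = 3150 := by field_simp; norm_num
  calc 2 * (η * H * (1 + 2 * Real.pi * H * |(2 * (j : ℝ) - 3 * H) / (6 * H)|)) ≤ 2 * (0.000000000001 * H * (1 + 3150)) := by gcongr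
    _ ≤ 0.00000001 * H := by nlinarith

lemma ParityUniform.zero_ge {H : ℕ} {f : ℕ → ℝ} {η : ℝ} (h : ParityUniform H f η) (hη : 0 < η)
    (hη1 : η ≤ 0.000000000001) (hH : 0 < H) : 0.9999 * H ≤ ‖expS H f 0‖ := by
  have hH0 : (0 : ℝ) < H := by exact_mod_cast hH
  have h1 := h.near_le hη hη1 (j := 0) (by simp [nearFreq, hH])
  rw [Nat.cast_zero, zero_div, geo_zero] at h1
  have h2 := norm_sub_norm_le (H : ℂ) (expS H f 0)
  rw [norm_sub_rev, Complex.norm_natCast] at h2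
  linarith

/-- Bounds for the exponential sum of a weight which resembles the constant weight. -/
structure Transferred (H : ℕ) (B₀ : ℝ) (f : ℕ → ℝ) : Prop where
  near : ∀ j ∈ nearFreq H,
    ‖expS H f ((j : ℝ) / (3 * H : ℕ)) - geo H ((j : ℝ) / (3 * H : ℕ))‖ ≤ 0.00000001 * H
  far : ∀ j ∈ farFreq H, ‖expS H f ((j : ℝ) / (3 * H : ℕ))‖ ≤ 0.714 * H
  square : ∀ L ⊆ farFreq H, (#L : ℝ) ≤ B₀ →
    ∑ j ∈ L, ‖expS H f ((j : ℝ) / (3 * H : ℕ))‖ ^ 2 ≤ 3.04 * (H : ℝ) ^ 2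

lemma geo_near_energy {H : ℕ} (hH : 1000 ≤ H) :
    2.997 * (H : ℝ) ^ 2 ≤ ∑ j ∈ nearFreq H, ‖geo H ((j : ℝ) / (3 * H : ℕ))‖ ^ 2 := by
  have h1 := sum_near_add_far H (fun j => ‖geo H ((j : ℝ) / (3 * H : ℕ))‖ ^ 2)
  have h2 := parseval_expS (H := H) (P := 3 * H) (by omega) (by omega) (fun _ => 1)
  simp only [expS_one] at h2
  rw [h2] at h1
  have h3 := geo_far_sq_sum hH
  simp only [one_pow, sum_const, card_range, nsmul_eq_mul, mul_one] at h1
  push_cast at *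
  nlinarith

lemma near_energy {H : ℕ} (hH : 1000 ≤ H) {f : ℕ → ℝ} (h : ∀ j ∈ nearFreq H,
    ‖expS H f ((j : ℝ) / (3 * H : ℕ)) - geo H ((j : ℝ) / (3 * H : ℕ))‖ ≤ 0.00000001 * H) :
    2.9969 * (H : ℝ) ^ 2 ≤ ∑ j ∈ nearFreq H, ‖expS H f ((j : ℝ) / (3 * H : ℕ))‖ ^ 2 := by
  have h1 : ∀ j ∈ nearFreq H, ‖geo H ((j : ℝ) / (3 * H : ℕ))‖ ^ 2 - 0.00000002 * (H : ℝ) ^ 2 ≤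
      ‖expS H f ((j : ℝ) / (3 * H : ℕ))‖ ^ 2 := by
    intro j hj
    have h2 := h j hj
    have h3 := norm_sub_norm_le (geo H ((j : ℝ) / (3 * H : ℕ))) (expS H f ((j : ℝ) / (3 * H : ℕ)))
    rw [norm_sub_rev] at h3
    have h4 := norm_geo_le H ((j : ℝ) / (3 * H : ℕ))
    have h5 := norm_nonneg (geo H ((j : ℝ) / (3 * H : ℕ)))
    have h6 := norm_nonneg (expS H f ((j : ℝ) / (3 * H : ℕ)))
    generalize ‖geo H ((j : ℝ) / (3 * H : ℕ))‖ = g at *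
    generalize ‖expS H f ((j : ℝ) / (3 * H : ℕ))‖ = e at *
    have h7 : g ≤ e + 0.00000001 * H := by linarith
    rcases le_total g (0.00000001 * H) with h8 | h8
    · nlinarith [sq_nonneg e]
    · have : (g - 0.00000001 * H) ^ 2 ≤ e ^ 2 := pow_le_pow_left₀ (by linarith) (by linarith) 2
      nlinarith [mul_nonneg (Nat.cast_nonneg (α := ℝ) H) (sub_nonneg.mpr h4), sq_nonneg (0.00000001 * H : ℝ)]
  have h2 := sum_le_sum h1
  rw [sum_sub_distrib, sum_const, nsmul_eq_mul] at h2
  have h3 := geo_near_energy hH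
  have h4 : (#(nearFreq H) : ℝ) ≤ 3001 := by exact_mod_cast card_nearFreq_le H
  have h5 : (#(nearFreq H) : ℝ) * (0.00000002 * (H : ℝ) ^ 2) ≤ 3001 * (0.00000002 * (H : ℝ) ^ 2) := by gcongr
  nlinarith [sq_nonneg (H : ℝ)]

lemma exists_transferred (B₀ : ℝ) (hB₀ : 0 < B₀) : ∃ w₀, ∀ w ≥ w₀, ∀ᶠ H : ℕ in atTop, ∀ f b,
    SieveWeight (primorial w) b H f → ∀ η, 0 < η → η ≤ 0.000000000001 → ParityUniform H f η →
      Transferred H B₀ f := by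
  obtain ⟨w₁, h1⟩ := mean_square_bounded_set (3001 + B₀) (by linarith)
  obtain ⟨w₂, h2⟩ := far_frequency_bound
  refine ⟨max w₁ w₂, fun w hw => ?_⟩
  filter_upwards [h1 w (le_trans (le_max_left _ _) hw), h2 w (le_trans (le_max_right _ _) hw),
    eventually_ge_atTop 1000] with H h3 h4 hH f b hf η hη hη1 hu
  have hH0 : (0 : ℝ) < H := by exact_mod_cast (by omega)
  have hnear : ∀ j ∈ nearFreq H,
    ‖expS H f ((j : ℝ) / (3 * H : ℕ)) - geo H ((j : ℝ) / (3 * H : ℕ))‖ ≤ 0.00000001 * H :=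
    fun j hj => hu.near_le hη hη1 hj
  refine ⟨hnear, ?_, ?_⟩
  · intro j hj
    simp only [farFreq, mem_filter, mem_range] at hj
    by_cases hh : |2 * (j : ℝ) - 3 * H| ≤ 1500
    · have := hu.half_le hη1 (by omega) hh
      linarith
    · have a1 := h4 f b hf j (by exact_mod_cast hj.2.1.le) (by
        rw [le_sub_iff_add_le]; exact_mod_cast hj.2.2.le) (by linarith)
      have a2 := hu.zero_ge hη hη1 (by omega)
      have a3 : (0.9999 * (H : ℝ)) ^ 2 ≤ ‖expS H f 0‖ ^ 2 := by gcongr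
      refine le_of_sq_le_sq ?_ (by positivity)
      nlinarith
  · intro L hL hc
    have hd : Disjoint L (nearFreq H) := by
      refine Disjoint.mono_left hL ?_
      exact disjoint_filter_filter_not _ _ _
    have a1 := h3 f b hf (L ∪ nearFreq H) (by
      apply union_subset (hL.trans (filter_subset _ _)) (filter_subset _ _)) (by
      rw [card_union_of_disjoint hd]
      have : (#(nearFreq H) : ℝ) ≤ 3001 := by exact_mod_cast card_nearFreq_le H
      push_cast
      linarith)
    rw [sum_union hd] at a1
    have a2 := near_energy hH hnear
    nlinarith

lemma Transferred.near_cube {H : ℕ} {B₀ : ℝ} {f₁ f₂ f₃ : ℕ → ℝ} (h₁ : Transferred H B₀ f₁)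
    (h₂ : Transferred H B₀ f₂) (h₃ : Transferred H B₀ f₃) {j : ℕ} (hj : j ∈ nearFreq H) :
    ‖expS H f₁ ((j : ℝ) / (3 * H : ℕ)) * expS H f₂ ((j : ℝ) / (3 * H : ℕ)) *
      expS H f₃ ((j : ℝ) / (3 * H : ℕ)) - geo H ((j : ℝ) / (3 * H : ℕ)) ^ 3‖ ≤ 0.00000007 * (H : ℝ) ^ 3 := by
  have a1 := h₁.near j hj
  have a2 := h₂.near j hj
  have a3 := h₃.near j hj
  have hg := norm_geo_le H ((j : ℝ) / (3 * H : ℕ))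
  generalize expS H f₁ ((j : ℝ) / (3 * H : ℕ)) = x at *
  generalize expS H f₂ ((j : ℝ) / (3 * H : ℕ)) = y at *
  generalize expS H f₃ ((j : ℝ) / (3 * H : ℕ)) = z at *
  generalize geo H ((j : ℝ) / (3 * H : ℕ)) = g at *
  have hH0 : (0 : ℝ) ≤ H := Nat.cast_nonneg _
  have b2 : ‖y‖ ≤ 2 * H := by
    have := norm_sub_norm_le y g
    linarith
  have b3 : ‖z‖ ≤ 2 * H := by
    have := norm_sub_norm_le z g
    linarith
  have e : x * y * z - g ^ 3 = (x - g) * y * z + g * (y - g) * z + g * g * (z - g) := by ring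
  rw [e]
  calc _ ≤ ‖x - g‖ * ‖y‖ * ‖z‖ + ‖g‖ * ‖y - g‖ * ‖z‖ + ‖g‖ * ‖g‖ * ‖z - g‖ := by
        refine (norm_add₃_le).trans ?_
        simp only [norm_mul, le_refl]
    _ ≤ (0.00000001 * H) * (2 * H) * (2 * H) + H * (0.00000001 * H) * (2 * H) + H * H * (0.00000001 * H) := by gcongr
    _ = _ := by ring

lemma mul_mul_le_cubes {a b c : ℝ} (ha : 0 ≤ a) (hb : 0 ≤ b) (hc : 0 ≤ c) :
    a * b * c ≤ (a ^ 3 + b ^ 3 + c ^ 3) / 3 := by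
  nlinarith [mul_nonneg (add_nonneg (add_nonneg ha hb) hc)
    (add_nonneg (add_nonneg (sq_nonneg (a - b)) (sq_nonneg (b - c))) (sq_nonneg (a - c)))]

lemma Transferred.far_cube {H : ℕ} {B₀ μ : ℝ} {f₁ f₂ f₃ : ℕ → ℝ} (h₁ : Transferred H B₀ f₁)
    (h₂ : Transferred H B₀ f₂) (h₃ : Transferred H B₀ f₃)
    (hsmall : ∀ f, f = f₁ ∨ f = f₂ ∨ f = f₃ →
      ∑ j ∈ (range (3 * H)).filter (fun j : ℕ => ‖expS H f ((j : ℝ) / (3 * H : ℕ))‖ < μ * H),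
        ‖expS H f ((j : ℝ) / (3 * H : ℕ))‖ ^ 3 ≤ 0.003 * (H : ℝ) ^ 3)
    (hlarge : ∀ f, f = f₁ ∨ f = f₂ ∨ f = f₃ →
      (#((range (3 * H)).filter fun j : ℕ => μ * H ≤ ‖expS H f ((j : ℝ) / (3 * H : ℕ))‖) : ℝ) ≤
        B₀ / 3) :
    ∑ j ∈ farFreq H, ‖expS H f₁ ((j : ℝ) / (3 * H : ℕ))‖ * ‖expS H f₂ ((j : ℝ) / (3 * H : ℕ))‖ *
      ‖expS H f₃ ((j : ℝ) / (3 * H : ℕ))‖ ≤ 2.174 * (H : ℝ) ^ 3 := by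
  set F : (ℕ → ℝ) → ℕ → ℝ := fun f j => ‖expS H f ((j : ℝ) / (3 * H : ℕ))‖ with hF
  have hF0 : ∀ f j, 0 ≤ F f j := fun f j => norm_nonneg _
  have hH0 : (0 : ℝ) ≤ H := Nat.cast_nonneg _
  set L : Finset ℕ := (farFreq H).filter fun j => μ * H ≤ F f₁ j ∨ μ * H ≤ F f₂ j ∨ μ * H ≤ F f₃ j with hL
  have hfar : farFreq H ⊆ range (3 * H) := filter_subset _ _
  have hLf : L ⊆ farFreq H := filter_subset _ _
  have hcard : (#L : ℝ) ≤ B₀ := by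
    have hsub : L ⊆ (range (3 * H)).filter (fun j => μ * H ≤ F f₁ j) ∪
        (range (3 * H)).filter (fun j => μ * H ≤ F f₂ j) ∪
        (range (3 * H)).filter (fun j => μ * H ≤ F f₃ j) := by
      intro j hj
      rw [hL, mem_filter] at hj
      have := hfar hj.1
      simp only [mem_union, mem_filter, this, true_and]
      tauto
    have c := (card_le_card hsub).trans ((card_union_le _ _).trans
      (Nat.add_le_add_right (card_union_le _ _) _))
    have c' : (#L : ℝ) ≤ #((range (3 * H)).filter (fun j => μ * H ≤ F f₁ j)) +
        #((range (3 * H)).filter (fun j => μ * H ≤ F f₂ j)) +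
        #((range (3 * H)).filter (fun j => μ * H ≤ F f₃ j)) := by exact_mod_cast c
    have := hlarge f₁ (by simp)
    have := hlarge f₂ (by simp)
    have := hlarge f₃ (by simp)
    linarith
  have e1 : ∑ j ∈ L, F f₁ j * F f₂ j * F f₃ j ≤ 0.714 * H * (3.04 * (H : ℝ) ^ 2) := by
    have s2 := h₂.square L hLf hcard
    have s3 := h₃.square L hLf hcard
    calc ∑ j ∈ L, F f₁ j * F f₂ j * F f₃ j
        ≤ ∑ j ∈ L, 0.714 * H * (1 / 2 * (F f₂ j ^ 2 + F f₃ j ^ 2)) := by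
          refine sum_le_sum fun j hj => ?_
          rw [mul_assoc]
          have h0 := mul_nonneg (hF0 f₂ j) (hF0 f₃ j)
          have := h₁.far j (hLf hj)
          refine mul_le_mul this ?_ h0 (by positivity)
          nlinarith [sq_nonneg (F f₂ j - F f₃ j)]
      _ = 0.714 * H * (1 / 2 * (∑ j ∈ L, F f₂ j ^ 2 + ∑ j ∈ L, F f₃ j ^ 2)) := by
          rw [← mul_sum, ← mul_sum, sum_add_distrib]
      _ ≤ _ := mul_le_mul_of_nonneg_left (by linarith) (by positivity)
  have e2 : ∑ j ∈ (farFreq H).filter (fun j => ¬ (μ * H ≤ F f₁ j ∨ μ * H ≤ F f₂ j ∨ μ * H ≤ F f₃ j)),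
      F f₁ j * F f₂ j * F f₃ j ≤ 0.003 * (H : ℝ) ^ 3 := by
    set K := (farFreq H).filter (fun j => ¬ (μ * H ≤ F f₁ j ∨ μ * H ≤ F f₂ j ∨ μ * H ≤ F f₃ j)) with hK
    have hk : ∀ f, f = f₁ ∨ f = f₂ ∨ f = f₃ → ∑ j ∈ K, F f j ^ 3 ≤ 0.003 * (H : ℝ) ^ 3 := by
      intro f hf
      refine le_trans (sum_le_sum_of_subset_of_nonneg ?_ fun j _ _ => by have := hF0 f j; positivity)
        (hsmall f hf)
      intro j hj
      rw [hK, mem_filter] at hj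
      rw [mem_filter]
      refine ⟨hfar hj.1, ?_⟩
      push Not at hj
      rcases hf with rfl | rfl | rfl
      · exact hj.2.1
      · exact hj.2.2.1
      · exact hj.2.2.2
    calc ∑ j ∈ K, F f₁ j * F f₂ j * F f₃ j
        ≤ ∑ j ∈ K, (F f₁ j ^ 3 + F f₂ j ^ 3 + F f₃ j ^ 3) / 3 :=
          sum_le_sum fun j _ => mul_mul_le_cubes (hF0 _ _) (hF0 _ _) (hF0 _ _)
      _ = (∑ j ∈ K, F f₁ j ^ 3 + ∑ j ∈ K, F f₂ j ^ 3 + ∑ j ∈ K, F f₃ j ^ 3) / 3 := by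
          rw [← sum_div, sum_add_distrib, sum_add_distrib]
      _ ≤ _ := by
          have := hk f₁ (by simp)
          have := hk f₂ (by simp)
          have := hk f₃ (by simp)
          linarith
  rw [← sum_filter_add_sum_filter_not (farFreq H)
    (fun j => μ * H ≤ F f₁ j ∨ μ * H ≤ F f₂ j ∨ μ * H ≤ F f₃ j)]
  have : 0 ≤ (H : ℝ) ^ 3 := by positivity
  nlinarith

lemma Transferred.triSum_pos {H M : ℕ} {B₀ : ℝ} {f₁ f₂ f₃ : ℕ → ℝ} (hH : 10000 ≤ H)
    (hM : 3 * H ≤ 2 * M) (hM' : 2 * M ≤ 3 * H + 6)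
    (h₁ : Transferred H B₀ f₁) (h₂ : Transferred H B₀ f₂) (h₃ : Transferred H B₀ f₃)
    (hfar : ∑ j ∈ farFreq H, ‖expS H f₁ ((j : ℝ) / (3 * H : ℕ))‖ *
      ‖expS H f₂ ((j : ℝ) / (3 * H : ℕ))‖ * ‖expS H f₃ ((j : ℝ) / (3 * H : ℕ))‖ ≤
        2.174 * (H : ℝ) ^ 3) :
    triSum H f₁ f₂ f₃ M ≠ 0 := by
  intro h0
  have hMH : M < 3 * H := by omega
  have hH0 : (0 : ℝ) < H := by exact_mod_cast (by omega)
  have hH1 : (10000 : ℝ) ≤ H := by exact_mod_cast hH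
  have e1 := triSum_fourier (by omega) hMH f₁ f₂ f₃
  have e2 := triSum_fourier (H := H) (by omega) hMH (fun _ => 1) (fun _ => 1) (fun _ => 1)
  rw [h0, Complex.ofReal_zero, mul_zero] at e1
  have e3 := congrArg₂ (· - ·) e1 e2
  simp only [expS_one] at e3
  rw [← sum_sub_distrib, zero_sub] at e3
  have e4 := congrArg norm e3
  rw [norm_neg, norm_mul, Complex.norm_natCast, Complex.norm_real] at e4
  have e5 : 2.22 * (H : ℝ) ^ 3 ≤ ((3 * H : ℕ) : ℝ) * ‖triSum H (fun _ => 1) (fun _ => 1) (fun _ => 1) M‖ := by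
    have := triSum_one_ge hH hM hM'
    calc 2.22 * (H : ℝ) ^ 3 = ((3 * H : ℕ) : ℝ) * (0.74 * (H : ℝ) ^ 2) := by push_cast; ring
      _ ≤ _ := by
        gcongr
        exact this.trans (Real.le_norm_self _)
  have e6 := norm_sum_le (range (3 * H)) (fun j : ℕ => expS H f₁ ((j : ℝ) / (3 * H : ℕ)) * expS H f₂ ((j : ℝ) / (3 * H : ℕ)) *
      expS H f₃ ((j : ℝ) / (3 * H : ℕ)) * ee (-(j * M / (3 * H : ℕ))) -
      geo H ((j : ℝ) / (3 * H : ℕ)) * geo H ((j : ℝ) / (3 * H : ℕ)) *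
      geo H ((j : ℝ) / (3 * H : ℕ)) * ee (-(j * M / (3 * H : ℕ))))
  rw [e4, ← sum_near_add_far] at e6
  have e7 : ∀ j : ℕ, ‖expS H f₁ ((j : ℝ) / (3 * H : ℕ)) * expS H f₂ ((j : ℝ) / (3 * H : ℕ)) *
      expS H f₃ ((j : ℝ) / (3 * H : ℕ)) * ee (-(j * M / (3 * H : ℕ))) -
      geo H ((j : ℝ) / (3 * H : ℕ)) * geo H ((j : ℝ) / (3 * H : ℕ)) *
      geo H ((j : ℝ) / (3 * H : ℕ)) * ee (-(j * M / (3 * H : ℕ)))‖ =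
      ‖expS H f₁ ((j : ℝ) / (3 * H : ℕ)) * expS H f₂ ((j : ℝ) / (3 * H : ℕ)) *
      expS H f₃ ((j : ℝ) / (3 * H : ℕ)) - geo H ((j : ℝ) / (3 * H : ℕ)) ^ 3‖ := by
    intro j
    rw [← sub_mul, norm_mul, norm_ee, mul_one]
    congr 1
    ring
  simp only [e7] at e6
  have n1 : ∑ j ∈ nearFreq H, ‖expS H f₁ ((j : ℝ) / (3 * H : ℕ)) * expS H f₂ ((j : ℝ) / (3 * H : ℕ)) *
      expS H f₃ ((j : ℝ) / (3 * H : ℕ)) - geo H ((j : ℝ) / (3 * H : ℕ)) ^ 3‖ ≤ 3001 * (0.00000007 * (H : ℝ) ^ 3) := by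
    refine (sum_le_card_nsmul _ _ _ fun j hj => h₁.near_cube h₂ h₃ hj).trans ?_
    rw [nsmul_eq_mul]
    have : (#(nearFreq H) : ℝ) ≤ 3001 := by exact_mod_cast card_nearFreq_le H
    gcongr
  have n2 : ∑ j ∈ farFreq H, ‖expS H f₁ ((j : ℝ) / (3 * H : ℕ)) * expS H f₂ ((j : ℝ) / (3 * H : ℕ)) *
      expS H f₃ ((j : ℝ) / (3 * H : ℕ)) - geo H ((j : ℝ) / (3 * H : ℕ)) ^ 3‖ ≤
      2.174 * (H : ℝ) ^ 3 + 0.001 * H * (0.003 * (H : ℝ) ^ 2) := by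
    calc _ ≤ ∑ j ∈ farFreq H, (‖expS H f₁ ((j : ℝ) / (3 * H : ℕ))‖ *
        ‖expS H f₂ ((j : ℝ) / (3 * H : ℕ))‖ * ‖expS H f₃ ((j : ℝ) / (3 * H : ℕ))‖ +
        0.001 * H * ‖geo H ((j : ℝ) / (3 * H : ℕ))‖ ^ 2) := by
          refine sum_le_sum fun j hj => (norm_sub_le _ _).trans ?_
          rw [norm_mul, norm_mul, norm_pow, pow_succ' _ 2]
          have := geo_far_le hj
          gcongr
      _ ≤ _ := by
          rw [sum_add_distrib, ← mul_sum]
          have := geo_far_sq_sum (H := H) (by omega)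
          gcongr
  have : 0 < (H : ℝ) ^ 3 := by positivity
  nlinarith

/-- The transference principle for ternary sums of weights majorised by the sieve. -/
theorem ternary_representation : ∃ w, 2 ≤ w ∧ ∃ η : ℝ, 0 < η ∧ ∀ᶠ H : ℕ in atTop,
    ∀ f₁ f₂ f₃ b₁ b₂ b₃, SieveWeight (primorial w) b₁ H f₁ → SieveWeight (primorial w) b₂ H f₂ →
      SieveWeight (primorial w) b₃ H f₃ → ParityUniform H f₁ η → ParityUniform H f₂ η →
      ParityUniform H f₃ η → ∀ M, 3 * H ≤ 2 * M → 2 * M ≤ 3 * H + 6 →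
      ∃ x y z, x < H ∧ y < H ∧ z < H ∧ x + y + z = M ∧ f₁ x ≠ 0 ∧ f₂ y ≠ 0 ∧ f₃ z ≠ 0 := by
  obtain ⟨C₁, hC₁, hlarge⟩ := level_set_bound
  obtain ⟨C₂, hC₂, hsmall⟩ := small_values_cube
  set μ : ℝ := (0.003 / C₂) ^ 2 with hμ
  have hμ0 : 0 < μ := by positivity
  have hμC : C₂ * μ ^ (0.5 : ℝ) = 0.003 := by
    rw [hμ, ← Real.rpow_natCast, ← Real.rpow_mul (by positivity)]
    norm_num
    field_simp
  set B₀ : ℝ := 3 * (C₁ * μ ^ (-(2.5) : ℝ)) with hB₀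
  obtain ⟨w₀, hw₀⟩ := exists_transferred B₀ (by positivity)
  have hW : 0 < primorial (max w₀ 2) := primorial_pos _
  have hμH : ∀ᶠ H : ℕ in atTop, (H : ℝ) ^ (-(0.1) : ℝ) ≤ μ :=
    ((tendsto_rpow_neg_atTop (by norm_num)).comp tendsto_natCast_atTop_atTop).eventually_le_const hμ0
  refine ⟨max w₀ 2, le_max_right _ _, 0.000000000001, by norm_num, ?_⟩
  filter_upwards [hlarge _ hW, hsmall _ hW μ hμ0, hμH, hw₀ _ (le_max_left _ _),
    eventually_ge_atTop 10000] with H k1 k2 k3 k4 hH f₁ f₂ f₃ b₁ b₂ b₃ s₁ s₂ s₃ u₁ u₂ u₃ M hM hM'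
  have t₁ := k4 f₁ b₁ s₁ _ (by norm_num) le_rfl u₁
  have t₂ := k4 f₂ b₂ s₂ _ (by norm_num) le_rfl u₂
  have t₃ := k4 f₃ b₃ s₃ _ (by norm_num) le_rfl u₃
  rw [hμC] at k2
  refine exists_of_triSum_ne_zero (t₁.triSum_pos hH hM hM' t₂ t₃ (t₁.far_cube (μ := μ) t₂ t₃ ?_ ?_))
  · rintro f (rfl | rfl | rfl)
    · exact k2 _ _ s₁
    · exact k2 _ _ s₂
    · exact k2 _ _ s₃
  · have e : B₀ / 3 = C₁ * μ ^ (-(2.5) : ℝ) := by rw [hB₀]; ring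
    rw [e]
    rintro f (rfl | rfl | rfl)
    · exact k1 _ _ s₁ _ k3
    · exact k1 _ _ s₂ _ k3
    · exact k1 _ _ s₃ _ k3

end Vino

namespace Vino

open Finset

lemma exists_unit_residues {W N : ℕ} (hW : Squarefree W) (hW2 : Even W) (hN : Odd N) (hWN : W < N) :
    ∃ b₂ b₃ M, b₂ < W ∧ b₃ < W ∧ b₂.Coprime W ∧ b₃.Coprime W ∧ N = 1 + b₂ + b₃ + W * M := by
  have hW0 : 0 < W := Nat.pos_of_ne_zero hW.ne_zero
  let a : ℕ → ℕ := fun p => if p ∣ N - 2 then 2 else 1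
  obtain ⟨x, hx⟩ := Nat.chineseRemainderOfFinset a id W.primeFactors
    (fun p hp => (Nat.prime_of_mem_primeFactors hp).ne_zero) (by
      intro p hp q hq hpq
      exact (Nat.coprime_primes (Nat.prime_of_mem_primeFactors hp)
        (Nat.prime_of_mem_primeFactors hq)).mpr hpq)
  have hN2 : 2 ≤ N := by
    have := hW2.two_dvd
    have := Nat.le_of_dvd hW0 this
    omega
  have hb : x % W < W := Nat.mod_lt _ hW0
  have hb3 : (N - 1 - x % W) % W < W := Nat.mod_lt _ hW0
  have hxp : ∀ p, p.Prime → p ∣ W → ¬ p ∣ x % W ∧ ¬ p ∣ N - 1 - x % W := by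
    intro p hp hpW
    have h1 : x ≡ a p [MOD p] := hx p (Nat.mem_primeFactors.mpr ⟨hp, hpW, hW0.ne'⟩)
    have h2 : x % W ≡ a p [MOD p] := (Nat.ModEq.of_dvd hpW (Nat.mod_modEq x W)).trans h1
    have h3 : p ∣ N - 2 → p ≠ 2 := by
      rintro h rfl
      obtain ⟨k, hk⟩ := hN
      omega
    have h4 : ¬ p ∣ a p := by
      simp only [a]
      split_ifs with h
      · exact fun h5 => h3 h ((Nat.prime_dvd_prime_iff_eq hp Nat.prime_two).mp h5)
      · exact hp.one_lt.ne' ∘ Nat.dvd_one.mp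
    refine ⟨fun h => h4 ((h2.dvd_iff dvd_rfl).mp h), fun h => ?_⟩
    have h5 : x % W ≡ N - 1 [MOD p] := (Nat.modEq_iff_dvd' (by omega)).mpr h
    have h6 : a p ≡ N - 1 [MOD p] := h2.symm.trans h5
    by_cases h : p ∣ N - 2
    · simp only [a, if_pos h] at h6
      have h7 : 1 ≡ N - 1 [MOD p] := (Nat.modEq_iff_dvd' (by omega)).mpr (by
        rwa [Nat.sub_sub])
      have h8 := (Nat.modEq_iff_dvd' (show 1 ≤ 2 by norm_num)).mp (h7.trans h6.symm)
      exact hp.one_lt.ne' (Nat.dvd_one.mp h8)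
    · simp only [a, if_neg h] at h6
      have h7 := (Nat.modEq_iff_dvd' (by omega)).mp h6
      rw [Nat.sub_sub] at h7
      exact h h7
  refine ⟨x % W, (N - 1 - x % W) % W, (N - 1 - x % W) / W, hb, hb3, ?_, ?_, ?_⟩
  · exact Nat.coprime_of_dvd fun p hp h1 h2 => (hxp p hp h2).1 h1
  · refine Nat.coprime_of_dvd fun p hp h1 h2 => (hxp p hp h2).2 ?_
    exact (Nat.dvd_mod_iff h2).mp h1
  · have := Nat.mod_add_div (N - 1 - x % W) W
    omega

lemma prime_of_primeWeight_ne_zero {W c n : ℕ} (h : primeWeight W c n ≠ 0) : (W * n + c).Prime := by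
  by_contra hp
  simp [primeWeight, lp, hp] at h

lemma squarefree_primorial (w : ℕ) : Squarefree (primorial w) :=
  squarefree_prod_of_pairwise_isCoprime
    (fun p hp q hq hpq => Nat.coprime_iff_isRelPrime.mp <| by
      simp only [coe_filter, Set.mem_ofPred_eq] at hp hq
      exact (Nat.coprime_primes hp.2 hq.2).mpr hpq)
    (fun p hp => (mem_filter.mp hp).2.squarefree)

/-- The three primes theorem with almost equal summands. -/
theorem three_almost_equal_primes (k : ℕ) (hk : 10 ≤ k) : ∀ᶠ N : ℕ in atTop, Odd N →
    ∃ p q r : ℕ, p.Prime ∧ q.Prime ∧ r.Prime ∧ p + q + r = N ∧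
      k * N ≤ 3 * k * p + 3 * N ∧ k * N ≤ 3 * k * q + 3 * N ∧ k * N ≤ 3 * k * r + 3 * N := by
  obtain ⟨w, hw, η, hη, htern⟩ := ternary_representation
  set W := primorial w with hWdef
  have hW0 : 0 < W := primorial_pos w
  have hW2 : Even W := by
    rw [even_iff_two_dvd, hWdef]
    exact dvd_prod_of_mem _ (mem_filter.mpr ⟨mem_range.mpr (by omega), Nat.prime_two⟩)
  have hsq : Squarefree W := squarefree_primorial w
  have hW2' : 2 ≤ W := Nat.le_of_dvd hW0 hW2.two_dvd
  have hdiv : Tendsto (fun N : ℕ => N / (k * W)) atTop atTop :=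
    Nat.tendsto_div_const_atTop (by positivity)
  filter_upwards [hdiv.eventually htern,
    hdiv.eventually (primeWeight_sieveWeight hW0 hW2 (k * W) hη),
    hdiv.eventually (eventually_ge_atTop (20 * k)), eventually_gt_atTop W] with N h1 h2 hH hN hodd
  obtain ⟨b₂, b₃, M, l2, l3, c2, c3, hsum⟩ := exists_unit_residues hsq hW2 hodd hN
  set H := N / (k * W) with hHdef
  have r1 : k * W * H ≤ N := Nat.mul_div_le N (k * W)
  have r2 : N < k * W * H + k * W := by
    have := Nat.lt_mul_div_succ N (show 0 < k * W by positivity)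
    rw [Nat.mul_succ] at this
    exact this
  have m1 : k * H ≤ M + 2 := by
    by_contra hc
    have : M + 3 ≤ k * H := by omega
    have : W * (M + 3) ≤ W * (k * H) := Nat.mul_le_mul_left _ this
    nlinarith
  have m2 : M ≤ k * H + k := by
    have : W * M < W * (k * H + k) := by nlinarith
    exact (Nat.lt_of_mul_lt_mul_left this).le
  have hkH : 10 * H ≤ k * H := Nat.mul_le_mul_right _ hk
  set T := (2 * M - 3 * H) / 6 with hT
  have t1 : 6 * T ≤ 2 * M - 3 * H := Nat.mul_div_le _ _
  have t2 : 2 * M - 3 * H < 6 * T + 6 := by omega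
  have t3 : 3 * (k * H) ≤ 9 * T + 5 * H + 20 := by omega
  have t4 : 2 * T + 2 ≤ k * H := by omega
  have hHT : H ≤ T := by omega
  have hWT : 2 * T ≤ W * T := Nat.mul_le_mul_right _ hW2'
  have key : ∀ b, b.Coprime W → b ≤ W → 1 ≤ b → SieveWeight W (W * T + b) H (primeWeight W (W * T + b)) ∧
      ParityUniform H (primeWeight W (W * T + b)) η := by
    intro b hb hbW hb1
    refine h2 _ (by omega) ?_ ?_
    · have : W * (T + 1) ≤ W * (k * H) := Nat.mul_le_mul_left _ (by omega)
      nlinarith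
    · rwa [Nat.coprime_mul_left_add_left]
  have pos : ∀ b, b.Coprime W → 1 ≤ b := by
    intro b hb
    rcases Nat.eq_zero_or_pos b with rfl | h
    · rw [Nat.coprime_zero_left] at hb
      omega
    · exact h
  have k1 := key 1 (Nat.coprime_one_left W) hW0 le_rfl
  have k2 := key b₂ c2 l2.le (pos _ c2)
  have k3 := key b₃ c3 l3.le (pos _ c3)
  obtain ⟨x, y, z, -, -, -, hxyz, hx, hy, hz⟩ := h1 _ _ _ _ _ _ k1.1 k2.1 k3.1 k1.2 k2.2 k3.2
    (M - 3 * T) (by omega) (by omega)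
  have big : ∀ n b, k * N ≤ 3 * k * (W * n + (W * T + b)) + 3 * N := by
    intro n b
    have a1 : k * N ≤ k * (k * W * H + k * W) := Nat.mul_le_mul_left _ r2.le
    have a2 : k * H + k ≤ 3 * T + 3 * H := by omega
    have a3 : k * W * (k * H + k) ≤ k * W * (3 * T + 3 * H) := Nat.mul_le_mul_left _ a2
    nlinarith [Nat.zero_le (k * W * n), Nat.zero_le (k * b)]
  refine ⟨_, _, _, prime_of_primeWeight_ne_zero hx, prime_of_primeWeight_ne_zero hy,
    prime_of_primeWeight_ne_zero hz, ?_, big _ _, big _ _, big _ _⟩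
  have e : M = x + y + z + 3 * T := by omega
  rw [hsum, e]
  ring

end Vino

namespace Vino

open Finset

lemma nthPrime_prime (n : ℕ) : (nthPrime n).Prime := Nat.prime_nth_prime _

lemma tendsto_nthPrime : Tendsto nthPrime atTop atTop :=
  (Nat.nth_strictMono Nat.infinite_setOfPred_prime).tendsto_atTop.comp (tendsto_sub_atTop_nat 1)

lemma frob_le (k : ℕ) (hk : 10 ≤ k) : ∀ᶠ n in atTop, (k - 3) * frob n ≤ (4 * k - 3) * nthPrime n := by
  obtain ⟨N₀, hN₀⟩ := eventually_atTop.mp (three_almost_equal_primes k hk)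
  filter_upwards [tendsto_nthPrime.eventually (eventually_ge_atTop (N₀ + 3))] with n hn
  have hp : (nthPrime n).Prime := nthPrime_prime n
  have hodd : Odd (nthPrime n) := hp.odd_of_ne_two (by omega)
  have hmem : ∀ q, q.Prime → nthPrime n ≤ q → q ∈ S n := fun q h1 h2 => AddSubmonoid.subset_closure ⟨h1, h2⟩
  obtain ⟨l, rfl⟩ := Nat.exists_eq_add_of_le hk
  generalize nthPrime n = p at *
  have hmem_odd : ∀ m, Odd m → N₀ ≤ m → 3 * (10 + l) * p ≤ (7 + l) * m → m ∈ S n := by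
    intro m ho hm hpm
    obtain ⟨a, b, c, ha, hb, hc, hs, h1, h2, h3⟩ := hN₀ m hm ho
    have key : ∀ q, (10 + l) * m ≤ 3 * (10 + l) * q + 3 * m → p ≤ q := by
      intro q hq
      have : 3 * (10 + l) * p ≤ 3 * (10 + l) * q := by linarith
      exact Nat.le_of_mul_le_mul_left this (by positivity)
    rw [← hs]
    exact add_mem (add_mem (hmem a ha (key a h1)) (hmem b hb (key b h2))) (hmem c hc (key c h3))
  have e1 : 10 + l - 3 = 7 + l := by omega
  have e2 : 4 * (10 + l) - 3 = 37 + 4 * l := by omega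
  rw [e1, e2, mul_comm, ← Nat.le_div_iff_mul_le (by omega)]
  refine csSup_le' fun m hm => ?_
  rw [Nat.le_div_iff_mul_le (by omega)]
  by_contra! hlt
  apply hm
  have hpm : p ≤ m := by nlinarith
  obtain ⟨d, rfl⟩ := Nat.exists_eq_add_of_le hpm
  have hd : 3 * (10 + l) * p ≤ (7 + l) * d := by nlinarith
  have hpd : p ≤ d := by nlinarith
  rcases Nat.even_or_odd (p + d) with he | ho
  · have : Odd d := by
      by_contra h
      rw [Nat.not_odd_iff_even] at h
      exact (Nat.not_even_iff_odd.mpr (hodd.add_even h)) he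
    exact add_mem (hmem p hp le_rfl) (hmem_odd d this (by omega) hd)
  · exact hmem_odd _ ho (by omega) (by nlinarith)

end Vino

theorem limsup_frob_div_p_le_four :
    Filter.limsup (fun n => (frob n : ℝ) / (nthPrime n : ℝ)) Filter.atTop ≤ 4 := by
  refine le_of_forall_pos_le_add fun ε hε => ?_
  obtain ⟨l, hl⟩ := exists_nat_ge (9 / ε)
  have hcob : IsCoboundedUnder (· ≤ ·) atTop (fun n => (frob n : ℝ) / (nthPrime n : ℝ)) :=
    isCoboundedUnder_le_of_le atTop (x := 0) fun n => by positivity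
  refine limsup_le_of_le hcob ?_
  filter_upwards [Vino.frob_le (10 + l) (by omega)] with n hn
  have hp : (0 : ℝ) < nthPrime n := by exact_mod_cast (Vino.nthPrime_prime n).pos
  rw [div_le_iff₀ hp]
  have e1 : 10 + l - 3 = 7 + l := by omega
  have e2 : 4 * (10 + l) - 3 = 4 * (7 + l) + 9 := by omega
  rw [e1, e2] at hn
  have h1 : (7 + l : ℝ) * frob n ≤ (4 * (7 + l) + 9) * nthPrime n := by exact_mod_cast hn
  rw [div_le_iff₀ hε] at hl
  have h2 : (9 : ℝ) ≤ (7 + l) * ε := by nlinarith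
  have h3 : (7 + l : ℝ) * frob n ≤ (7 + l) * ((4 + ε) * nthPrime n) := by nlinarith
  exact le_of_mul_le_mul_left h3 (by positivity)
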